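/- There exist positive constants δ*, C₁, C₂ such that the following holds. Let (ũ, v, θ̃, φ) be a solution of the reformulated PNPF system on [0, T], and assume ‖(ũ, v, θ̃)(t)‖_{H²} + ‖∇φ(t)‖_{L²} ≤ δ for all t ∈ [0, T] with δ ≤ δ*. Then for all t ∈ (0, T): (1/2)(d/dt)(‖∇(ũ, v)‖²_{L²} + 2c‖∇θ̃‖²_{L²}) + C₁‖∇²(ũ, v, θ̃)‖²_{L²} + C₁‖∇v‖²_{L²} ≤ C₂ δ (‖∇(ũ, v, θ̃)‖²_{L²} + ‖v‖²_{L²} + ‖∇φ‖²_{L²}). -/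

import Mathlib

open MeasureTheory Filter Topology Real

noncomputable section

/-- Euclidean space ℝ³. -/
abbrev E3 : Type := EuclideanSpace ℝ (Fin 3)

/-- The `i`-th partial derivative `∂ᵢ f`. -/
def pd (i : Fin 3) (f : E3 → ℝ) (x : E3) : ℝ :=
  fderiv ℝ f x (EuclideanSpace.single i 1)

/-- The Laplacian `Δf`. -/
def lap (f : E3 → ℝ) (x : E3) : ℝ := ∑ i : Fin 3, pd i (pd i f) x

/-- The dot product of gradients `∇f · ∇g`. -/
def gdot (f g : E3 → ℝ) (x : E3) : ℝ := ∑ i : Fin 3, pd i f x * pd i g x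

/-- The squared `L²(ℝ³)` norm of the `k`-th total spatial derivative `‖∇ᵏf‖_{L²}²`. -/
def Dsq (k : ℕ) (f : E3 → ℝ) : ℝ := ∫ x : E3, ‖iteratedFDeriv ℝ k f x‖ ^ 2

/-- The squared `H²(ℝ³)` norm `‖f‖_{H²}²`. -/
def H2sq (f : E3 → ℝ) : ℝ := Dsq 0 f + Dsq 1 f + Dsq 2 f

/-- A solution of the reformulated PNPF system on the time interval `[0, T]`:
smooth, with `2 + ũ > 0`, `φ` the Newtonian potential of `v` (so `Δφ = v`,
`φ → 0` at infinity), all spatial derivatives of order `≤ 3` square integrable,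
decay at spatial infinity, and the three evolution equations. -/
def IsRefSol (c T : ℝ) (u v θ φ : ℝ → E3 → ℝ) : Prop :=
  -- smoothness
  ContDiffOn ℝ (⊤ : ℕ∞) (fun q : ℝ × E3 => u q.1 q.2) (Set.Icc 0 T ×ˢ Set.univ) ∧
  ContDiffOn ℝ (⊤ : ℕ∞) (fun q : ℝ × E3 => v q.1 q.2) (Set.Icc 0 T ×ˢ Set.univ) ∧
  ContDiffOn ℝ (⊤ : ℕ∞) (fun q : ℝ × E3 => θ q.1 q.2) (Set.Icc 0 T ×ˢ Set.univ) ∧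
  ContDiffOn ℝ (⊤ : ℕ∞) (fun q : ℝ × E3 => φ q.1 q.2) (Set.Icc 0 T ×ˢ Set.univ) ∧
  -- positivity of 2 + ũ
  (∀ t ∈ Set.Icc (0 : ℝ) T, ∀ x : E3, 0 < 2 + u t x) ∧
  -- φ is the Newtonian potential of v
  (∀ t ∈ Set.Icc (0 : ℝ) T, ∀ x : E3,
      φ t x = -(1 / (4 * π)) * ∫ y : E3, v t y / ‖x - y‖) ∧
  -- spatial derivatives of order ≤ 3 lie in L²
  (∀ t ∈ Set.Icc (0 : ℝ) T, ∀ k ≤ 3,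
      Integrable (fun x : E3 => ‖iteratedFDeriv ℝ k (u t) x‖ ^ 2) ∧
      Integrable (fun x : E3 => ‖iteratedFDeriv ℝ k (v t) x‖ ^ 2) ∧
      Integrable (fun x : E3 => ‖iteratedFDeriv ℝ k (θ t) x‖ ^ 2) ∧
      Integrable (fun x : E3 => ‖iteratedFDeriv ℝ (k + 1) (φ t) x‖ ^ 2)) ∧
  -- decay at spatial infinity
  (∀ t ∈ Set.Icc (0 : ℝ) T,
      Tendsto (u t) (cocompact E3) (nhds 0) ∧
      Tendsto (v t) (cocompact E3) (nhds 0) ∧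
      Tendsto (θ t) (cocompact E3) (nhds 0) ∧
      Tendsto (φ t) (cocompact E3) (nhds 0)) ∧
  -- equation (i)
  (∀ t ∈ Set.Icc (0 : ℝ) T, ∀ x : E3,
      deriv (fun s => u s x) t =
        lap (u t) x + 2 * lap (θ t) x + θ t x * lap (u t) x + u t x * lap (θ t) x
          + 2 * gdot (θ t) (u t) x - gdot (v t) (φ t) x - (v t x) ^ 2) ∧
  -- equation (ii)
  (∀ t ∈ Set.Icc (0 : ℝ) T, ∀ x : E3,
      deriv (fun s => v s x) t =
        lap (v t) x - 2 * v t x + θ t x * lap (v t) x + v t x * lap (θ t) x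
          + 2 * gdot (θ t) (v t) x - gdot (u t) (φ t) x - u t x * v t x) ∧
  -- equation (iii)
  (∀ t ∈ Set.Icc (0 : ℝ) T, ∀ x : E3,
      c * deriv (fun s => θ s x) t =
        (3 / 2) * lap (θ t) x + (1 / 2) * lap (u t) x + θ t x * lap (θ t) x
          - (u t x / (2 * (2 + u t x))) * lap (θ t) x
          + ((2 * (θ t x) ^ 2 + 4 * θ t x - u t x) / (2 * (2 + u t x))) * lap (u t) x
          + (c + 1) * gdot (θ t) (θ t) x
          + (c + 3) * ((1 + θ t x) / (2 + u t x)) * gdot (u t) (θ t) x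
          - 2 * ((1 + θ t x) / (2 + u t x)) * gdot (v t) (φ t) x
          - (c + 2) * (v t x / (2 + u t x)) * gdot (θ t) (φ t) x
          - ((1 + θ t x) / (2 + u t x)) * (v t x) ^ 2
          + gdot (φ t) (φ t) x)

open scoped ContDiff

/-! ### Partial derivatives -/

lemma contDiff_pd {f : E3 → ℝ} (hf : ContDiff ℝ ∞ f) (i : Fin 3) : ContDiff ℝ ∞ (pd i f) :=
  (hf.fderiv_right (m := ∞) (by simp)).clm_apply contDiff_const

lemma ContDiff.differentiable_infty {f : E3 → ℝ} (hf : ContDiff ℝ ∞ f) : Differentiable ℝ f :=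
  hf.differentiable (by simp)

lemma pd_sub {f g : E3 → ℝ} (hf : ContDiff ℝ ∞ f) (hg : ContDiff ℝ ∞ g) (i : Fin 3) :
    pd i (fun x => f x - g x) = fun x => pd i f x - pd i g x := by
  ext x
  simp only [pd]
  rw [fderiv_fun_sub hf.differentiable_infty.differentiableAt
    hg.differentiable_infty.differentiableAt]
  rfl

lemma pd_mul {f g : E3 → ℝ} (hf : ContDiff ℝ ∞ f) (hg : ContDiff ℝ ∞ g) (i : Fin 3) :
    pd i (fun x => f x * g x) = fun x => f x * pd i g x + pd i f x * g x := by
  ext x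
  simp only [pd]
  rw [fderiv_fun_mul hf.differentiable_infty.differentiableAt
    hg.differentiable_infty.differentiableAt]
  simp [mul_comm]

lemma pd_add {f g : E3 → ℝ} (hf : ContDiff ℝ ∞ f) (hg : ContDiff ℝ ∞ g) (i : Fin 3) :
    pd i (fun x => f x + g x) = fun x => pd i f x + pd i g x := by
  ext x
  simp only [pd]
  rw [fderiv_fun_add hf.differentiable_infty.differentiableAt
    hg.differentiable_infty.differentiableAt]
  rfl

lemma pd_translate (f : E3 → ℝ) (a : E3) (i : Fin 3) :
    pd i (fun x => f (x + a)) = fun x => pd i f (x + a) := by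
  ext x
  simp only [pd]
  rw [fderiv_comp_add_right]

lemma pd_comm {f : E3 → ℝ} (hf : ContDiff ℝ ∞ f) (i j : Fin 3) :
    pd i (pd j f) = pd j (pd i f) := by
  have h2 : ∀ (i j : Fin 3) (x : E3), pd i (pd j f) x =
      fderiv ℝ (fderiv ℝ f) x (EuclideanSpace.single i 1) (EuclideanSpace.single j 1) := by
    intro i j x
    have hd : DifferentiableAt ℝ (fderiv ℝ f) x :=
      ((hf.fderiv_right (m := ∞) (by simp)).differentiable (by simp)).differentiableAt
    change fderiv ℝ (fun y => fderiv ℝ f y (EuclideanSpace.single j 1)) x _ = _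
    rw [fderiv_clm_apply hd (by fun_prop)]
    simp
  ext x
  rw [h2, h2]
  have := (hf.contDiffAt (x := x)).isSymmSndFDerivAt
    (by simpa using ENat.LEInfty.out)
  exact this _ _

/-! ### Square integrability -/

lemma MeasureTheory.MemLp.integrable_mul_two {f g : E3 → ℝ} (hf : MemLp f 2) (hg : MemLp g 2) :
    Integrable (fun x => f x * g x) := hf.integrable_mul hg

/-- `L2Reg n f`: `f` is smooth and its partial derivatives of order at most `n` lie in `L²`. -/
def L2Reg : ℕ → (E3 → ℝ) → Prop
  | 0, f => ContDiff ℝ ∞ f ∧ MemLp f 2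
  | n + 1, f => ContDiff ℝ ∞ f ∧ MemLp f 2 ∧ ∀ i, L2Reg n (pd i f)

namespace L2Reg

variable {n : ℕ} {f g : E3 → ℝ}

lemma smooth (h : L2Reg n f) : ContDiff ℝ ∞ f := by
  cases n <;> exact h.1

lemma memLp (h : L2Reg n f) : MemLp f 2 := by
  cases n
  · exact h.2
  · exact h.2.1

lemma pderiv (h : L2Reg (n + 1) f) (i : Fin 3) : L2Reg n (pd i f) := h.2.2 i

lemma of_succ (h : L2Reg (n + 1) f) : L2Reg n f := by
  induction n generalizing f with
  | zero => exact ⟨h.smooth, h.memLp⟩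
  | succ n ih => exact ⟨h.smooth, h.memLp, fun i => ih (h.pderiv i)⟩

lemma sub (hf : L2Reg n f) (hg : L2Reg n g) : L2Reg n (fun x => f x - g x) := by
  induction n generalizing f g with
  | zero => exact ⟨hf.smooth.sub hg.smooth, hf.memLp.sub hg.memLp⟩
  | succ n ih =>
    refine ⟨hf.smooth.sub hg.smooth, hf.memLp.sub hg.memLp, fun i => ?_⟩
    rw [pd_sub hf.smooth hg.smooth]
    exact ih (hf.pderiv i) (hg.pderiv i)

lemma translate (hf : L2Reg n f) (a : E3) : L2Reg n (fun x => f (x + a)) := by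
  induction n generalizing f with
  | zero =>
    exact ⟨hf.smooth.comp (contDiff_id.add contDiff_const),
      hf.memLp.comp_measurePreserving (measurePreserving_add_right volume a)⟩
  | succ n ih =>
    refine ⟨hf.smooth.comp (contDiff_id.add contDiff_const),
      hf.memLp.comp_measurePreserving (measurePreserving_add_right volume a), fun i => ?_⟩
    rw [pd_translate]
    exact ih (hf.pderiv i)

end L2Reg

/-- The integral of the square. -/
def isq (f : E3 → ℝ) : ℝ := ∫ x, f x ^ 2

/-- The sum of the squared `L²` norms of the first partial derivatives. -/
def gradSq (f : E3 → ℝ) : ℝ := ∑ i, isq (pd i f)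

/-- The sum of the squared `L²` norms of the second partial derivatives. -/
def hessSq (f : E3 → ℝ) : ℝ := ∑ i, ∑ j, isq (pd i (pd j f))

lemma isq_nonneg (f : E3 → ℝ) : 0 ≤ isq f := integral_nonneg fun _ => sq_nonneg _

lemma gradSq_nonneg (f : E3 → ℝ) : 0 ≤ gradSq f := Finset.sum_nonneg fun _ _ => isq_nonneg _

lemma hessSq_nonneg (f : E3 → ℝ) : 0 ≤ hessSq f :=
  Finset.sum_nonneg fun _ _ => Finset.sum_nonneg fun _ _ => isq_nonneg _

lemma isq_pd_le_gradSq (f : E3 → ℝ) (i : Fin 3) : isq (pd i f) ≤ gradSq f :=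
  Finset.single_le_sum (f := fun i => isq (pd i f)) (fun _ _ => isq_nonneg _) (Finset.mem_univ i)

lemma isq_pd_pd_le_hessSq (f : E3 → ℝ) (i j : Fin 3) : isq (pd i (pd j f)) ≤ hessSq f :=
  (Finset.single_le_sum (f := fun j => isq (pd i (pd j f))) (fun _ _ => isq_nonneg _)
    (Finset.mem_univ j)).trans
  (Finset.single_le_sum (f := fun i => ∑ j, isq (pd i (pd j f)))
    (fun _ _ => Finset.sum_nonneg fun _ _ => isq_nonneg _) (Finset.mem_univ i))

lemma isq_translate (f : E3 → ℝ) (a : E3) : isq (fun x => f (x + a)) = isq f :=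
  integral_add_right_eq_self (fun x => f x ^ 2) a

/-- Integration by parts along a coordinate direction. -/
lemma integral_mul_pd {f g : E3 → ℝ} {i : Fin 3} (hf : ContDiff ℝ ∞ f) (hg : ContDiff ℝ ∞ g)
    (h1 : Integrable (fun x => pd i f x * g x)) (h2 : Integrable (fun x => f x * pd i g x))
    (h3 : Integrable (fun x => f x * g x)) :
    ∫ x, f x * pd i g x = - ∫ x, pd i f x * g x :=
  integral_mul_fderiv_eq_neg_fderiv_mul_of_integrable h1 h2 h3
    (fun _ _ => hf.differentiable_infty.differentiableAt)
    (fun _ _ => hg.differentiable_infty.differentiableAt)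

lemma L2Reg.ibp {f g : E3 → ℝ} (hf : L2Reg 1 f) (hg : L2Reg 1 g) (i : Fin 3) :
    ∫ x, f x * pd i g x = - ∫ x, pd i f x * g x :=
  integral_mul_pd hf.smooth hg.smooth ((hf.pderiv i).memLp.integrable_mul_two hg.memLp)
    (hf.memLp.integrable_mul_two (hg.pderiv i).memLp) (hf.memLp.integrable_mul_two hg.memLp)

lemma L2Reg.memLp_lap {f : E3 → ℝ} (hf : L2Reg 2 f) : MemLp (lap f) 2 :=
  memLp_finsetSum (p := 2) Finset.univ (f := fun i : Fin 3 => pd i (pd i f))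
    fun i _ => ((hf.pderiv i).pderiv i).memLp

/-- The `L²` norm of the Laplacian controls all second derivatives. -/
lemma L2Reg.hessSq_eq {f : E3 → ℝ} (hf : L2Reg 3 f) : hessSq f = isq (lap f) := by
  have key : ∀ i j, isq (pd i (pd j f)) =
      ∫ x, pd i (pd i f) x * pd j (pd j f) x := by
    intro i j
    have h1 := L2Reg.ibp (hf.pderiv i).of_succ ((hf.pderiv j).pderiv j) i
    have h2 := L2Reg.ibp ((hf.pderiv j).pderiv i) (hf.pderiv i).of_succ j
    have e1 : pd i (pd j (pd j f)) =
        pd j (pd i (pd j f)) := pd_comm (hf.pderiv j).smooth i j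
    have e2 : pd j (pd i f) = pd i (pd j f) := pd_comm hf.smooth j i
    rw [e1] at h1
    rw [e2] at h2
    calc isq (pd i (pd j f))
        = ∫ x, pd i (pd j f) x * pd i (pd j f) x := by
          simp [isq, sq]
      _ = - ∫ x, pd i f x * pd j (pd i (pd j f)) x := by
          rw [h2]; simp [mul_comm]
      _ = _ := by rw [h1]; simp
  have hint : ∀ i j, Integrable
      (fun x => pd i (pd i f) x * pd j (pd j f) x) := fun i j =>
    ((hf.of_succ.pderiv i).pderiv i).memLp.integrable_mul_two ((hf.of_succ.pderiv j).pderiv j).memLp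
  simp only [hessSq, key]
  rw [show isq (lap f) = ∫ x, ∑ i, ∑ j,
      pd i (pd i f) x * pd j (pd j f) x by
    simp only [isq, lap, sq, Finset.sum_mul_sum]]
  rw [integral_finsetSum _ fun i _ => integrable_finsetSum _ fun j _ => hint i j]
  exact Finset.sum_congr rfl fun i _ => (integral_finsetSum _ fun j _ => hint i j).symm

/-- `∫ f Δf = -‖∇f‖²`. -/
lemma L2Reg.integral_mul_lap {f : E3 → ℝ} (hf : L2Reg 2 f) :
    ∫ x, f x * lap f x = - gradSq f := by
  have h : ∀ i, ∫ x, f x * pd i (pd i f) x = - isq (pd i f) := fun i => by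
    rw [L2Reg.ibp hf.of_succ (hf.pderiv i) i]; simp [isq, sq]
  simp only [lap, Finset.mul_sum]
  rw [integral_finsetSum _ fun i _ => hf.memLp.integrable_mul_two ((hf.pderiv i).pderiv i).memLp]
  simp [h, gradSq]

/-- The interpolation inequality `‖∂ᵢf‖₄² ≤ 3 ‖f‖_∞ ‖∂ᵢ²f‖₂`. -/
lemma integral_pd_pow_four_le {f : E3 → ℝ} (hf : L2Reg 2 f) {M N : ℝ} (hM : ∀ x, |f x| ≤ M)
    (i : Fin 3) (hN : ∀ x, |pd i f x| ≤ N) :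
    Integrable (fun x => pd i f x ^ 4) ∧
      ∫ x, pd i f x ^ 4 ≤ 9 * M ^ 2 * isq (pd i (pd i f)) := by
  have hg := contDiff_pd hf.smooth i
  have hsq : Integrable (fun x => pd i f x ^ 2) := (hf.pderiv i).memLp.integrable_sq
  have hsq2 : Integrable (fun x => pd i (pd i f) x ^ 2) := ((hf.pderiv i).pderiv i).memLp.integrable_sq
  have i4 : Integrable (fun x => pd i f x ^ 4) := by
    refine (hsq.const_mul (N ^ 2)).mono' (hg.continuous.pow 4).aestronglyMeasurable
      (ae_of_all _ fun x => ?_)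
    have : pd i f x ^ 2 ≤ N ^ 2 := sq_le_sq' (neg_le_of_abs_le (hN x)) (le_of_abs_le (hN x))
    rw [Real.norm_eq_abs, abs_of_nonneg (by positivity)]
    nlinarith [sq_nonneg (pd i f x)]
  have hpow : pd i (fun x => pd i f x ^ 3) = fun x => 3 * pd i f x ^ 2 * pd i (pd i f) x := by
    ext x
    rw [pd]
    rw [fderiv_fun_pow 3 hg.differentiable_infty.differentiableAt]
    simp [pd]
  have i3 : Integrable (fun x => f x * pd i (fun x => pd i f x ^ 3) x) := by
    rw [hpow]
    have := ((hf.pderiv i).memLp.integrable_mul_two ((hf.pderiv i).pderiv i).memLp).norm.const_mul (3 * M * N)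
    refine this.mono' (by
      have := hf.smooth.continuous
      have := hg.continuous
      have := (contDiff_pd hg i).continuous
      exact Continuous.aestronglyMeasurable (by fun_prop)) (ae_of_all _ fun x => ?_)
    simp only [norm_mul, norm_pow, Real.norm_eq_abs, abs_of_pos (three_pos : (0:ℝ) < 3)]
    have h1 := hM x
    have h2 := hN x
    calc |f x| * (3 * |pd i f x| ^ 2 * |pd i (pd i f) x|)
        = 3 * (|f x| * |pd i f x|) * (|pd i f x| * |pd i (pd i f) x|) := by ring
      _ ≤ 3 * (M * N) * (|pd i f x| * |pd i (pd i f) x|) := by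
        have := (abs_nonneg _).trans h1
        gcongr
      _ = _ := by ring
  have ibp := integral_mul_pd (i := i) hf.smooth (hg.pow 3)
    (by simpa [pow_succ, mul_comm, mul_assoc, mul_left_comm] using i4) i3
    (by
      refine ((hf.memLp.integrable_mul_two (hf.pderiv i).memLp).norm.const_mul (N ^ 2)).mono'
        (hf.smooth.continuous.mul (hg.continuous.pow 3)).aestronglyMeasurable
        (ae_of_all _ fun x => ?_)
      have h2 : |pd i f x| ^ 2 ≤ N ^ 2 := by gcongr; exact hN x
      simp only [norm_mul, norm_pow, Real.norm_eq_abs]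
      calc |f x| * |pd i f x| ^ 3 = |pd i f x| ^ 2 * (|f x| * |pd i f x|) := by ring
        _ ≤ _ := by gcongr)
  refine ⟨i4, ?_⟩
  have e : ∫ x, pd i f x ^ 4 = ∫ x, pd i f x * pd i f x ^ 3 := by
    congr 1; ext x; ring
  have hle : ∫ x, pd i f x ^ 4 ≤
      ∫ x, (1 / 2 * pd i f x ^ 4 + 9 * M ^ 2 / 2 * pd i (pd i f) x ^ 2) := by
    rw [e, ← neg_eq_iff_eq_neg.mpr ibp, ← integral_neg]
    refine integral_mono i3.neg ((i4.const_mul _).add (hsq2.const_mul _)) fun x => ?_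
    rw [hpow]
    simp only
    have h1 : -(f x * (3 * pd i f x ^ 2 * pd i (pd i f) x)) ≤
        3 * M * (pd i f x ^ 2 * |pd i (pd i f) x|) := by
      refine (neg_le_abs _).trans ?_
      simp only [abs_mul, abs_pow, sq_abs, abs_of_pos (three_pos : (0:ℝ) < 3)]
      nlinarith [mul_le_mul_of_nonneg_right (hM x)
        (mul_nonneg (sq_nonneg (pd i f x)) (abs_nonneg (pd i (pd i f) x)))]
    nlinarith [sq_nonneg (pd i f x ^ 2 - 3 * M * |pd i (pd i f) x|), sq_abs (pd i (pd i f) x)]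
  rw [integral_add (i4.const_mul _) (hsq2.const_mul _), integral_const_mul,
    integral_const_mul] at hle
  simp only [isq]
  linarith

/-! ### The Sobolev embedding `H² ⊂ L^∞` in dimension three -/

section Sobolev

open scoped SchwartzMap FourierTransform LineDeriv

/-- `g - Δg` for a Schwartz function `g`. -/
def oneSubLap (g : 𝓢(E3, ℂ)) : 𝓢(E3, ℂ) :=
  g - ∑ i : Fin 3, ∂_{(EuclideanSpace.single i (1 : ℝ) : E3)}
    (∂_{(EuclideanSpace.single i (1 : ℝ) : E3)} g)

lemma fourier_oneSubLap (g : 𝓢(E3, ℂ)) (ξ : E3) :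
    𝓕 (oneSubLap g) ξ = ((1 + 4 * π ^ 2 * ‖ξ‖ ^ 2 : ℝ) : ℂ) * 𝓕 g ξ := by
  have hcoord : ∀ i : Fin 3, 𝓕 (∂_{(EuclideanSpace.single i (1 : ℝ) : E3)}
      (∂_{(EuclideanSpace.single i (1 : ℝ) : E3)} g)) ξ =
      -(4 * π ^ 2 * (ξ i : ℂ) ^ 2) * 𝓕 g ξ := by
    intro i
    have ht : (fun x : E3 => inner ℝ x (EuclideanSpace.single i (1 : ℝ) : E3)).HasTemperateGrowth :=
      ((innerSL ℝ).flip _).hasTemperateGrowth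
    simp only [SchwartzMap.fourier_lineDerivOp_eq, smul_apply,
      SchwartzMap.smulLeftCLM_apply_apply ht]
    simp [EuclideanSpace.inner_single_right]
    ring_nf
    simp
  have hsum : (‖ξ‖ ^ 2 : ℝ) = ∑ i, ξ i ^ 2 := EuclideanSpace.real_norm_sq_eq ξ
  rw [hsum]
  have : 𝓕 (oneSubLap g) = 𝓕 g - ∑ i : Fin 3, 𝓕 (∂_{(EuclideanSpace.single i (1 : ℝ) : E3)}
      (∂_{(EuclideanSpace.single i (1 : ℝ) : E3)} g)) := by
    rw [oneSubLap, ← SchwartzMap.fourierTransformCLM_apply (𝕜 := ℂ), map_sub, map_sum]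
    simp
  rw [this]
  simp only [Fin.sum_univ_three, sub_apply, add_apply, hcoord]
  push_cast
  ring

lemma exists_norm_apply_zero_sq_le :
    ∃ A > (0 : ℝ), ∀ g : 𝓢(E3, ℂ), ‖g 0‖ ^ 2 ≤ A * ∫ x, ‖oneSubLap g x‖ ^ 2 := by
  set w : E3 → ℝ := fun ξ => ((1 : ℝ) + ‖ξ‖ ^ 2) ^ (-(4 : ℝ) / 2) with hw
  have hwi : Integrable w := integrable_rpow_neg_one_add_norm_sq (by simp; norm_num)
  have hw' : ∀ ξ, w ξ = ((1 + ‖ξ‖ ^ 2)⁻¹) ^ 2 := by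
    intro ξ
    simp only [hw]
    rw [show (-(4 : ℝ) / 2) = -((2 : ℕ) : ℝ) by norm_num, Real.rpow_neg (by positivity),
      Real.rpow_natCast, inv_pow]
  set A := ∫ ξ, w ξ with hA
  have hA0 : 0 ≤ A := integral_nonneg fun ξ => by rw [hw']; positivity
  refine ⟨A + 1, by positivity, fun g => ?_⟩
  set G := 𝓕 (oneSubLap g) with hG
  have hGi : Integrable (fun ξ => ‖G ξ‖ ^ 2) := by
    have : MemLp (fun ξ => G ξ) 2 := G.memLp 2
    exact this.integrable_norm_pow (by simp)
  have hpl : ∫ ξ, ‖G ξ‖ ^ 2 = ∫ x, ‖oneSubLap g x‖ ^ 2 := SchwartzMap.integral_norm_sq_fourier _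
  have hg0 : ‖g 0‖ ≤ ∫ ξ, ‖𝓕 g ξ‖ := by
    have h : g = 𝓕⁻ (𝓕 g) := (FourierTransform.fourierInv_fourier_eq g).symm
    have h0 : g 0 = (𝓕⁻ ((𝓕 g : 𝓢(E3, ℂ)) : E3 → ℂ)) 0 := by
      conv_lhs => rw [h]
      rw [SchwartzMap.fourierInv_coe]
    rw [h0, Real.fourierInv_eq']
    refine (norm_integral_le_integral_norm _).trans (le_of_eq ?_)
    simp
  have hpt : ∀ ξ, ‖𝓕 g ξ‖ ≤ (1 + ‖ξ‖ ^ 2)⁻¹ * ‖G ξ‖ := by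
    intro ξ
    rw [hG, fourier_oneSubLap, norm_mul, Complex.norm_real, Real.norm_eq_abs,
      abs_of_pos (by positivity), ← mul_assoc]
    refine le_mul_of_one_le_left (norm_nonneg _) ?_
    rw [inv_mul_eq_div, one_le_div (by positivity)]
    nlinarith [Real.pi_gt_three, sq_nonneg ‖ξ‖, mul_nonneg (sq_nonneg ‖ξ‖)
      (by nlinarith [Real.pi_gt_three] : (0:ℝ) ≤ 4 * π ^ 2 - 1)]
  set B := ∫ ξ, ‖G ξ‖ ^ 2 with hB
  have hB0 : 0 ≤ B := integral_nonneg fun ξ => by positivity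
  have hlam : ∀ r > 0, ‖g 0‖ ≤ 1 / 2 * (r * A + r⁻¹ * B) := by
    intro r hr
    refine hg0.trans ?_
    have hi : Integrable (fun ξ => 1 / 2 * (r * w ξ + r⁻¹ * ‖G ξ‖ ^ 2)) :=
      ((hwi.const_mul r).add (hGi.const_mul r⁻¹)).const_mul _
    have : ∫ ξ, ‖𝓕 g ξ‖ ≤ ∫ ξ, 1 / 2 * (r * w ξ + r⁻¹ * ‖G ξ‖ ^ 2) := by
      refine integral_mono (𝓕 g).integrable.norm hi fun ξ => ?_
      refine (hpt ξ).trans ?_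
      simp only [hw']
      have : 0 ≤ r⁻¹ * (r * (1 + ‖ξ‖ ^ 2)⁻¹ - ‖G ξ‖) ^ 2 := by positivity
      have e : r⁻¹ * (r * (1 + ‖ξ‖ ^ 2)⁻¹ - ‖G ξ‖) ^ 2 =
        r * ((1 + ‖ξ‖ ^ 2)⁻¹) ^ 2 + r⁻¹ * ‖G ξ‖ ^ 2 - 2 * ((1 + ‖ξ‖ ^ 2)⁻¹ * ‖G ξ‖) := by
        field_simp
        ring
      linarith
    refine this.trans (le_of_eq ?_)
    rw [integral_const_mul, integral_add (hwi.const_mul r) (hGi.const_mul r⁻¹),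
      integral_const_mul, integral_const_mul]
  rw [← hpl]
  rcases hB0.eq_or_lt with h0 | h0
  · rw [← h0, mul_zero]
    have : ‖g 0‖ ≤ 0 := by
      refine le_of_forall_pos_le_add fun e he => ?_
      have := hlam (e / (A + 1)) (by positivity)
      rw [← h0] at this
      have h2 : e / (A + 1) * A ≤ e := by
        rw [div_mul_eq_mul_div, div_le_iff₀ (by positivity)]; nlinarith
      linarith
    have h3 : ‖g 0‖ = 0 := le_antisymm this (norm_nonneg _)
    rw [h3]; simp
  · have hs : 0 < √(A + 1) := Real.sqrt_pos.2 (by positivity)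
    have hs2 : 0 < √B := Real.sqrt_pos.2 h0
    have h1 := hlam (√B / √(A + 1)) (by positivity)
    have e1 : √B / √(A + 1) * A ≤ √B * √(A + 1) := by
      rw [div_mul_eq_mul_div, div_le_iff₀ hs, mul_assoc, Real.mul_self_sqrt (by positivity)]
      gcongr; linarith
    have e2 : (√B / √(A + 1))⁻¹ * B = √B * √(A + 1) := by
      rw [inv_div, div_mul_eq_mul_div, div_eq_iff hs2.ne', mul_comm √B, mul_assoc,
        Real.mul_self_sqrt hB0]
    have h2 : ‖g 0‖ ≤ √B * √(A + 1) := by linarith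
    calc ‖g 0‖ ^ 2 ≤ (√B * √(A + 1)) ^ 2 := by gcongr
      _ = _ := by rw [mul_pow, Real.sq_sqrt hB0, Real.sq_sqrt (by positivity)]; ring

lemma lineDerivOp_of_real {g : 𝓢(E3, ℂ)} {h : E3 → ℝ} (hh : ContDiff ℝ ∞ h)
    (hg : ∀ y, g y = (h y : ℂ)) (i : Fin 3) (y : E3) :
    (∂_{(EuclideanSpace.single i (1 : ℝ) : E3)} g) y = (pd i h y : ℂ) := by
  have e : (g : E3 → ℂ) = fun y => (h y : ℂ) := funext hg
  rw [SchwartzMap.lineDerivOp_apply_eq_fderiv, e]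
  have := (Complex.ofRealCLM.hasFDerivAt (x := h y)).comp y
    (hh.differentiable_infty y).hasFDerivAt
  have h2 : HasFDerivAt (fun y => (h y : ℂ)) (Complex.ofRealCLM.comp (fderiv ℝ h y)) y := this
  rw [h2.fderiv]
  rfl

/-- The Sobolev embedding: a function in `H²(ℝ³)` is bounded by its `H²` norm. -/
lemma exists_sobolev : ∃ K > (0 : ℝ), ∀ f : E3 → ℝ, L2Reg 2 f → ∀ x,
    f x ^ 2 ≤ K ^ 2 * (isq f + gradSq f + hessSq f) := by
  obtain ⟨A, hA, hAg⟩ := exists_norm_apply_zero_sq_le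
  let η : ContDiffBump (0 : E3) := ⟨1, 2, one_pos, one_lt_two⟩
  have hη : ContDiff ℝ ∞ (η : E3 → ℝ) := η.contDiff
  have hηc : HasCompactSupport (η : E3 → ℝ) := η.hasCompactSupport
  have hpc : ∀ {f : E3 → ℝ} (i : Fin 3), HasCompactSupport f → HasCompactSupport (pd i f) :=
    fun i hf => hf.fderiv_apply ℝ _
  have hbd : ∀ {f : E3 → ℝ}, ContDiff ℝ ∞ f → HasCompactSupport f → ∃ M, ∀ x, |f x| ≤ M :=
    fun hf hc => hf.continuous.bounded_above_of_compact_support hc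
  obtain ⟨M0, hM0⟩ := hbd hη hηc
  choose M1 hM1 using fun i => hbd (contDiff_pd hη i) (hpc i hηc)
  choose M2 hM2 using fun i => hbd (contDiff_pd (contDiff_pd hη i) i) (hpc i (hpc i hηc))
  have hM0' : 0 ≤ M0 := (abs_nonneg _).trans (hM0 0)
  have hM1' : ∀ i, 0 ≤ M1 i := fun i => (abs_nonneg _).trans (hM1 i 0)
  have hM2' : ∀ i, 0 ≤ M2 i := fun i => (abs_nonneg _).trans (hM2 i 0)
  set M := 1 + M0 + ∑ i, M2 i + 2 * ∑ i, M1 i with hM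
  have hMpos : 0 < M := by
    have := Finset.sum_nonneg fun i (_ : i ∈ Finset.univ) => hM1' i
    have := Finset.sum_nonneg fun i (_ : i ∈ Finset.univ) => hM2' i
    positivity
  refine ⟨√(7 * A) * M, by positivity, fun f hf x => ?_⟩
  set F : E3 → ℝ := fun y => f (y + x) with hF
  have hFr : L2Reg 2 F := hf.translate x
  set h : E3 → ℝ := fun y => η y * F y with hh
  have hhs : ContDiff ℝ ∞ h := hη.mul hFr.smooth
  have hhc : HasCompactSupport h := hηc.mul_right
  have hcs : HasCompactSupport (fun y => (h y : ℂ)) := hhc.comp_left (g := fun r : ℝ => (r : ℂ)) rfl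
  have hcd : ContDiff ℝ ∞ (fun y => (h y : ℂ)) := Complex.ofRealCLM.contDiff.comp hhs
  set g : 𝓢(E3, ℂ) := hcs.toSchwartzMap hcd with hg
  have hgh : ∀ y, g y = (h y : ℂ) := fun y => rfl
  have hG : ∀ y, oneSubLap g y = ((h y - lap h y : ℝ) : ℂ) := by
    intro y
    have h2 : ∀ i : Fin 3, (∂_{(EuclideanSpace.single i (1 : ℝ) : E3)}
        (∂_{(EuclideanSpace.single i (1 : ℝ) : E3)} g)) y = (pd i (pd i h) y : ℂ) := fun i =>
      lineDerivOp_of_real (contDiff_pd hhs i) (lineDerivOp_of_real hhs hgh i) i y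
    simp only [oneSubLap, sub_apply, hgh, lap, Fin.sum_univ_three,
      add_apply, h2]
    push_cast
    ring
  have hpp : ∀ i y, pd i (pd i h) y =
      η y * pd i (pd i F) y + 2 * (pd i η y * pd i F y) + pd i (pd i η) y * F y := by
    intro i y
    rw [hh, pd_mul hη hFr.smooth i, pd_add (hη.mul (contDiff_pd hFr.smooth i))
      ((contDiff_pd hη i).mul hFr.smooth), pd_mul hη (contDiff_pd hFr.smooth i),
      pd_mul (contDiff_pd hη i) hFr.smooth]
    ring
  have hptb : ∀ y, |h y - lap h y| ≤
      M * (|F y| + ∑ i, |pd i F y| + ∑ i, |pd i (pd i F) y|) := by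
    intro y
    have ehy : h y = η y * F y := rfl
    simp only [lap, hpp, Fin.sum_univ_three, ehy]
    have b0 := hM0 y
    have t : ∀ {a b c : ℝ}, |a| ≤ b → |a * c| ≤ b * |c| := fun hab => by
      rw [abs_mul]; gcongr
    have h0 := t (c := F y) b0
    have h1 := fun i => t (c := pd i F y) (hM1 i y)
    have h2 := fun i => t (c := F y) (hM2 i y)
    have h3 := fun i => t (c := pd i (pd i F) y) b0
    have n1 := abs_nonneg (F y)
    have n2 := fun i => abs_nonneg (pd i F y)
    have n3 := fun i => abs_nonneg (pd i (pd i F) y)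
    have c0 : M0 + M2 0 + M2 1 + M2 2 ≤ M := by
      simp only [hM, Fin.sum_univ_three]; linarith [hM1' 0, hM1' 1, hM1' 2]
    have c1 : ∀ i, 2 * M1 i ≤ M := by
      intro i
      have s1 := Finset.single_le_sum (fun i _ => hM1' i) (Finset.mem_univ i)
      have s2 := Finset.sum_nonneg fun i (_ : i ∈ Finset.univ) => hM2' i
      linarith
    have c2 : M0 ≤ M := by
      simp only [hM, Fin.sum_univ_three]
      linarith [hM1' 0, hM1' 1, hM1' 2, hM2' 0, hM2' 1, hM2' 2]
    have k0 := mul_le_mul_of_nonneg_right c0 n1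
    have k1 := fun i => mul_le_mul_of_nonneg_right (c1 i) (n2 i)
    have k2 := fun i => mul_le_mul_of_nonneg_right c2 (n3 i)
    have := abs_le.mp h0
    have := abs_le.mp (h1 0)
    have := abs_le.mp (h1 1)
    have := abs_le.mp (h1 2)
    have := abs_le.mp (h2 0)
    have := abs_le.mp (h2 1)
    have := abs_le.mp (h2 2)
    have := abs_le.mp (h3 0)
    have := abs_le.mp (h3 1)
    have := abs_le.mp (h3 2)
    have := k1 0
    have := k1 1
    have := k1 2
    have := k2 0
    have := k2 1
    have := k2 2
    rw [abs_le]
    constructor <;> linarith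
  have hsq : ∀ y, ‖oneSubLap g y‖ ^ 2 ≤
      7 * M ^ 2 * (F y ^ 2 + ∑ i, pd i F y ^ 2 + ∑ i, pd i (pd i F) y ^ 2) := by
    intro y
    rw [hG, Complex.norm_real, Real.norm_eq_abs]
    have h1 : |h y - lap h y| ^ 2 ≤
        (M * (|F y| + ∑ i, |pd i F y| + ∑ i, |pd i (pd i F) y|)) ^ 2 := by
      gcongr; exact hptb y
    refine h1.trans ?_
    rw [mul_pow]
    have e : ∀ a0 a1 a2 a3 a4 a5 a6 : ℝ, (a0 + (a1 + a2 + a3) + (a4 + a5 + a6)) ^ 2 ≤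
        7 * (a0 ^ 2 + (a1 ^ 2 + a2 ^ 2 + a3 ^ 2) + (a4 ^ 2 + a5 ^ 2 + a6 ^ 2)) := by
      intro a0 a1 a2 a3 a4 a5 a6
      have := sq_sum_le_card_mul_sum_sq (s := (Finset.univ : Finset (Fin 7)))
        (f := ![a0, a1, a2, a3, a4, a5, a6])
      simp [Fin.sum_univ_succ] at this
      nlinarith
    have := e |F y| |pd 0 F y| |pd 1 F y| |pd 2 F y| |pd 0 (pd 0 F) y| |pd 1 (pd 1 F) y|
      |pd 2 (pd 2 F) y|
    simp only [sq_abs] at this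
    simp only [Fin.sum_univ_three]
    calc _ ≤ M ^ 2 * _ := mul_le_mul_of_nonneg_left this (sq_nonneg M)
      _ = _ := by ring
  have i0 : Integrable (fun y => F y ^ 2) := hFr.memLp.integrable_sq
  have i1 : ∀ i, Integrable (fun y => pd i F y ^ 2) := fun i => (hFr.pderiv i).memLp.integrable_sq
  have i2 : ∀ i, Integrable (fun y => pd i (pd i F) y ^ 2) := fun i =>
    ((hFr.pderiv i).pderiv i).memLp.integrable_sq
  have is1 : Integrable (fun y => ∑ i, pd i F y ^ 2) := integrable_finsetSum _ fun i _ => i1 i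
  have is2 : Integrable (fun y => ∑ i, pd i (pd i F) y ^ 2) :=
    integrable_finsetSum _ fun i _ => i2 i
  have i01 : Integrable (fun y => F y ^ 2 + ∑ i, pd i F y ^ 2) := i0.add is1
  have hint : ∫ y, ‖oneSubLap g y‖ ^ 2 ≤ 7 * M ^ 2 * (isq F + gradSq F + hessSq F) := by
    calc ∫ y, ‖oneSubLap g y‖ ^ 2
        ≤ ∫ y, 7 * M ^ 2 * (F y ^ 2 + ∑ i, pd i F y ^ 2 + ∑ i, pd i (pd i F) y ^ 2) := by
          refine integral_mono_of_nonneg (ae_of_all _ fun y => by positivity)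
            ((i01.add is2).const_mul _) (ae_of_all _ hsq)
      _ = 7 * M ^ 2 * (isq F + gradSq F + ∑ i, isq (pd i (pd i F))) := by
          rw [integral_const_mul, integral_add i01 is2, integral_add i0 is1,
            integral_finsetSum _ fun i _ => i1 i, integral_finsetSum _ fun i _ => i2 i]
          rfl
      _ ≤ _ := by
          gcongr
          exact Finset.sum_le_sum fun i _ => Finset.single_le_sum
            (f := fun j => isq (pd i (pd j F))) (fun _ _ => isq_nonneg _) (Finset.mem_univ i)
  have etr : isq F + gradSq F + hessSq F = isq f + gradSq f + hessSq f := by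
    simp only [gradSq, hessSq, hF, pd_translate]
    rw [isq_translate]
    simp only [isq_translate (pd _ f), isq_translate (pd _ (pd _ f))]
  have hg0 : ‖g 0‖ ^ 2 = f x ^ 2 := by
    rw [hgh, Complex.norm_real]
    have : η (0 : E3) = 1 := η.one_of_mem_closedBall (by simp [η])
    simp [hh, hF, this]
  calc f x ^ 2 ≤ A * ∫ y, ‖oneSubLap g y‖ ^ 2 := hg0 ▸ hAg g
    _ ≤ A * (7 * M ^ 2 * (isq F + gradSq F + hessSq F)) := by gcongr
    _ = _ := by rw [etr, mul_pow, Real.sq_sqrt (by positivity)]; ring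

end Sobolev

/-! ### Gradient bounds for the Newtonian potential -/

/-- The Newtonian potential of `w`. -/
def newton (w : E3 → ℝ) (x : E3) : ℝ := -(1 / (4 * π)) * ∫ y, w y / ‖x - y‖

/-- `w` is controlled by `m` in `L^∞` and in `L²`. -/
structure BddBy (m : ℝ) (w : E3 → ℝ) : Prop where
  cont : Continuous w
  memLp : MemLp w 2
  pos : 0 < m
  abs_le : ∀ x, |w x| ≤ m
  isq_le : isq w ≤ m ^ 2

lemma integrable_radial_kernel :
    Integrable (fun z : E3 => (‖z‖ ^ 2)⁻¹ * (1 + ‖z‖ ^ 2)⁻¹) := by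
  have := integrable_fun_norm_addHaar (volume : Measure E3)
    (f := fun r : ℝ => (r ^ 2)⁻¹ * (1 + r ^ 2)⁻¹)
  rw [this]
  refine (integrable_inv_one_add_sq.integrableOn (s := Set.Ioi 0)).congr_fun ?_
    measurableSet_Ioi
  intro r hr
  have : r ≠ 0 := ne_of_gt hr
  simp
  field_simp

lemma exists_integral_div_sq_le : ∃ C > (0 : ℝ), ∀ (m : ℝ) (w : E3 → ℝ), BddBy m w → ∀ x,
    Integrable (fun y => |w y| * (‖x - y‖ ^ 2)⁻¹) ∧
      ∫ y, |w y| * (‖x - y‖ ^ 2)⁻¹ ≤ C * m := by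
  set k : E3 → ℝ := fun z => (‖z‖ ^ 2)⁻¹ * (1 + ‖z‖ ^ 2)⁻¹ with hk
  have hki : Integrable k := integrable_radial_kernel
  have hk0 : 0 ≤ ∫ z, k z := integral_nonneg fun z => by simp only [hk]; positivity
  refine ⟨2 * (∫ z, k z) + 1, by positivity, fun m w hw x => ?_⟩
  have hm := hw.pos
  have hkx : Integrable (fun y => k (x - y)) := hki.comp_sub_left x
  have hsq : Integrable (fun y => w y ^ 2) := hw.memLp.integrable_sq
  have hdom : Integrable (fun y => 2 * m * k (x - y) + m⁻¹ * w y ^ 2) :=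
    (hkx.const_mul _).add (hsq.const_mul _)
  have hpt : ∀ y, |w y| * (‖x - y‖ ^ 2)⁻¹ ≤ 2 * m * k (x - y) + m⁻¹ * w y ^ 2 := by
    intro y
    simp only [hk]
    generalize ‖x - y‖ ^ 2 = r, sq_nonneg ‖x - y‖ = hr at *
    rcases hr.eq_or_lt with h0 | h0
    · rw [← h0]; simp; positivity
    · have hwm := hw.abs_le y
      rw [← sq_abs (w y)]
      have ha := abs_nonneg (w y)
      generalize |w y| = a at *
      have e : 2 * m * (r⁻¹ * (1 + r)⁻¹) + m⁻¹ * a ^ 2 - a * r⁻¹ =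
          (2 * m ^ 2 + a ^ 2 * r * (1 + r) - a * m * (1 + r)) / (m * r * (1 + r)) := by
        field_simp
      have : 0 ≤ (2 * m ^ 2 + a ^ 2 * r * (1 + r) - a * m * (1 + r)) / (m * r * (1 + r)) := by
        refine div_nonneg ?_ (by positivity)
        nlinarith [sq_nonneg (2 * a * r - m), mul_nonneg ha (sub_nonneg.2 hwm),
          mul_nonneg (mul_nonneg ha ha) h0.le, sq_nonneg (a * r - m),
          mul_nonneg (sub_nonneg.2 hwm) hm.le]
      linarith
  have hmeas : AEStronglyMeasurable (fun y => |w y| * (‖x - y‖ ^ 2)⁻¹) := by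
    have := hw.cont
    have : Measurable (fun y => |w y| * (‖x - y‖ ^ 2)⁻¹) :=
      this.measurable.abs.mul
        (((continuous_const.sub continuous_id).norm.pow 2).measurable.inv)
    exact this.aestronglyMeasurable
  have hint : Integrable (fun y => |w y| * (‖x - y‖ ^ 2)⁻¹) :=
    hdom.mono' hmeas (ae_of_all _ fun y => by
      rw [Real.norm_of_nonneg (by positivity)]; exact hpt y)
  refine ⟨hint, (integral_mono hint hdom hpt).trans ?_⟩
  rw [integral_add (hkx.const_mul _) (hsq.const_mul _), integral_const_mul, integral_const_mul,
    integral_sub_left_eq_self k]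
  have : m⁻¹ * ∫ y, w y ^ 2 ≤ m := by
    rw [inv_mul_le_iff₀ hm]
    have := hw.isq_le
    simp only [isq] at this
    linarith
  linarith

lemma abs_inv_sub_inv_le {a b d : ℝ} (ha : 0 ≤ a) (hb : 0 ≤ b) (h : |a - b| ≤ d) :
    |a⁻¹ - b⁻¹| ≤ d * ((a ^ 2)⁻¹ + (b ^ 2)⁻¹) := by
  have hd := (abs_nonneg _).trans h
  rcases ha.eq_or_lt with rfl | ha
  · rcases hb.eq_or_lt with rfl | hb
    · simp
    · have : b ≤ d := by simpa [abs_of_pos hb] using h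
      simp only [inv_zero, zero_sub, abs_neg, abs_of_pos (inv_pos.2 hb)]
      rw [← sub_nonneg]
      have e : d * (((0:ℝ) ^ 2)⁻¹ + (b ^ 2)⁻¹) - b⁻¹ = (d - b) / b ^ 2 := by
        field_simp
        simp
      rw [e]
      exact div_nonneg (by linarith) (by positivity)
  · rcases hb.eq_or_lt with rfl | hb
    · have : a ≤ d := by simpa [abs_of_pos ha] using h
      simp only [inv_zero, sub_zero, abs_of_pos (inv_pos.2 ha)]
      rw [← sub_nonneg]
      have e : d * ((a ^ 2)⁻¹ + ((0:ℝ) ^ 2)⁻¹) - a⁻¹ = (d - a) / a ^ 2 := by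
        field_simp
        simp
      rw [e]
      exact div_nonneg (by linarith) (by positivity)
    · have e : a⁻¹ - b⁻¹ = -(a - b) * (a⁻¹ * b⁻¹) := by field_simp; ring
      rw [e, abs_mul, abs_neg, abs_of_pos (by positivity : 0 < a⁻¹ * b⁻¹)]
      have : a⁻¹ * b⁻¹ ≤ (a ^ 2)⁻¹ + (b ^ 2)⁻¹ := by
        rw [← inv_pow, ← inv_pow]
        nlinarith [sq_nonneg (a⁻¹ - b⁻¹), sq_nonneg (a⁻¹), sq_nonneg b⁻¹]
      gcongr

lemma exists_newton_lipschitz : ∃ C > (0 : ℝ), ∀ (m : ℝ) (w : E3 → ℝ), BddBy m w → ∀ x x',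
    Integrable (fun y => w y / ‖x - y‖ - w y / ‖x' - y‖) ∧
      |newton w x - newton w x'| ≤ C * m * ‖x - x'‖ := by
  obtain ⟨C, hC, h⟩ := exists_integral_div_sq_le
  refine ⟨2 * C, by positivity, fun m w hw x x' => ?_⟩
  have hm := hw.pos
  obtain ⟨i1, b1⟩ := h m w hw x
  obtain ⟨i2, b2⟩ := h m w hw x'
  have hdom : Integrable (fun y => ‖x - x'‖ * (|w y| * (‖x - y‖ ^ 2)⁻¹ +
      |w y| * (‖x' - y‖ ^ 2)⁻¹)) := (i1.add i2).const_mul _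
  have hpt : ∀ y, |w y / ‖x - y‖ - w y / ‖x' - y‖| ≤ ‖x - x'‖ * (|w y| * (‖x - y‖ ^ 2)⁻¹ +
      |w y| * (‖x' - y‖ ^ 2)⁻¹) := by
    intro y
    have e : w y / ‖x - y‖ - w y / ‖x' - y‖ = w y * (‖x - y‖⁻¹ - ‖x' - y‖⁻¹) := by ring
    rw [e, abs_mul]
    have := abs_inv_sub_inv_le (norm_nonneg (x - y)) (norm_nonneg (x' - y)) (d := ‖x - x'‖)
      (by simpa using abs_norm_sub_norm_le (x - y) (x' - y))
    calc |w y| * |‖x - y‖⁻¹ - ‖x' - y‖⁻¹| ≤ |w y| * _ :=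
          mul_le_mul_of_nonneg_left this (abs_nonneg _)
      _ = _ := by ring
  have hmeas : AEStronglyMeasurable (fun y => w y / ‖x - y‖ - w y / ‖x' - y‖) := by
    have hc := hw.cont.measurable
    have hn : ∀ x : E3, Measurable (fun y => ‖x - y‖) := fun x =>
      (continuous_const.sub continuous_id).norm.measurable
    exact ((hc.div (hn x)).sub (hc.div (hn x'))).aestronglyMeasurable
  have hint : Integrable (fun y => w y / ‖x - y‖ - w y / ‖x' - y‖) :=
    hdom.mono' hmeas (ae_of_all _ hpt)
  refine ⟨hint, ?_⟩
  have hD : |∫ y, (w y / ‖x - y‖ - w y / ‖x' - y‖)| ≤ 2 * C * m * ‖x - x'‖ := by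
    refine (abs_integral_le_integral_abs).trans ((integral_mono hint.abs hdom hpt).trans ?_)
    rw [integral_const_mul, integral_add i1 i2]
    calc _ ≤ ‖x - x'‖ * (C * m + C * m) := by gcongr
      _ = _ := by ring
  have hπ : |-(1 / (4 * π))| ≤ 1 := by
    rw [abs_neg, abs_of_pos (by positivity), div_le_one (by positivity)]
    linarith [Real.pi_gt_three]
  have hpos : 0 ≤ 2 * C * m * ‖x - x'‖ := by positivity
  by_cases hx : Integrable (fun y => w y / ‖x - y‖)
  · have hx' : Integrable (fun y => w y / ‖x' - y‖) := by
      refine (hx.sub hint).congr (ae_of_all _ fun y => ?_)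
      simp
    rw [newton, newton, ← mul_sub, ← integral_sub hx hx', abs_mul]
    calc _ ≤ 1 * (2 * C * m * ‖x - x'‖) := by gcongr
      _ = _ := one_mul _
  · have hx' : ¬ Integrable (fun y => w y / ‖x' - y‖) := fun h' => hx (by
      refine (h'.add hint).congr (ae_of_all _ fun y => ?_)
      simp)
    rw [newton, newton, integral_undef hx, integral_undef hx']
    simpa using hpos

lemma abs_pd_le_of_lipschitz {f : E3 → ℝ} {C : ℝ} (hC : 0 ≤ C)
    (h : ∀ x x', |f x - f x'| ≤ C * ‖x - x'‖) (i : Fin 3) (x : E3) : |pd i f x| ≤ C := by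
  have h1 := norm_fderiv_le_of_lip' ℝ hC (f := f) (x₀ := x)
    (Eventually.of_forall fun y => h y x)
  have h2 := (fderiv ℝ f x).le_opNorm (EuclideanSpace.single i 1)
  simp only [PiLp.norm_single, norm_one, mul_one] at h2
  exact h2.trans h1

/-- Gradient bounds for a Newtonian potential and for its translation differences. -/
lemma exists_abs_pd_newton_le : ∃ C > (0 : ℝ), ∀ (m : ℝ) (w φ : E3 → ℝ), BddBy m w →
    (∀ x, φ x = newton w x) → ContDiff ℝ ∞ φ →
    (∀ i x, |pd i φ x| ≤ C * m) ∧
    ∀ (a : E3) (m' : ℝ), BddBy m' (fun x => w (x + a) - w x) →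
      ∀ i x, |pd i φ (x + a) - pd i φ x| ≤ C * m' := by
  obtain ⟨C, hC, h⟩ := exists_newton_lipschitz
  refine ⟨C, hC, fun m w φ hw hφ hs => ?_⟩
  have hm := hw.pos
  obtain rfl : φ = newton w := funext hφ
  refine ⟨fun i x => abs_pd_le_of_lipschitz (by positivity) (fun x x' => (h m w hw x x').2) i x,
    fun a m' hw' i x => ?_⟩
  have hm' := hw'.pos
  have e : pd i (newton w) (x + a) - pd i (newton w) x =
      pd i (fun x => newton w (x + a) - newton w x) x := by
    rw [pd_sub (f := fun x => newton w (x + a)) (hs.comp (contDiff_id.add contDiff_const)) hs,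
      pd_translate]
  rw [e]
  refine abs_pd_le_of_lipschitz (by positivity) ?_ i x
  have htr : ∀ x, (fun y => w (y + a) / ‖x - y‖) =
      fun y => (fun z => w z / ‖(x + a) - z‖) (y + a) := by
    intro x; ext y; simp
  have hshift : ∀ x, newton w (x + a) = -(1 / (4 * π)) * ∫ y, w (y + a) / ‖x - y‖ := by
    intro x
    rw [htr, integral_add_right_eq_self (fun z => w z / ‖(x + a) - z‖), newton]
  by_cases h0 : Integrable (fun y => w y / ‖(0 : E3) - y‖)
  · have hall : ∀ x, Integrable (fun y => w y / ‖x - y‖) := fun x =>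
      (h0.add (h m w hw x 0).1).congr (ae_of_all _ fun y => by simp)
    have hall' : ∀ x, Integrable (fun y => w (y + a) / ‖x - y‖) := fun x => by
      rw [htr]; exact (hall (x + a)).comp_add_right a
    have en : ∀ x, newton w (x + a) - newton w x = newton (fun x => w (x + a) - w x) x := by
      intro x
      rw [hshift, newton, newton, ← mul_sub, ← integral_sub (hall' x) (hall x)]
      simp [sub_div]
    intro x x'
    rw [en, en]
    exact (h m' _ hw' x x').2
  · have hall : ∀ x, newton w x = 0 := fun x => by
      have : ¬ Integrable (fun y => w y / ‖x - y‖) := fun hx => h0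
        ((hx.add (h m w hw 0 x).1).congr (ae_of_all _ fun y => by simp))
      rw [newton, integral_undef this, mul_zero]
    intro x x'
    simp only [hall, sub_self, abs_zero]
    positivity

/-! ### Difference quotients -/

/-- The `i`-th coordinate vector. -/
def ei (i : Fin 3) : E3 := EuclideanSpace.single i 1

lemma hasDerivAt_add_smul_ei {g : E3 → ℝ} (hg : ContDiff ℝ ∞ g) (i : Fin 3) (x : E3) (h s : ℝ) :
    HasDerivAt (fun s : ℝ => g (x + (s * h) • ei i)) (h * pd i g (x + (s * h) • ei i)) s := by
  have h1 : HasDerivAt (fun s : ℝ => x + (s * h) • ei i) (h • ei i) s := by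
    simpa using (((hasDerivAt_id s).mul_const h).smul_const (ei i)).const_add x
  have h2 := (hg.differentiable_infty (x + (s * h) • ei i)).hasFDerivAt.comp_hasDerivAt s h1
  rw [map_smul, smul_eq_mul] at h2
  exact h2

lemma sq_intervalIntegral_le {p : ℝ → ℝ} (hp : Continuous p) :
    (∫ s in (0:ℝ)..1, p s) ^ 2 ≤ ∫ s in (0:ℝ)..1, p s ^ 2 := by
  set A := ∫ s in (0:ℝ)..1, p s with hA
  have i1 : IntervalIntegrable p volume 0 1 := hp.intervalIntegrable _ _
  have i2 : IntervalIntegrable (fun s => p s ^ 2) volume 0 1 := (hp.pow 2).intervalIntegrable _ _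
  have : 0 ≤ ∫ s in (0:ℝ)..1, (p s - A) ^ 2 :=
    intervalIntegral.integral_nonneg zero_le_one fun _ _ => sq_nonneg _
  have e : ∫ s in (0:ℝ)..1, (p s - A) ^ 2 =
      ∫ s in (0:ℝ)..1, (p s ^ 2 - 2 * A * p s + A ^ 2) := by
    congr 1; ext s; ring
  rw [e, intervalIntegral.integral_add (i2.sub (i1.const_mul _)) (by simp),
    intervalIntegral.integral_sub i2 (i1.const_mul _), intervalIntegral.integral_const_mul,
    ← hA] at this
  simp at this
  nlinarith

lemma sq_translate_sub_le {g : E3 → ℝ} (hg : ContDiff ℝ ∞ g) (i : Fin 3) (h : ℝ) (x : E3) :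
    (g (x + h • ei i) - g x) ^ 2 ≤
      h ^ 2 * ∫ s in (0:ℝ)..1, pd i g (x + (s * h) • ei i) ^ 2 := by
  have hc : Continuous fun s : ℝ => pd i g (x + (s * h) • ei i) :=
    (contDiff_pd hg i).continuous.comp (by fun_prop)
  have h1 := intervalIntegral.integral_eq_sub_of_hasDerivAt (a := 0) (b := 1)
    (fun s _ => hasDerivAt_add_smul_ei hg i x h s)
    ((continuous_const.mul hc).intervalIntegrable _ _)
  simp only [one_mul, zero_mul, zero_smul, add_zero, intervalIntegral.integral_const_mul] at h1
  rw [← h1, mul_pow]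
  exact mul_le_mul_of_nonneg_left (sq_intervalIntegral_le hc) (sq_nonneg h)

lemma isq_translate_sub_le {g : E3 → ℝ} (hg : ContDiff ℝ ∞ g) (i : Fin 3)
    (hi : MemLp (pd i g) 2) (h : ℝ) :
    isq (fun x => g (x + h • ei i) - g x) ≤ h ^ 2 * isq (pd i g) := by
  have hpc := (contDiff_pd hg i).continuous
  have hcont : Continuous fun q : E3 × ℝ => pd i g (q.1 + (q.2 * h) • ei i) ^ 2 :=
    (hpc.comp (by fun_prop)).pow 2
  have hsq : Integrable (fun x => pd i g x ^ 2) := hi.integrable_sq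
  have hl : ∫⁻ x, ENNReal.ofReal ((g (x + h • ei i) - g x) ^ 2) ≤
      ENNReal.ofReal (h ^ 2 * isq (pd i g)) := by
    calc ∫⁻ x, ENNReal.ofReal ((g (x + h • ei i) - g x) ^ 2)
        ≤ ∫⁻ x, ENNReal.ofReal (h ^ 2) *
            ∫⁻ s in Set.Ioc (0:ℝ) 1, ENNReal.ofReal (pd i g (x + (s * h) • ei i) ^ 2) := by
          refine lintegral_mono fun x => ?_
          have hcx : Continuous fun s : ℝ => pd i g (x + (s * h) • ei i) ^ 2 :=
            (hpc.comp (by fun_prop)).pow 2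
          rw [← ofReal_integral_eq_lintegral_ofReal
            ((hcx.intervalIntegrable 0 1).1) (ae_of_all _ fun _ => sq_nonneg _),
            ← ENNReal.ofReal_mul (sq_nonneg h), ← intervalIntegral.integral_of_le zero_le_one]
          exact ENNReal.ofReal_le_ofReal (sq_translate_sub_le hg i h x)
      _ = ENNReal.ofReal (h ^ 2) * ∫⁻ s in Set.Ioc (0:ℝ) 1,
            ∫⁻ x, ENNReal.ofReal (pd i g (x + (s * h) • ei i) ^ 2) := by
          rw [lintegral_const_mul' _ _ ENNReal.ofReal_ne_top, lintegral_lintegral_swap]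
          exact (hcont.measurable.ennreal_ofReal).aemeasurable
      _ = ENNReal.ofReal (h ^ 2) * ∫⁻ s in Set.Ioc (0:ℝ) 1, ENNReal.ofReal (isq (pd i g)) := by
          congr 2; ext s
          rw [lintegral_add_right_eq_self (fun x => ENNReal.ofReal (pd i g x ^ 2)), isq,
            ofReal_integral_eq_lintegral_ofReal hsq (ae_of_all _ fun _ => sq_nonneg _)]
      _ = _ := by
          rw [setLIntegral_const, Real.volume_Ioc]
          simp [ENNReal.ofReal_mul (sq_nonneg h)]
  rw [isq, integral_eq_lintegral_of_nonneg_ae (ae_of_all _ fun _ => sq_nonneg _)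
    (Continuous.aestronglyMeasurable (by have := hg.continuous; fun_prop))]
  exact ENNReal.toReal_le_of_le_ofReal (mul_nonneg (sq_nonneg _) (isq_nonneg _)) hl

/-! ### Time-dependent functions -/

/-- Joint smoothness in time and space. -/
def JS (F : ℝ → E3 → ℝ) : Prop := ContDiff ℝ ∞ (fun q : ℝ × E3 => F q.1 q.2)

/-- The time derivative. -/
def dt (F : ℝ → E3 → ℝ) (s : ℝ) (x : E3) : ℝ := deriv (fun r => F r x) s

namespace JS

variable {F G : ℝ → E3 → ℝ}

lemma cont (hF : JS F) : Continuous (fun q : ℝ × E3 => F q.1 q.2) := ContDiff.continuous hF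

lemma space (hF : JS F) (s : ℝ) : ContDiff ℝ ∞ (F s) :=
  ContDiff.comp (g := fun q : ℝ × E3 => F q.1 q.2) hF (contDiff_const.prodMk contDiff_id)

lemma time (hF : JS F) (x : E3) : ContDiff ℝ ∞ (fun s => F s x) :=
  ContDiff.comp (g := fun q : ℝ × E3 => F q.1 q.2) hF (contDiff_id.prodMk contDiff_const)

lemma hasDerivAt (hF : JS F) (s : ℝ) (x : E3) : HasDerivAt (fun r => F r x) (dt F s x) s :=
  (((hF.time x).differentiable (by simp)) s).hasDerivAt

lemma pd_eq (hF : JS F) (i : Fin 3) (s : ℝ) (x : E3) :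
    pd i (F s) x = fderiv ℝ (fun q : ℝ × E3 => F q.1 q.2) (s, x) (0, EuclideanSpace.single i 1) := by
  have h1 := ((ContDiff.differentiable hF (by simp)) (s, x)).hasFDerivAt
  have h2 : HasFDerivAt (fun x : E3 => (s, x)) (ContinuousLinearMap.inr ℝ ℝ E3) x :=
    (hasFDerivAt_const s x).prodMk (hasFDerivAt_id x)
  have h3 := HasFDerivAt.comp (f := fun x : E3 => (s, x)) x h1 h2
  have h4 : HasFDerivAt (F s) ((fderiv ℝ (fun q : ℝ × E3 => F q.1 q.2) (s, x)).comp
    (ContinuousLinearMap.inr ℝ ℝ E3)) x := h3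
  rw [_root_.pd, h4.fderiv]
  rfl

lemma dt_eq (hF : JS F) (s : ℝ) (x : E3) :
    dt F s x = fderiv ℝ (fun q : ℝ × E3 => F q.1 q.2) (s, x) (1, 0) := by
  have h1 := ((ContDiff.differentiable hF (by simp)) (s, x)).hasFDerivAt
  have h2 : HasDerivAt (fun r : ℝ => (r, x)) ((1 : ℝ), (0 : E3)) s :=
    (hasDerivAt_id s).prodMk (hasDerivAt_const s x)
  have h3 := HasFDerivAt.comp_hasDerivAt (f := fun r : ℝ => (r, x)) s h1 h2
  exact h3.deriv

lemma pd (hF : JS F) (i : Fin 3) : JS (fun s => pd i (F s)) := by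
  have : (fun q : ℝ × E3 => _root_.pd i (F q.1) q.2) = fun q =>
      fderiv ℝ (fun q : ℝ × E3 => F q.1 q.2) q (0, EuclideanSpace.single i 1) := by
    ext q; exact hF.pd_eq i q.1 q.2
  rw [JS, this]
  exact (ContDiff.fderiv_right (m := ∞) hF (by simp)).clm_apply contDiff_const

lemma dt (hF : JS F) : JS (dt F) := by
  have : (fun q : ℝ × E3 => _root_.dt F q.1 q.2) = fun q =>
      fderiv ℝ (fun q : ℝ × E3 => F q.1 q.2) q (1, 0) := by
    ext q; exact hF.dt_eq q.1 q.2
  rw [JS, this]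
  exact (ContDiff.fderiv_right (m := ∞) hF (by simp)).clm_apply contDiff_const

lemma dt_pd (hF : JS F) (i : Fin 3) (s : ℝ) (x : E3) :
    _root_.dt (fun s => _root_.pd i (F s)) s x = _root_.pd i (_root_.dt F s) x := by
  rw [(hF.pd i).dt_eq, hF.dt.pd_eq]
  have e1 : (fun q : ℝ × E3 => _root_.pd i (F q.1) q.2) = fun q =>
      fderiv ℝ (fun q : ℝ × E3 => F q.1 q.2) q (0, EuclideanSpace.single i 1) := by
    ext q; exact hF.pd_eq i q.1 q.2
  have e2 : (fun q : ℝ × E3 => _root_.dt F q.1 q.2) = fun q =>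
      fderiv ℝ (fun q : ℝ × E3 => F q.1 q.2) q (1, 0) := by
    ext q; exact hF.dt_eq q.1 q.2
  rw [e1, e2]
  have hd : DifferentiableAt ℝ (fderiv ℝ (fun q : ℝ × E3 => F q.1 q.2)) (s, x) :=
    ((ContDiff.fderiv_right (m := ∞) hF (by simp)).differentiable (by simp)).differentiableAt
  rw [fderiv_clm_apply hd (by fun_prop), fderiv_clm_apply hd (by fun_prop)]
  have := (ContDiff.contDiffAt (x := (s, x)) hF).isSymmSndFDerivAt
    (by simpa using ENat.LEInfty.out)
  simpa using this _ _

lemma sub (hF : JS F) (hG : JS G) : JS (fun s x => F s x - G s x) := ContDiff.sub hF hG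

lemma translate (hF : JS F) (a : E3) : JS (fun s x => F s (x + a)) :=
  ContDiff.comp (g := fun q : ℝ × E3 => F q.1 q.2) hF
    (contDiff_fst.prodMk (contDiff_snd.add contDiff_const))

lemma stronglyMeasurable_integral (hF : Continuous (fun q : ℝ × E3 => F q.1 q.2)) :
    StronglyMeasurable (fun s => ∫ x, F s x) :=
  StronglyMeasurable.integral_prod_right' (f := fun q : ℝ × E3 => F q.1 q.2)
    hF.stronglyMeasurable

end JS

lemma dt_sub {F G : ℝ → E3 → ℝ} (hF : JS F) (hG : JS G) (s : ℝ) (x : E3) :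
    dt (fun s x => F s x - G s x) s x = dt F s x - dt G s x :=
  ((hF.hasDerivAt s x).sub (hG.hasDerivAt s x)).deriv

lemma dt_translate (F : ℝ → E3 → ℝ) (a : E3) (s : ℝ) (x : E3) :
    dt (fun s x => F s (x + a)) s x = dt F s (x + a) := rfl

/-! ### The energy identity -/

lemma integral_cutoff_sub {Q : ℝ → E3 → ℝ} (hQ : JS Q) {χ : E3 → ℝ} (hχ : Continuous χ)
    (hc : HasCompactSupport χ) {t₁ t₂ : ℝ} (h : t₁ ≤ t₂) :
    (∫ x, χ x * Q t₂ x) - ∫ x, χ x * Q t₁ x = ∫ s in t₁..t₂, ∫ x, χ x * dt Q s x := by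
  have hcont : Continuous (fun q : ℝ × E3 => χ q.2 * dt Q q.1 q.2) :=
    (hχ.comp continuous_snd).mul hQ.dt.cont
  have hint : Integrable (Function.uncurry fun s x => χ x * dt Q s x)
      ((volume.restrict (Set.uIoc t₁ t₂)).prod volume) := by
    have e : (volume.restrict (Set.uIoc t₁ t₂)).prod (volume : Measure E3) =
        ((volume : Measure ℝ).prod (volume : Measure E3)).restrict
          (Set.uIoc t₁ t₂ ×ˢ Set.univ) := by
      rw [← Measure.prod_restrict, Measure.restrict_univ]
    rw [e]
    have h1 : IntegrableOn (Function.uncurry fun s x => χ x * dt Q s x)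
        (Set.Icc t₁ t₂ ×ˢ tsupport χ) ((volume : Measure ℝ).prod (volume : Measure E3)) :=
      ContinuousOn.integrableOn_compact (isCompact_Icc.prod hc) hcont.continuousOn
    refine IntegrableOn.of_forall_sdiff_eq_zero h1
      (measurableSet_uIoc.prod MeasurableSet.univ) ?_
    rintro ⟨s, x⟩ ⟨⟨hs, -⟩, hn⟩
    have hx : x ∉ tsupport χ := fun hx => hn ⟨Set.Ioc_subset_Icc_self
      (by simpa [Set.uIoc_of_le h] using hs), hx⟩
    simp [image_eq_zero_of_notMem_tsupport hx]
  have hi : ∀ s, Integrable (fun x => χ x * Q s x) := fun s =>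
    (hχ.mul (hQ.space s).continuous).integrable_of_hasCompactSupport hc.mul_right
  rw [intervalIntegral_integral_swap hint, ← integral_sub (hi t₂) (hi t₁)]
  congr 1
  ext x
  rw [intervalIntegral.integral_const_mul, ← mul_sub]
  congr 1
  exact (intervalIntegral.integral_eq_sub_of_hasDerivAt (fun s _ => hQ.hasDerivAt s x)
    ((hQ.dt.time x).continuous.intervalIntegrable _ _)).symm

lemma pd_smul_arg {f : E3 → ℝ} (hf : ContDiff ℝ ∞ f) (r : ℝ) (i : Fin 3) :
    pd i (fun x => f (r • x)) = fun x => r * pd i f (r • x) := by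
  ext x
  have h1 := (hf.differentiable_infty (r • x)).hasFDerivAt
  have h2 : HasFDerivAt (fun x : E3 => r • x) (r • ContinuousLinearMap.id ℝ E3) x :=
    (hasFDerivAt_id x).const_smul r
  have h3 := HasFDerivAt.comp (f := fun x : E3 => r • x) x h1 h2
  have h4 : HasFDerivAt (fun x => f (r • x)) _ x := h3
  rw [pd, h4.fderiv]
  simp [pd]

/-- A sequence of smooth cutoff functions. -/
lemma exists_cutoff : ∃ (χ : ℕ → E3 → ℝ) (A : ℝ), (∀ n, ContDiff ℝ ∞ (χ n)) ∧
    (∀ n, HasCompactSupport (χ n)) ∧ (∀ n x, |χ n x| ≤ 1) ∧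
    (∀ x, Tendsto (fun n => χ n x) atTop (𝓝 1)) ∧
    (∀ n i x, |pd i (χ n) x| ≤ A) ∧
    (∀ i x, Tendsto (fun n => pd i (χ n) x) atTop (𝓝 0)) := by
  let η : ContDiffBump (0 : E3) := ⟨1, 2, one_pos, one_lt_two⟩
  have hη : ContDiff ℝ ∞ (η : E3 → ℝ) := η.contDiff
  have hηc : HasCompactSupport (η : E3 → ℝ) := η.hasCompactSupport
  have hbd : ∀ i, ∃ M, ∀ x, |pd i η x| ≤ M := fun i =>
    (contDiff_pd hη i).continuous.bounded_above_of_compact_support (hηc.fderiv_apply ℝ _)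
  choose M hM using hbd
  have hM0 : ∀ i, 0 ≤ M i := fun i => (abs_nonneg _).trans (hM i 0)
  have hr : Tendsto (fun n : ℕ => 1 / ((n : ℝ) + 1)) atTop (𝓝 0) :=
    tendsto_one_div_add_atTop_nhds_zero_nat
  have hle : ∀ (n : ℕ) i x, |pd i (fun x => η ((1 / ((n : ℝ) + 1)) • x)) x| ≤
      1 / ((n : ℝ) + 1) * M i := by
    intro n i x
    rw [pd_smul_arg hη]
    simp only [abs_mul]
    rw [abs_of_pos (by positivity : 0 < 1 / ((n : ℝ) + 1))]
    gcongr
    exact hM i _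
  refine ⟨fun n x => η ((1 / ((n : ℝ) + 1)) • x), ∑ i, M i, fun n => hη.comp (by fun_prop),
    fun n => hηc.comp_smul (by positivity), fun n x => ?_, fun x => ?_, fun n i x => ?_,
    fun i x => ?_⟩
  · rw [abs_of_nonneg η.nonneg]; exact η.le_one
  · have h1 : Tendsto (fun n : ℕ => (1 / ((n : ℝ) + 1)) • x) atTop (𝓝 0) := by
      simpa using hr.smul_const x
    have h2 := (hη.continuous.tendsto 0).comp h1
    have h3 : η (0 : E3) = 1 := η.one_of_mem_closedBall (by simp [η])
    rwa [h3] at h2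
  · refine (hle n i x).trans ?_
    have h1 : 1 / ((n : ℝ) + 1) ≤ 1 := by
      rw [div_le_one (by positivity)]; linarith [(Nat.cast_nonneg n : (0:ℝ) ≤ n)]
    calc _ ≤ 1 * M i := by gcongr; exact hM0 i
      _ ≤ _ := by rw [one_mul]; exact Finset.single_le_sum (fun i _ => hM0 i) (Finset.mem_univ i)
  · rw [tendsto_zero_iff_norm_tendsto_zero]
    refine squeeze_zero (fun _ => norm_nonneg _) (fun n => hle n i x) ?_
    simpa using hr.mul_const (M i)

lemma integral_mul_le_half {f g : E3 → ℝ} (hf : MemLp f 2) (hg : MemLp g 2) :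
    |∫ x, f x * g x| ≤ (isq f + isq g) / 2 := by
  have h1 : Integrable (fun x => f x ^ 2) := hf.integrable_sq
  have h2 : Integrable (fun x => g x ^ 2) := hg.integrable_sq
  refine abs_integral_le_integral_abs.trans ?_
  have : ∫ x, |f x * g x| ≤ ∫ x, (1 / 2 * f x ^ 2 + 1 / 2 * g x ^ 2) := by
    refine integral_mono (hf.integrable_mul_two hg).abs
      ((h1.const_mul _).add (h2.const_mul _)) fun x => ?_
    simp only [abs_mul]
    nlinarith [sq_nonneg (|f x| - |g x|), sq_abs (f x), sq_abs (g x)]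
  rw [integral_add (h1.const_mul _) (h2.const_mul _), integral_const_mul, integral_const_mul] at this
  simp only [isq]
  linarith

/-- `d/ds ‖∂ⱼf‖² = -2 ∫ ∂ⱼ²f ∂ₛf`, in integrated form. -/
lemma isq_pd_sub_eq {f : ℝ → E3 → ℝ} (hf : JS f) {t₁ t₂ M : ℝ} (h : t₁ ≤ t₂) (j : Fin 3)
    (hr : ∀ s ∈ Set.Icc t₁ t₂, L2Reg 2 (f s)) (hd : ∀ s ∈ Set.Icc t₁ t₂, MemLp (dt f s) 2)
    (b1 : ∀ s ∈ Set.Icc t₁ t₂, isq (pd j (f s)) ≤ M)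
    (b2 : ∀ s ∈ Set.Icc t₁ t₂, isq (pd j (pd j (f s))) ≤ M)
    (b3 : ∀ s ∈ Set.Icc t₁ t₂, isq (dt f s) ≤ M) :
    isq (pd j (f t₂)) - isq (pd j (f t₁)) =
      ∫ s in t₁..t₂, -2 * ∫ x, pd j (pd j (f s)) x * dt f s x := by
  obtain ⟨χ, A, χs, χc, χ1, χt, χA, χ0⟩ := exists_cutoff
  have hA : 0 ≤ A := (abs_nonneg _).trans (χA 0 0 0)
  have hM : 0 ≤ M := (isq_nonneg _).trans (b1 t₁ ⟨le_rfl, h⟩)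
  have hQ : JS (fun s x => pd j (f s) x ^ 2) := ContDiff.pow (hf.pd j) 2
  have hdQ : ∀ s x, dt (fun s x => pd j (f s) x ^ 2) s x =
      2 * (pd j (f s) x * pd j (dt f s) x) := by
    intro s x
    have := ((hf.pd j).hasDerivAt s x).pow 2
    have h2 : HasDerivAt (fun r => pd j (f r) x ^ 2) _ s := this
    rw [dt, h2.deriv, hf.dt_pd]
    simp; ring
  set Φ : ℕ → ℝ → ℝ := fun n s => ∫ x, χ n x * dt (fun s x => pd j (f s) x ^ 2) s x with hΦ
  have hΦeq : ∀ n, ∀ s, Φ n s =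
      -2 * ∫ x, (χ n x * pd j (pd j (f s)) x + pd j (χ n) x * pd j (f s) x) * dt f s x := by
    intro n s
    have c1 := (hf.pd j).space s
    have c2 := hf.dt.space s
    have c3 := (χs n).mul c1
    have ibp := integral_mul_pd (i := j) c3 c2
      (Continuous.integrable_of_hasCompactSupport
        ((contDiff_pd c3 j).continuous.mul c2.continuous)
        (((χc n).mul_right.fderiv_apply ℝ _).mul_right))
      (Continuous.integrable_of_hasCompactSupport
        (c3.continuous.mul (contDiff_pd c2 j).continuous) ((χc n).mul_right.mul_right))
      (Continuous.integrable_of_hasCompactSupport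
        (c3.continuous.mul c2.continuous) ((χc n).mul_right.mul_right))
    rw [pd_mul (χs n) c1] at ibp
    rw [neg_mul, ← mul_neg, ← ibp, ← integral_const_mul, hΦ]
    simp only [hdQ]
    congr 1; ext x; ring
  have hbound : ∀ n, ∀ s ∈ Set.Icc t₁ t₂, ∀ x,
      ‖(χ n x * pd j (pd j (f s)) x + pd j (χ n) x * pd j (f s) x) * dt f s x‖ ≤
        (pd j (pd j (f s)) x ^ 2 + A ^ 2 * pd j (f s) x ^ 2 + dt f s x ^ 2) := by
    intro n s hs x
    rw [Real.norm_eq_abs, abs_mul]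
    have h1 : |χ n x * pd j (pd j (f s)) x + pd j (χ n) x * pd j (f s) x| ≤
        |pd j (pd j (f s)) x| + A * |pd j (f s) x| := by
      refine (abs_add_le _ _).trans ?_
      rw [abs_mul, abs_mul]
      have h2 := χA n j x
      refine add_le_add (mul_le_of_le_one_left (abs_nonneg _) (χ1 n x)) ?_
      gcongr
    refine (mul_le_mul_of_nonneg_right h1 (abs_nonneg _)).trans ?_
    rw [← sq_abs (pd j (pd j (f s)) x), ← sq_abs (pd j (f s) x), ← sq_abs (dt f s x)]
    nlinarith [sq_nonneg (|pd j (pd j (f s)) x| - |dt f s x| / 2),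
      sq_nonneg (A * |pd j (f s) x| - |dt f s x| / 2), sq_nonneg (|dt f s x|)]
  have hi2 : ∀ s ∈ Set.Icc t₁ t₂, Integrable (fun x => pd j (pd j (f s)) x ^ 2) := fun s hs =>
    (((hr s hs).pderiv j).pderiv j).memLp.integrable_sq
  have hi1 : ∀ s ∈ Set.Icc t₁ t₂, Integrable (fun x => pd j (f s) x ^ 2) := fun s hs =>
    ((hr s hs).pderiv j).memLp.integrable_sq
  have hi3 : ∀ s ∈ Set.Icc t₁ t₂, Integrable (fun x => dt f s x ^ 2) := fun s hs =>
    (hd s hs).integrable_sq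
  have hi12 : ∀ s ∈ Set.Icc t₁ t₂, Integrable (fun x => pd j (pd j (f s)) x ^ 2 +
      A ^ 2 * pd j (f s) x ^ 2) := fun s hs => (hi2 s hs).add ((hi1 s hs).const_mul _)
  have hi : ∀ s ∈ Set.Icc t₁ t₂, Integrable (fun x => pd j (pd j (f s)) x ^ 2 +
      A ^ 2 * pd j (f s) x ^ 2 + dt f s x ^ 2) := fun s hs => (hi12 s hs).add (hi3 s hs)
  have hcs : ∀ n s, Continuous fun x =>
      (χ n x * pd j (pd j (f s)) x + pd j (χ n) x * pd j (f s) x) * dt f s x := by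
    intro n s
    have c1 := ((hf.pd j).space s).continuous
    have c2 := (((hf.pd j).pd j).space s).continuous
    have c3 := (hf.dt.space s).continuous
    have c4 := (χs n).continuous
    have c5 := (contDiff_pd (χs n) j).continuous
    fun_prop
  have hRHS : Tendsto (fun n => ∫ s in t₁..t₂, Φ n s) atTop
      (𝓝 (∫ s in t₁..t₂, -2 * ∫ x, pd j (pd j (f s)) x * dt f s x)) := by
    refine intervalIntegral.tendsto_integral_filter_of_dominated_convergence
      (fun _ => 2 * (M + A ^ 2 * M + M)) (Eventually.of_forall fun n => ?_)
      (Eventually.of_forall fun n => ae_of_all _ fun s hs => ?_) (by simp)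
      (ae_of_all _ fun s hs => ?_)
    · exact (JS.stronglyMeasurable_integral
        (F := fun s x => χ n x * dt (fun s x => pd j (f s) x ^ 2) s x)
        (((χs n).continuous.comp continuous_snd).mul hQ.dt.cont)).aestronglyMeasurable
    · have hs' : s ∈ Set.Icc t₁ t₂ := Set.Ioc_subset_Icc_self (by simpa [Set.uIoc_of_le h] using hs)
      rw [hΦeq, norm_mul]
      simp only [norm_neg, Real.norm_ofNat]
      gcongr
      refine (norm_integral_le_integral_norm _).trans
        ((integral_mono_of_nonneg (ae_of_all _ fun _ => norm_nonneg _) (hi s hs')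
          (ae_of_all _ (hbound n s hs'))).trans ?_)
      rw [integral_add (hi12 s hs') (hi3 s hs'), integral_add (hi2 s hs')
        ((hi1 s hs').const_mul _), integral_const_mul]
      have := b1 s hs'
      have := b2 s hs'
      have := b3 s hs'
      simp only [isq] at *
      gcongr
    · have hs' : s ∈ Set.Icc t₁ t₂ := Set.Ioc_subset_Icc_self (by simpa [Set.uIoc_of_le h] using hs)
      simp only [hΦeq]
      refine Tendsto.const_mul _ ?_
      refine tendsto_integral_of_dominated_convergence _ (fun n => (hcs n s).aestronglyMeasurable)
        (hi s hs') (fun n => ae_of_all _ (hbound n s hs')) (ae_of_all _ fun x => ?_)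
      simpa using (((χt x).mul_const (pd j (pd j (f s)) x)).add
        ((χ0 j x).mul_const (pd j (f s) x))).mul_const (dt f s x)
  have hpt : ∀ s ∈ Set.Icc t₁ t₂, Tendsto (fun n => ∫ x, χ n x * pd j (f s) x ^ 2) atTop
      (𝓝 (isq (pd j (f s)))) := by
    intro s hs
    refine tendsto_integral_of_dominated_convergence (fun x => pd j (f s) x ^ 2)
      (fun n => ((χs n).continuous.mul
        (((hf.pd j).space s).continuous.pow 2)).aestronglyMeasurable)
      (hi1 s hs) (fun n => ae_of_all _ fun x => ?_) (ae_of_all _ fun x => ?_)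
    · rw [norm_mul, Real.norm_eq_abs, Real.norm_of_nonneg (sq_nonneg _)]
      exact mul_le_of_le_one_left (sq_nonneg _) (χ1 n x)
    · simpa using (χt x).mul_const (pd j (f s) x ^ 2)
  have hLHS := (hpt t₂ ⟨h, le_rfl⟩).sub (hpt t₁ ⟨le_rfl, h⟩)
  refine tendsto_nhds_unique (hLHS.congr fun n => ?_) hRHS
  exact integral_cutoff_sub hQ (χs n).continuous (χc n) h

/-! ### The nonlinear terms -/

/-- The values at a point of the unknowns, their gradients and Laplacians. -/
structure Jet where
  u : ℝ
  v : ℝ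
  θ : ℝ
  gu : Fin 3 → ℝ
  gv : Fin 3 → ℝ
  gθ : Fin 3 → ℝ
  gφ : Fin 3 → ℝ
  lu : ℝ
  lv : ℝ
  lθ : ℝ

/-- The dot product on `ℝ³`. -/
def dot (p q : Fin 3 → ℝ) : ℝ := ∑ i, p i * q i

/-- The `ℓ¹` norm on `ℝ³`. -/
def nrm (p : Fin 3 → ℝ) : ℝ := ∑ i, |p i|

lemma nrm_nonneg (p : Fin 3 → ℝ) : 0 ≤ nrm p := Finset.sum_nonneg fun _ _ => abs_nonneg _

lemma abs_dot_le (p q : Fin 3 → ℝ) : |dot p q| ≤ nrm p * nrm q := by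
  rw [dot, nrm, Finset.sum_mul]
  refine (Finset.abs_sum_le_sum_abs _ _).trans (Finset.sum_le_sum fun i _ => ?_)
  rw [abs_mul]
  gcongr
  exact Finset.single_le_sum (f := fun i => |q i|) (fun _ _ => abs_nonneg _) (Finset.mem_univ i)

lemma abs_dot_sub_le (p q p' q' : Fin 3 → ℝ) :
    |dot p' q' - dot p q| ≤ nrm (p' - p) * nrm q' + nrm p * nrm (q' - q) := by
  have e : dot p' q' - dot p q = dot (p' - p) q' + dot p (q' - q) := by
    simp only [dot, Fin.sum_univ_three, Pi.sub_apply]; ring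
  rw [e]
  exact (abs_add_le _ _).trans (add_le_add (abs_dot_le _ _) (abs_dot_le _ _))

lemma abs_mul_sub_mul_le (k k' X X' : ℝ) :
    |k' * X' - k * X| ≤ |k'| * |X' - X| + |k' - k| * |X| := by
  have e : k' * X' - k * X = k' * (X' - X) + (k' - k) * X := by ring
  rw [e, ← abs_mul, ← abs_mul]
  exact abs_add_le _ _

namespace Jet

/-- Nonlinear part of the first equation. -/
def Ru (P : Jet) : ℝ :=
  P.θ * P.lu + P.u * P.lθ + 2 * dot P.gθ P.gu - dot P.gv P.gφ - P.v ^ 2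

/-- Nonlinear part of the second equation. -/
def Rv (P : Jet) : ℝ :=
  P.θ * P.lv + P.v * P.lθ + 2 * dot P.gθ P.gv - dot P.gu P.gφ - P.u * P.v

/-- Nonlinear part of the third equation. -/
def Rθ (c : ℝ) (P : Jet) : ℝ :=
  P.θ * P.lθ - (P.u / (2 * (2 + P.u))) * P.lθ
    + ((2 * P.θ ^ 2 + 4 * P.θ - P.u) / (2 * (2 + P.u))) * P.lu
    + (c + 1) * dot P.gθ P.gθ
    + (c + 3) * ((1 + P.θ) / (2 + P.u)) * dot P.gu P.gθ
    - 2 * ((1 + P.θ) / (2 + P.u)) * dot P.gv P.gφ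
    - (c + 2) * (P.v / (2 + P.u)) * dot P.gθ P.gφ
    - ((1 + P.θ) / (2 + P.u)) * P.v ^ 2
    + dot P.gφ P.gφ

/-- Size of the gradients of the main unknowns. -/
def g (P : Jet) : ℝ := nrm P.gu + nrm P.gv + nrm P.gθ

/-- Size of the Laplacians. -/
def L (P : Jet) : ℝ := |P.lu| + |P.lv| + |P.lθ|

lemma g_nonneg (P : Jet) : 0 ≤ P.g :=
  add_nonneg (add_nonneg (nrm_nonneg _) (nrm_nonneg _)) (nrm_nonneg _)

lemma L_nonneg (P : Jet) : 0 ≤ P.L :=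
  add_nonneg (add_nonneg (abs_nonneg _) (abs_nonneg _)) (abs_nonneg _)

/-- Difference of gradients. -/
def gd (P P' : Jet) : ℝ :=
  nrm (P'.gu - P.gu) + nrm (P'.gv - P.gv) + nrm (P'.gθ - P.gθ)

/-- Difference of Laplacians. -/
def Ld (P P' : Jet) : ℝ := |P'.lu - P.lu| + |P'.lv - P.lv| + |P'.lθ - P.lθ|

/-- The small-amplitude condition. -/
structure Small (ε : ℝ) (P : Jet) : Prop where
  u : |P.u| ≤ ε
  v : |P.v| ≤ ε
  θ : |P.θ| ≤ ε
  φ : nrm P.gφ ≤ ε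

/-- Closeness of two jets. -/
structure Close (m p : ℝ) (P P' : Jet) : Prop where
  u : |P'.u - P.u| ≤ m
  v : |P'.v - P.v| ≤ m
  θ : |P'.θ - P.θ| ≤ m
  φ : nrm (P'.gφ - P.gφ) ≤ p

/-- The bound for differences of the nonlinear terms. -/
def bd (ε m p : ℝ) (P P' : Jet) : ℝ :=
  ε * Ld P P' + m * P.L + (P'.g + P.g) * gd P P' + ε * gd P P' + p * P.g
    + p * (nrm P.gφ + nrm P'.gφ) + m * ε * P.g + m * P.g ^ 2 + ε * |P'.v - P.v| + m * |P.v|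

variable {ε m p : ℝ} {P P' : Jet}

lemma abs_coeff_div_sub_le {x y x' y' A B : ℝ} (hy : 3 / 2 ≤ y) (hy' : 3 / 2 ≤ y')
    (h1 : |x' - x| ≤ A) (h2 : |y' - y| ≤ B) (hx : |x| ≤ 2) :
    |x' / y' - x / y| ≤ A + B := by
  have e : x' / y' - x / y = (x' - x) / y' - x * (y' - y) / (y * y') := by
    field_simp; ring
  rw [e]
  refine (abs_sub _ _).trans (add_le_add ?_ ?_)
  · rw [abs_div, abs_of_pos (by linarith : 0 < y'), div_le_iff₀ (by linarith)]
    nlinarith [abs_nonneg (x' - x)]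
  · rw [abs_div, abs_mul, abs_of_pos (by positivity : 0 < y * y'), div_le_iff₀ (by positivity)]
    have hyy : 2 ≤ y * y' := by nlinarith
    nlinarith [abs_nonneg (y' - y), abs_nonneg x]

lemma abs_div_le {x y A : ℝ} (hy : 3 / 2 ≤ y) (h1 : |x| ≤ A) : |x / y| ≤ A := by
  rw [abs_div, abs_of_pos (by linarith : 0 < y), div_le_iff₀ (by linarith)]
  nlinarith [abs_nonneg x]

set_option maxHeartbeats 1000000 in
theorem diff_le {c : ℝ} (hc : 0 ≤ c) (hε : ε ≤ 1 / 2) (hP : P.Small ε) (hP' : P'.Small ε)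
    (h : Close m p P P') :
    |P'.Ru - P.Ru| ≤ 10 * bd ε m p P P' ∧ |P'.Rv - P.Rv| ≤ 10 * bd ε m p P P' ∧
      |P'.Rθ c - P.Rθ c| ≤ 40 * (c + 3) * bd ε m p P P' := by
  have hε0 : 0 ≤ ε := (abs_nonneg _).trans hP.u
  have hm0 : 0 ≤ m := (abs_nonneg _).trans h.u
  have hp0 : 0 ≤ p := (nrm_nonneg _).trans h.φ
  -- sizes
  have g0 := P.g_nonneg
  have g0' := P'.g_nonneg
  have nn := nrm_nonneg
  have gu_le : nrm P.gu ≤ P.g := by rw [g]; linarith [nn P.gv, nn P.gθ]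
  have gv_le : nrm P.gv ≤ P.g := by rw [g]; linarith [nn P.gu, nn P.gθ]
  have gθ_le : nrm P.gθ ≤ P.g := by rw [g]; linarith [nn P.gu, nn P.gv]
  have gu_le' : nrm P'.gu ≤ P'.g := by rw [g]; linarith [nn P'.gv, nn P'.gθ]
  have gv_le' : nrm P'.gv ≤ P'.g := by rw [g]; linarith [nn P'.gu, nn P'.gθ]
  have gθ_le' : nrm P'.gθ ≤ P'.g := by rw [g]; linarith [nn P'.gu, nn P'.gv]
  have du_le : nrm (P'.gu - P.gu) ≤ gd P P' := by
    rw [gd]; linarith [nn (P'.gv - P.gv), nn (P'.gθ - P.gθ)]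
  have dv_le : nrm (P'.gv - P.gv) ≤ gd P P' := by
    rw [gd]; linarith [nn (P'.gu - P.gu), nn (P'.gθ - P.gθ)]
  have dθ_le : nrm (P'.gθ - P.gθ) ≤ gd P P' := by
    rw [gd]; linarith [nn (P'.gu - P.gu), nn (P'.gv - P.gv)]
  have d0 : 0 ≤ gd P P' := (nn _).trans du_le
  have lu_le : |P.lu| ≤ P.L := by rw [L]; linarith [abs_nonneg P.lv, abs_nonneg P.lθ]
  have lv_le : |P.lv| ≤ P.L := by rw [L]; linarith [abs_nonneg P.lu, abs_nonneg P.lθ]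
  have lθ_le : |P.lθ| ≤ P.L := by rw [L]; linarith [abs_nonneg P.lu, abs_nonneg P.lv]
  have L0 := P.L_nonneg
  have dlu : |P'.lu - P.lu| ≤ Ld P P' := by
    rw [Ld]; linarith [abs_nonneg (P'.lv - P.lv), abs_nonneg (P'.lθ - P.lθ)]
  have dlv : |P'.lv - P.lv| ≤ Ld P P' := by
    rw [Ld]; linarith [abs_nonneg (P'.lu - P.lu), abs_nonneg (P'.lθ - P.lθ)]
  have dlθ : |P'.lθ - P.lθ| ≤ Ld P P' := by
    rw [Ld]; linarith [abs_nonneg (P'.lu - P.lu), abs_nonneg (P'.lv - P.lv)]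
  have Ld0 : 0 ≤ Ld P P' := (abs_nonneg _).trans dlu
  -- the entries of the bound
  have φ0 := nn P.gφ
  have φ0' := nn P'.gφ
  have q1 : 0 ≤ ε * Ld P P' := by positivity
  have q2 : 0 ≤ m * P.L := by positivity
  have q3 : 0 ≤ (P'.g + P.g) * gd P P' := by positivity
  have q4 : 0 ≤ ε * gd P P' := by positivity
  have q5 : 0 ≤ p * P.g := by positivity
  have q6 : 0 ≤ p * (nrm P.gφ + nrm P'.gφ) := by positivity
  have q7 : 0 ≤ m * ε * P.g := by positivity
  have q8 : 0 ≤ m * P.g ^ 2 := by positivity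
  have q9 : 0 ≤ ε * |P'.v - P.v| := by positivity
  have q10 : 0 ≤ m * |P.v| := by positivity
  -- products of coefficients and Laplacians
  have lap_term : ∀ {k k' X X' A B : ℝ}, 0 ≤ A → 0 ≤ B → |k'| ≤ A * ε → |k' - k| ≤ B * m →
      |X' - X| ≤ Ld P P' → |X| ≤ P.L →
      |k' * X' - k * X| ≤ A * (ε * Ld P P') + B * (m * P.L) := by
    intro k k' X X' A B hA hB h1 h2 h3 h4
    refine (abs_mul_sub_mul_le _ _ _ _).trans ?_
    rw [← mul_assoc, ← mul_assoc]
    gcongr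
  -- dot products of gradients of the main unknowns
  have dot_term : ∀ {x y x' y' : Fin 3 → ℝ}, nrm x ≤ P.g → nrm y' ≤ P'.g →
      nrm (x' - x) ≤ gd P P' → nrm (y' - y) ≤ gd P P' →
      |dot x' y' - dot x y| ≤ (P'.g + P.g) * gd P P' := by
    intro x y x' y' h1 h2 h3 h4
    refine (abs_dot_sub_le _ _ _ _).trans ?_
    calc _ ≤ gd P P' * P'.g + P.g * gd P P' := by
          have := nn x
          have := nn y'
          gcongr <;> exact nn _
      _ = _ := by ring
  -- dot products with the gradient of the potential
  have dotφ_term : ∀ {x x' : Fin 3 → ℝ}, nrm x ≤ P.g → nrm (x' - x) ≤ gd P P' →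
      |dot x' P'.gφ - dot x P.gφ| ≤ ε * gd P P' + p * P.g := by
    intro x x' h1 h2
    refine (abs_dot_sub_le _ _ _ _).trans ?_
    calc _ ≤ gd P P' * ε + P.g * p := by
          have := hP'.φ
          have := h.φ
          gcongr <;> exact nn _
      _ = _ := by ring
  have vv : |P'.v ^ 2 - P.v ^ 2| ≤ 2 * (ε * |P'.v - P.v|) := by
    rw [show P'.v ^ 2 - P.v ^ 2 = (P'.v + P.v) * (P'.v - P.v) by ring, abs_mul, ← mul_assoc]
    gcongr
    exact (abs_add_le _ _).trans (by linarith [hP.v, hP'.v])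
  have uv : |P'.u * P'.v - P.u * P.v| ≤ ε * |P'.v - P.v| + m * |P.v| := by
    refine (abs_mul_sub_mul_le _ _ _ _).trans ?_
    have := hP'.u
    have := h.u
    gcongr
  have gθgu := dot_term gθ_le gu_le' dθ_le du_le
  have gθgv := dot_term gθ_le gv_le' dθ_le dv_le
  have gθgθ := dot_term gθ_le gθ_le' dθ_le dθ_le
  have gugθ := dot_term gu_le gθ_le' du_le dθ_le
  have gvgφ := dotφ_term gv_le dv_le
  have gugφ := dotφ_term gu_le du_le
  have gθgφ := dotφ_term gθ_le dθ_le
  have θlu := lap_term (A := 1) (B := 1) zero_le_one zero_le_one (by simpa using hP'.θ)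
    (by simpa using h.θ) dlu lu_le
  have θlv := lap_term (A := 1) (B := 1) zero_le_one zero_le_one (by simpa using hP'.θ)
    (by simpa using h.θ) dlv lv_le
  have θlθ := lap_term (A := 1) (B := 1) zero_le_one zero_le_one (by simpa using hP'.θ)
    (by simpa using h.θ) dlθ lθ_le
  have ulθ := lap_term (A := 1) (B := 1) zero_le_one zero_le_one (by simpa using hP'.u)
    (by simpa using h.u) dlθ lθ_le
  have vlθ := lap_term (A := 1) (B := 1) zero_le_one zero_le_one (by simpa using hP'.v)
    (by simpa using h.v) dlθ lθ_le
  refine ⟨?_, ?_, ?_⟩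
  · rw [abs_le] at θlu θlv ulθ vlθ gθgu gθgv gvgφ gugφ vv uv ⊢
    simp only [bd, Ru]
    constructor <;> linarith only [θlu, ulθ, gθgu, gvgφ, vv, q1, q2, q3, q4, q5, q6, q7, q8, q9, q10]
  · rw [abs_le] at θlu θlv ulθ vlθ gθgu gθgv gvgφ gugφ vv uv ⊢
    simp only [bd, Rv]
    constructor <;> linarith only [θlv, vlθ, gθgv, gugφ, uv, q1, q2, q3, q4, q5, q6, q7, q8, q9, q10]
  · have hu := abs_le.1 hP.u
    have hu' := abs_le.1 hP'.u
    have hθ := abs_le.1 hP.θ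
    have hθ' := abs_le.1 hP'.θ
    have hdu := abs_le.1 h.u
    have hdθ := abs_le.1 h.θ
    have y1 : 3 / 2 ≤ 2 + P.u := by linarith
    have y1' : 3 / 2 ≤ 2 + P'.u := by linarith
    have y2 : 3 / 2 ≤ 2 * (2 + P.u) := by linarith
    have y2' : 3 / 2 ≤ 2 * (2 + P'.u) := by linarith
    have dy1 : |2 + P'.u - (2 + P.u)| ≤ m := by
      rw [show 2 + P'.u - (2 + P.u) = P'.u - P.u by ring]; exact h.u
    have dy2 : |2 * (2 + P'.u) - 2 * (2 + P.u)| ≤ 2 * m := by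
      rw [show 2 * (2 + P'.u) - 2 * (2 + P.u) = 2 * (P'.u - P.u) by ring, abs_mul]
      simpa using h.u
    -- coefficient bounds
    have a1 : |(1 + P'.θ) / (2 + P'.u)| ≤ 1 := by
      rw [abs_le, le_div_iff₀ (by linarith), div_le_iff₀ (by linarith)]
      constructor <;> linarith
    have a2 : |(1 + P'.θ) / (2 + P'.u) - (1 + P.θ) / (2 + P.u)| ≤ m + m :=
      abs_coeff_div_sub_le y1 y1' (by simpa using h.θ) dy1 (by rw [abs_le]; constructor <;> linarith)
    have b1 : |P'.u / (2 * (2 + P'.u))| ≤ ε := abs_div_le y2' hP'.u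
    have b2 : |P'.u / (2 * (2 + P'.u)) - P.u / (2 * (2 + P.u))| ≤ m + 2 * m :=
      abs_coeff_div_sub_le y2 y2' h.u dy2 (by rw [abs_le]; constructor <;> linarith)
    have sqθ : P.θ ^ 2 ≤ 1 / 2 * ε := by nlinarith only [hθ, hε, hε0]
    have sqθ' : P'.θ ^ 2 ≤ 1 / 2 * ε := by nlinarith only [hθ', hε, hε0]
    have d1 : |(2 * P'.θ ^ 2 + 4 * P'.θ - P'.u) / (2 * (2 + P'.u))| ≤ 6 * ε :=
      abs_div_le y2' (by rw [abs_le]; constructor <;> linarith only [sq_nonneg P'.θ, sqθ', hu', hθ', hε0])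
    have dθθ : |P'.θ ^ 2 - P.θ ^ 2| ≤ m := by
      rw [show P'.θ ^ 2 - P.θ ^ 2 = (P'.θ + P.θ) * (P'.θ - P.θ) by ring, abs_mul]
      have : |P'.θ + P.θ| ≤ 1 := by rw [abs_le]; constructor <;> linarith
      calc _ ≤ 1 * m := by gcongr; exact h.θ
        _ = m := one_mul m
    have hdd := abs_le.1 dθθ
    have d2 : |(2 * P'.θ ^ 2 + 4 * P'.θ - P'.u) / (2 * (2 + P'.u)) / 2 -
        (2 * P.θ ^ 2 + 4 * P.θ - P.u) / (2 * (2 + P.u)) / 2| ≤ 4 * m + 2 * m := by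
      rw [div_right_comm, div_right_comm (2 * P.θ ^ 2 + 4 * P.θ - P.u)]
      exact abs_coeff_div_sub_le y2 y2' (by rw [abs_le]; constructor <;> linarith) dy2
        (by rw [abs_le]; constructor <;> linarith only [sq_nonneg P.θ, sqθ, hu, hθ, hε0, hε])
    have d2' : |(2 * P'.θ ^ 2 + 4 * P'.θ - P'.u) / (2 * (2 + P'.u)) -
        (2 * P.θ ^ 2 + 4 * P.θ - P.u) / (2 * (2 + P.u))| ≤ 12 * m := by
      rw [abs_le] at d2 ⊢
      constructor <;> linarith
    have e1 : |P'.v / (2 + P'.u)| ≤ ε := abs_div_le y1' hP'.v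
    have e2 : |P'.v / (2 + P'.u) - P.v / (2 + P.u)| ≤ m + m :=
      abs_coeff_div_sub_le y1 y1' h.v dy1 (by linarith [hP.v])
    have blθ := lap_term (A := 1) (B := 3) zero_le_one (by norm_num) (by simpa using b1)
      (by linarith only [b2]) dlθ lθ_le
    have dlu' := lap_term (A := 6) (B := 12) (by norm_num) (by norm_num) d1 d2' dlu lu_le
    have t5 : |(1 + P'.θ) / (2 + P'.u) * dot P'.gu P'.gθ - (1 + P.θ) / (2 + P.u) * dot P.gu P.gθ| ≤
        (P'.g + P.g) * gd P P' + 2 * (m * P.g ^ 2) := by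
      refine (abs_mul_sub_mul_le _ _ _ _).trans (add_le_add ?_ ?_)
      · exact (mul_le_of_le_one_left (abs_nonneg _) a1).trans gugθ
      · calc _ ≤ (m + m) * (P.g * P.g) := by
              gcongr
              exact (abs_dot_le _ _).trans (by gcongr; exact nn _)
          _ = _ := by ring
    have gφb : ∀ {x : Fin 3 → ℝ}, nrm x ≤ P.g → |dot x P.gφ| ≤ P.g * ε := fun hx =>
      (abs_dot_le _ _).trans (by have := hP.φ; gcongr)
    have t6 : |(1 + P'.θ) / (2 + P'.u) * dot P'.gv P'.gφ - (1 + P.θ) / (2 + P.u) * dot P.gv P.gφ| ≤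
        (ε * gd P P' + p * P.g) + 2 * (m * ε * P.g) := by
      refine (abs_mul_sub_mul_le _ _ _ _).trans (add_le_add ?_ ?_)
      · exact (mul_le_of_le_one_left (abs_nonneg _) a1).trans gvgφ
      · calc _ ≤ (m + m) * (P.g * ε) := by
              gcongr
              exact gφb gv_le
          _ = _ := by ring
    have t7 : |P'.v / (2 + P'.u) * dot P'.gθ P'.gφ - P.v / (2 + P.u) * dot P.gθ P.gφ| ≤
        (ε * gd P P' + p * P.g) + 2 * (m * ε * P.g) := by
      refine (abs_mul_sub_mul_le _ _ _ _).trans (add_le_add ?_ ?_)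
      · exact (mul_le_of_le_one_left (abs_nonneg _) (by linarith only [e1, hε])).trans gθgφ
      · calc _ ≤ (m + m) * (P.g * ε) := by
              gcongr
              exact gφb gθ_le
          _ = _ := by ring
    have t8 : |(1 + P'.θ) / (2 + P'.u) * P'.v ^ 2 - (1 + P.θ) / (2 + P.u) * P.v ^ 2| ≤
        2 * (ε * |P'.v - P.v|) + m * |P.v| := by
      refine (abs_mul_sub_mul_le _ _ _ _).trans (add_le_add ?_ ?_)
      · exact (mul_le_of_le_one_left (abs_nonneg _) a1).trans vv
      · have hv := hP.v
        rw [abs_pow]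
        calc _ ≤ (m + m) * (1 / 2 * |P.v|) := by
              rw [sq]
              gcongr
              linarith only [hv, hε]
          _ = _ := by ring
    have t9 : |dot P'.gφ P'.gφ - dot P.gφ P.gφ| ≤ p * (nrm P.gφ + nrm P'.gφ) := by
      refine (abs_dot_sub_le _ _ _ _).trans ?_
      have := h.φ
      calc _ ≤ p * nrm P'.gφ + nrm P.gφ * p := by gcongr
        _ = _ := by ring
    have hS : 0 ≤ bd ε m p P P' := by simp only [bd]; positivity
    have s4 : |(c + 1) * dot P'.gθ P'.gθ - (c + 1) * dot P.gθ P.gθ| ≤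
        (c + 3) * bd ε m p P P' := by
      rw [← mul_sub, abs_mul, abs_of_nonneg (by linarith only [hc] : 0 ≤ c + 1)]
      gcongr
      · linarith only [hc]
      · exact gθgθ.trans (by simp only [bd]; linarith only [q1, q2, q3, q4, q5, q6, q7, q8, q9, q10])
    have s5 : |(c + 3) * ((1 + P'.θ) / (2 + P'.u)) * dot P'.gu P'.gθ -
        (c + 3) * ((1 + P.θ) / (2 + P.u)) * dot P.gu P.gθ| ≤ (c + 3) * (2 * bd ε m p P P') := by
      rw [mul_assoc, mul_assoc, ← mul_sub, abs_mul, abs_of_nonneg (by linarith only [hc] : 0 ≤ c + 3)]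
      gcongr
      exact t5.trans (by simp only [bd]; linarith only [q1, q2, q3, q4, q5, q6, q7, q8, q9, q10])
    have s7 : |(c + 2) * (P'.v / (2 + P'.u)) * dot P'.gθ P'.gφ -
        (c + 2) * (P.v / (2 + P.u)) * dot P.gθ P.gφ| ≤ (c + 3) * (2 * bd ε m p P P') := by
      rw [mul_assoc, mul_assoc, ← mul_sub, abs_mul, abs_of_nonneg (by linarith only [hc] : 0 ≤ c + 2)]
      gcongr
      · linarith only [hc]
      · exact t7.trans (by simp only [bd]; linarith only [q1, q2, q3, q4, q5, q6, q7, q8, q9, q10])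
    have hc3 : 3 * bd ε m p P P' ≤ (c + 3) * bd ε m p P P' := by gcongr; linarith only [hc]
    have rest : |P'.θ * P'.lθ - P.θ * P.lθ| + |P'.u / (2 * (2 + P'.u)) * P'.lθ -
        P.u / (2 * (2 + P.u)) * P.lθ| +
        |(2 * P'.θ ^ 2 + 4 * P'.θ - P'.u) / (2 * (2 + P'.u)) * P'.lu -
        (2 * P.θ ^ 2 + 4 * P.θ - P.u) / (2 * (2 + P.u)) * P.lu| +
        2 * |(1 + P'.θ) / (2 + P'.u) * dot P'.gv P'.gφ -
          (1 + P.θ) / (2 + P.u) * dot P.gv P.gφ| +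
        |(1 + P'.θ) / (2 + P'.u) * P'.v ^ 2 - (1 + P.θ) / (2 + P.u) * P.v ^ 2| +
        |dot P'.gφ P'.gφ - dot P.gφ P.gφ| ≤ 20 * bd ε m p P P' := by
      simp only [bd]
      linarith only [θlθ, blθ, dlu', t6, t8, t9, q1, q2, q3, q4, q5, q6, q7, q8, q9, q10]
    simp only [Rθ]
    generalize bd ε m p P P' = S at *
    have x1 := abs_le.1 s4
    have x2 := abs_le.1 s5
    have x3 := abs_le.1 s7
    have r1 := neg_abs_le (P'.θ * P'.lθ - P.θ * P.lθ)
    have r1' := le_abs_self (P'.θ * P'.lθ - P.θ * P.lθ)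
    have r2 := neg_abs_le (P'.u / (2 * (2 + P'.u)) * P'.lθ - P.u / (2 * (2 + P.u)) * P.lθ)
    have r2' := le_abs_self (P'.u / (2 * (2 + P'.u)) * P'.lθ - P.u / (2 * (2 + P.u)) * P.lθ)
    have r3 := neg_abs_le ((2 * P'.θ ^ 2 + 4 * P'.θ - P'.u) / (2 * (2 + P'.u)) * P'.lu -
        (2 * P.θ ^ 2 + 4 * P.θ - P.u) / (2 * (2 + P.u)) * P.lu)
    have r3' := le_abs_self ((2 * P'.θ ^ 2 + 4 * P'.θ - P'.u) / (2 * (2 + P'.u)) * P'.lu -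
        (2 * P.θ ^ 2 + 4 * P.θ - P.u) / (2 * (2 + P.u)) * P.lu)
    have r4 := neg_abs_le ((1 + P'.θ) / (2 + P'.u) * dot P'.gv P'.gφ -
          (1 + P.θ) / (2 + P.u) * dot P.gv P.gφ)
    have r4' := le_abs_self ((1 + P'.θ) / (2 + P'.u) * dot P'.gv P'.gφ -
          (1 + P.θ) / (2 + P.u) * dot P.gv P.gφ)
    have r5 := neg_abs_le ((1 + P'.θ) / (2 + P'.u) * P'.v ^ 2 - (1 + P.θ) / (2 + P.u) * P.v ^ 2)
    have r5' := le_abs_self ((1 + P'.θ) / (2 + P'.u) * P'.v ^ 2 - (1 + P.θ) / (2 + P.u) * P.v ^ 2)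
    have r6 := neg_abs_le (dot P'.gφ P'.gφ - dot P.gφ P.gφ)
    have r6' := le_abs_self (dot P'.gφ P'.gφ - dot P.gφ P.gφ)
    rw [abs_le]
    constructor <;> linarith only [x1, x2, x3, r1, r1', r2, r2', r3, r3', r4, r4', r5, r5', r6, r6', rest, hc3, hS]

end Jet

/-! ### Calculus of `L²` and `L⁴` bounds -/

/-- `f` is square integrable with `∫ f² ≤ a`. -/
def SqLe (f : E3 → ℝ) (a : ℝ) : Prop := MemLp f 2 ∧ isq f ≤ a

namespace SqLe

variable {f g k : E3 → ℝ} {a b c : ℝ}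

lemma nonneg (h : SqLe f a) : 0 ≤ a := (isq_nonneg f).trans h.2

lemma le (h : SqLe f a) (hab : a ≤ b) : SqLe f b := ⟨h.1, h.2.trans hab⟩

lemma mono (hf : SqLe f a) (hg : Continuous g) (h : ∀ x, |g x| ≤ f x) : SqLe g a := by
  have h1 : MemLp g 2 := hf.1.of_le hg.aestronglyMeasurable
    (ae_of_all _ fun x => (h x).trans (le_abs_self _))
  refine ⟨h1, le_trans (integral_mono h1.integrable_sq hf.1.integrable_sq fun x => ?_) hf.2⟩
  exact sq_le_sq' (neg_le_of_abs_le (h x)) (le_of_abs_le (h x))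

lemma abs (hf : SqLe f a) : SqLe (fun x => |f x|) a :=
  ⟨hf.1.norm, by simpa only [isq, sq_abs] using hf.2⟩

lemma const_mul (hf : SqLe f a) (r : ℝ) : SqLe (fun x => r * f x) (r ^ 2 * a) := by
  refine ⟨hf.1.const_mul r, ?_⟩
  simp only [isq, mul_pow, integral_const_mul]
  exact mul_le_mul_of_nonneg_left hf.2 (sq_nonneg r)

lemma add (hf : SqLe f a) (hg : SqLe g b) : SqLe (fun x => f x + g x) (2 * (a + b)) := by
  have h1 := hf.1.integrable_sq
  have h2 := hg.1.integrable_sq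
  refine ⟨hf.1.add hg.1, ?_⟩
  calc isq (fun x => f x + g x) ≤ ∫ x, 2 * (f x ^ 2 + g x ^ 2) := by
        refine integral_mono (hf.1.add hg.1).integrable_sq ((h1.add h2).const_mul _) fun x => ?_
        nlinarith [sq_nonneg (f x - g x)]
    _ = 2 * (isq f + isq g) := by rw [integral_const_mul, integral_add h1 h2]; rfl
    _ ≤ _ := by linarith [hf.2, hg.2]

lemma add₃ (hf : SqLe f a) (hg : SqLe g b) (hk : SqLe k c) :
    SqLe (fun x => f x + g x + k x) (3 * (a + b + c)) := by
  have h1 := hf.1.integrable_sq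
  have h2 := hg.1.integrable_sq
  have h3 := hk.1.integrable_sq
  refine ⟨(hf.1.add hg.1).add hk.1, ?_⟩
  calc isq (fun x => f x + g x + k x) ≤ ∫ x, 3 * (f x ^ 2 + g x ^ 2 + k x ^ 2) := by
        refine integral_mono ((hf.1.add hg.1).add hk.1).integrable_sq
          (((h1.add h2).add h3).const_mul _) fun x => ?_
        nlinarith [sq_nonneg (f x - g x), sq_nonneg (f x - k x), sq_nonneg (g x - k x)]
    _ = 3 * (isq f + isq g + isq k) := by
        have h12 : Integrable (fun x => f x ^ 2 + g x ^ 2) := h1.add h2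
        rw [integral_const_mul, integral_add h12 h3, integral_add h1 h2]; rfl
    _ ≤ _ := by linarith [hf.2, hg.2, hk.2]

lemma nrm {F : Fin 3 → E3 → ℝ} {a : Fin 3 → ℝ} (h : ∀ i, SqLe (F i) (a i)) :
    SqLe (fun x => nrm (fun i => F i x)) (3 * ∑ i, a i) := by
  simp only [_root_.nrm, Fin.sum_univ_three]
  exact (h 0).abs.add₃ (h 1).abs (h 2).abs

end SqLe

lemma MeasureTheory.MemLp.sqLe {f : E3 → ℝ} (h : MemLp f 2) : SqLe f (isq f) := ⟨h, le_rfl⟩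

/-- `f` is continuous with `∫ f⁴ ≤ a`. -/
def QuLe (f : E3 → ℝ) (a : ℝ) : Prop :=
  Continuous f ∧ Integrable (fun x => f x ^ 4) ∧ ∫ x, f x ^ 4 ≤ a

namespace QuLe

variable {f g k : E3 → ℝ} {a b c : ℝ}

lemma le (h : QuLe f a) (hab : a ≤ b) : QuLe f b := ⟨h.1, h.2.1, h.2.2.trans hab⟩

lemma abs (hf : QuLe f a) : QuLe (fun x => |f x|) a := by
  have : ∀ x, |f x| ^ 4 = f x ^ 4 := fun x => Even.pow_abs (by decide) _
  refine ⟨hf.1.abs, ?_⟩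
  simpa only [this] using hf.2

lemma add₃ (hf : QuLe f a) (hg : QuLe g b) (hk : QuLe k c) :
    QuLe (fun x => f x + g x + k x) (27 * (a + b + c)) := by
  have key : ∀ x, (f x + g x + k x) ^ 4 ≤ 27 * (f x ^ 4 + g x ^ 4 + k x ^ 4) := by
    intro x
    have h1 : (f x + g x + k x) ^ 2 ≤ 3 * (f x ^ 2 + g x ^ 2 + k x ^ 2) := by
      nlinarith [sq_nonneg (f x - g x), sq_nonneg (f x - k x), sq_nonneg (g x - k x)]
    have h2 : (f x ^ 2 + g x ^ 2 + k x ^ 2) ^ 2 ≤ 3 * (f x ^ 4 + g x ^ 4 + k x ^ 4) := by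
      nlinarith [sq_nonneg (f x ^ 2 - g x ^ 2), sq_nonneg (f x ^ 2 - k x ^ 2),
        sq_nonneg (g x ^ 2 - k x ^ 2)]
    have h3 := pow_le_pow_left₀ (sq_nonneg _) h1 2
    nlinarith
  have hc : Continuous (fun x => f x + g x + k x) := (hf.1.add hg.1).add hk.1
  have hi : Integrable (fun x => 27 * (f x ^ 4 + g x ^ 4 + k x ^ 4)) :=
    ((hf.2.1.add hg.2.1).add hk.2.1).const_mul 27
  have h0 : ∀ x, 0 ≤ (f x + g x + k x) ^ 4 := fun x => by positivity
  have hI : Integrable (fun x => (f x + g x + k x) ^ 4) :=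
    hi.mono' (hc.pow 4).aestronglyMeasurable (ae_of_all _ fun x => by
      rw [Real.norm_eq_abs, abs_of_nonneg (h0 x)]; exact key x)
  refine ⟨hc, hI, (integral_mono hI hi key).trans ?_⟩
  have hfg : Integrable (fun x => f x ^ 4 + g x ^ 4) := hf.2.1.add hg.2.1
  rw [integral_const_mul, integral_add hfg hk.2.1, integral_add hf.2.1 hg.2.1]
  linarith [hf.2.2, hg.2.2, hk.2.2]

lemma zero : QuLe (fun _ => 0) 0 := ⟨continuous_const, by simp, by simp⟩

lemma add (hf : QuLe f a) (hg : QuLe g b) : QuLe (fun x => f x + g x) (27 * (a + b)) := by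
  simpa using hf.add₃ hg zero

lemma nrm {F : Fin 3 → E3 → ℝ} {a : Fin 3 → ℝ} (h : ∀ i, QuLe (F i) (a i)) :
    QuLe (fun x => nrm (fun i => F i x)) (27 * ∑ i, a i) := by
  simp only [_root_.nrm, Fin.sum_univ_three]
  exact (h 0).abs.add₃ (h 1).abs (h 2).abs

lemma sq (hf : QuLe f a) : SqLe (fun x => f x ^ 2) a := by
  have e : ∀ x, (f x ^ 2) ^ 2 = f x ^ 4 := fun x => by ring
  refine ⟨(memLp_two_iff_integrable_sq (hf.1.pow 2).aestronglyMeasurable).2 ?_, ?_⟩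
  · simpa only [e, Pi.pow_apply] using hf.2.1
  · simpa only [isq, e] using hf.2.2

lemma mul (hf : QuLe f a) (hg : QuLe g b) {μ : ℝ} (hμ : 0 < μ) :
    SqLe (fun x => f x * g x) ((μ * a + b / μ) / 2) := by
  have key : ∀ x, (f x * g x) ^ 2 ≤ μ / 2 * f x ^ 4 + 1 / (2 * μ) * g x ^ 4 := by
    intro x
    have e : μ / 2 * f x ^ 4 + 1 / (2 * μ) * g x ^ 4 - (f x * g x) ^ 2
        = (μ * f x ^ 2 - g x ^ 2) ^ 2 / (2 * μ) := by field_simp; ring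
    have : 0 ≤ (μ * f x ^ 2 - g x ^ 2) ^ 2 / (2 * μ) := by positivity
    linarith
  have hc : Continuous (fun x => f x * g x) := hf.1.mul hg.1
  have hi : Integrable (fun x => μ / 2 * f x ^ 4 + 1 / (2 * μ) * g x ^ 4) :=
    (hf.2.1.const_mul _).add (hg.2.1.const_mul _)
  have hI : Integrable (fun x => (f x * g x) ^ 2) :=
    hi.mono' (hc.pow 2).aestronglyMeasurable (ae_of_all _ fun x => by
      rw [Real.norm_eq_abs, abs_of_nonneg (sq_nonneg _)]; exact key x)
  refine ⟨(memLp_two_iff_integrable_sq hc.aestronglyMeasurable).2 hI,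
    (integral_mono hI hi key).trans ?_⟩
  rw [integral_add (hf.2.1.const_mul _) (hg.2.1.const_mul _), integral_const_mul,
    integral_const_mul]
  have h1 : μ / 2 * ∫ x, f x ^ 4 ≤ μ / 2 * a := by gcongr; exact hf.2.2
  have h2 : 1 / (2 * μ) * ∫ x, g x ^ 4 ≤ 1 / (2 * μ) * b := by gcongr; exact hg.2.2
  have e : (μ * a + b / μ) / 2 = μ / 2 * a + 1 / (2 * μ) * b := by field_simp
  linarith

end QuLe

lemma Jet.sqLe_bd {ε m p a₁ a₂ a₃ a₄ a₅ a₆ a₇ a₈ a₉ a₁₀ : ℝ} {P P' : E3 → Jet}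
    (h1 : SqLe (fun x => Jet.Ld (P x) (P' x)) a₁) (h2 : SqLe (fun x => (P x).L) a₂)
    (h3 : SqLe (fun x => ((P' x).g + (P x).g) * Jet.gd (P x) (P' x)) a₃)
    (h4 : SqLe (fun x => Jet.gd (P x) (P' x)) a₄) (h5 : SqLe (fun x => (P x).g) a₅)
    (h6 : SqLe (fun x => nrm (P x).gφ) a₆) (h7 : SqLe (fun x => nrm (P' x).gφ) a₇)
    (h8 : SqLe (fun x => (P x).g ^ 2) a₈) (h9 : SqLe (fun x => (P' x).v - (P x).v) a₉)
    (h10 : SqLe (fun x => (P x).v) a₁₀) :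
    SqLe (fun x => Jet.bd ε m p (P x) (P' x))
      (27 * (ε ^ 2 * a₁ + m ^ 2 * a₂ + a₃ + ε ^ 2 * a₄ + p ^ 2 * a₅ + p ^ 2 * (2 * (a₆ + a₇))
        + (m * ε) ^ 2 * a₅ + m ^ 2 * a₈ + ε ^ 2 * a₉ + m ^ 2 * a₁₀)) := by
  have A := (h1.const_mul ε).add₃ (h2.const_mul m) h3
  have B := (h4.const_mul ε).add₃ (h5.const_mul p) ((h6.add h7).const_mul p)
  have C := (h5.const_mul (m * ε)).add₃ (h8.const_mul m) (h9.abs.const_mul ε)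
  have D := (A.add₃ B C).add (h10.abs.const_mul m)
  have n1 := h1.nonneg
  have n2 := h2.nonneg
  have n3 := h3.nonneg
  have n4 := h4.nonneg
  have n5 := h5.nonneg
  have n6 := h6.nonneg
  have n7 := h7.nonneg
  have n8 := h8.nonneg
  have n9 := h9.nonneg
  have n10 := h10.nonneg
  refine SqLe.le (b := _) ?_ (?_ : 2 * (3 * (3 * (ε ^ 2 * a₁ + m ^ 2 * a₂ + a₃)
    + 3 * (ε ^ 2 * a₄ + p ^ 2 * a₅ + p ^ 2 * (2 * (a₆ + a₇)))
    + 3 * ((m * ε) ^ 2 * a₅ + m ^ 2 * a₈ + ε ^ 2 * a₉)) + m ^ 2 * a₁₀) ≤ _)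
  · convert D using 2 with x
    simp only [Jet.bd]; ring
  · have : 0 ≤ ε ^ 2 * a₁ + m ^ 2 * a₂ + a₃ + ε ^ 2 * a₄ + p ^ 2 * a₅ + p ^ 2 * (2 * (a₆ + a₇))
        + (m * ε) ^ 2 * a₅ + m ^ 2 * a₈ + ε ^ 2 * a₉ := by positivity
    have : 0 ≤ m ^ 2 * a₁₀ := by positivity
    linarith

/-! ### Spatial slices of a solution -/

/-- The unknowns at a fixed time. -/
structure Slice where
  u : E3 → ℝ
  v : E3 → ℝ
  θ : E3 → ℝ
  φ : E3 → ℝ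

namespace Slice

variable {δ : ℝ} {S : Slice}

/-- The jet of a slice at a point. -/
def jet (S : Slice) (x : E3) : Jet where
  u := S.u x
  v := S.v x
  θ := S.θ x
  gu := fun i => pd i S.u x
  gv := fun i => pd i S.v x
  gθ := fun i => pd i S.θ x
  gφ := fun i => pd i S.φ x
  lu := lap S.u x
  lv := lap S.v x
  lθ := lap S.θ x

/-- The squared `L²` norm of the main unknowns. -/
def Lo (S : Slice) : ℝ := isq S.u + isq S.v + isq S.θ

/-- The squared `L²` norm of the gradients of the main unknowns. -/
def Gr (S : Slice) : ℝ := gradSq S.u + gradSq S.v + gradSq S.θ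

/-- The squared `L²` norm of the Hessians of the main unknowns. -/
def He (S : Slice) : ℝ := hessSq S.u + hessSq S.v + hessSq S.θ

/-- Translation. -/
def translate (S : Slice) (a : E3) : Slice :=
  ⟨fun x => S.u (x + a), fun x => S.v (x + a), fun x => S.θ (x + a), fun x => S.φ (x + a)⟩

/-- Difference of two slices. -/
def sub (S S' : Slice) : Slice :=
  ⟨fun x => S.u x - S'.u x, fun x => S.v x - S'.v x, fun x => S.θ x - S'.θ x,
    fun x => S.φ x - S'.φ x⟩

lemma sub_u (S S' : Slice) : (S.sub S').u = fun x => S.u x - S'.u x := rfl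

lemma sub_v (S S' : Slice) : (S.sub S').v = fun x => S.v x - S'.v x := rfl

lemma sub_θ (S S' : Slice) : (S.sub S').θ = fun x => S.θ x - S'.θ x := rfl

/-- The main unknowns have three square integrable derivatives. -/
structure Reg (S : Slice) : Prop where
  u : L2Reg 3 S.u
  v : L2Reg 3 S.v
  θ : L2Reg 3 S.θ

/-- Regularity and smallness of a slice of a solution. -/
structure Good (δ : ℝ) (S : Slice) : Prop extends Reg S where
  φ_smooth : ContDiff ℝ ∞ S.φ
  φ_newton : ∀ x, S.φ x = newton S.v x
  φ_memLp : ∀ i, MemLp (pd i S.φ) 2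
  le : S.Lo + S.Gr + S.He ≤ δ ^ 2
  φ_le : gradSq S.φ ≤ δ ^ 2

lemma Reg.translate (h : Reg S) (a : E3) : Reg (S.translate a) :=
  ⟨h.u.translate a, h.v.translate a, h.θ.translate a⟩

lemma Reg.sub {S' : Slice} (h : Reg S) (h' : Reg S') : Reg (S.sub S') :=
  ⟨h.u.sub h'.u, h.v.sub h'.v, h.θ.sub h'.θ⟩

lemma Lo_nonneg (S : Slice) : 0 ≤ S.Lo :=
  add_nonneg (add_nonneg (isq_nonneg _) (isq_nonneg _)) (isq_nonneg _)

lemma Gr_nonneg (S : Slice) : 0 ≤ S.Gr :=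
  add_nonneg (add_nonneg (gradSq_nonneg _) (gradSq_nonneg _)) (gradSq_nonneg _)

lemma He_nonneg (S : Slice) : 0 ≤ S.He :=
  add_nonneg (add_nonneg (hessSq_nonneg _) (hessSq_nonneg _)) (hessSq_nonneg _)

lemma jet_translate (S : Slice) (a x : E3) : (S.translate a).jet x = S.jet (x + a) := by
  simp only [jet, translate, lap, pd_translate]

lemma continuous_pd {f : E3 → ℝ} (hf : ContDiff ℝ ∞ f) (i : Fin 3) : Continuous (pd i f) :=
  (contDiff_pd hf i).continuous

/-- Uniform bounds of slices and of their translation differences. -/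
lemma exists_small : ∃ K : ℝ, 1 ≤ K ∧
    (∀ (δ : ℝ) (S : Slice), Reg S → S.Lo + S.Gr + S.He ≤ δ ^ 2 → 0 < δ →
      ∀ x, |S.u x| ≤ K * δ ∧ |S.v x| ≤ K * δ ∧ |S.θ x| ≤ K * δ) ∧
    (∀ (δ : ℝ) (S : Slice), 0 < δ → Good δ S → ∀ x, (S.jet x).Small (K * δ)) ∧
    ∀ (δ σ : ℝ) (S : Slice) (a : E3), 0 < δ → 0 < σ → Good δ S →
      ((S.translate a).sub S).Lo + ((S.translate a).sub S).Gr + ((S.translate a).sub S).He ≤ σ ^ 2 →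
      ∀ x, Jet.Close (K * σ) (K * σ) (S.jet x) ((S.translate a).jet x) := by
  obtain ⟨K₀, hK₀, hsob⟩ := exists_sobolev
  obtain ⟨C, hC, hnewt⟩ := exists_abs_pd_newton_le
  set k := K₀ + 1 with hk
  have hk1 : 1 ≤ k := by linarith
  have sup : ∀ (δ : ℝ) (f : E3 → ℝ), 0 < δ → L2Reg 3 f → isq f + gradSq f + hessSq f ≤ δ ^ 2 →
      ∀ x, |f x| ≤ k * δ := by
    intro δ f hδ hf hle x
    have h1 := hsob f hf.of_succ x
    refine abs_le_of_sq_le_sq (h1.trans ?_) (by positivity)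
    have h0 := add_nonneg (add_nonneg (isq_nonneg f) (gradSq_nonneg f)) (hessSq_nonneg f)
    calc _ ≤ k ^ 2 * δ ^ 2 := by gcongr; linarith
      _ = _ := by ring
  have bdd : ∀ (δ : ℝ) (f : E3 → ℝ), 0 < δ → L2Reg 3 f → isq f + gradSq f + hessSq f ≤ δ ^ 2 →
      BddBy (k * δ) f := by
    intro δ f hδ hf hle
    refine ⟨hf.smooth.continuous, hf.memLp, by positivity, sup δ f hδ hf hle, ?_⟩
    have : δ ^ 2 ≤ (k * δ) ^ 2 := by gcongr; nlinarith
    linarith [gradSq_nonneg f, hessSq_nonneg f]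
  have sup3 : ∀ (δ : ℝ) (S : Slice), Reg S → S.Lo + S.Gr + S.He ≤ δ ^ 2 → 0 < δ →
      (∀ x, |S.u x| ≤ k * δ ∧ |S.v x| ≤ k * δ ∧ |S.θ x| ≤ k * δ) ∧ BddBy (k * δ) S.v := by
    intro δ S hS hle hδ
    simp only [Lo, Gr, He] at hle
    have := isq_nonneg S.u
    have := isq_nonneg S.v
    have := isq_nonneg S.θ
    have := gradSq_nonneg S.u
    have := gradSq_nonneg S.v
    have := gradSq_nonneg S.θ
    have := hessSq_nonneg S.u
    have := hessSq_nonneg S.v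
    have := hessSq_nonneg S.θ
    exact ⟨fun x => ⟨sup δ _ hδ hS.u (by linarith) x, sup δ _ hδ hS.v (by linarith) x,
      sup δ _ hδ hS.θ (by linarith) x⟩, bdd δ _ hδ hS.v (by linarith)⟩
  have kK : ∀ δ : ℝ, 0 < δ → k * δ ≤ k * (1 + 3 * C) * δ := fun δ hδ => by
    have : 0 ≤ k * (3 * C) * δ := by positivity
    linarith
  have nrm3 : ∀ (p : Fin 3 → ℝ) (b : ℝ), (∀ i, |p i| ≤ b) → nrm p ≤ 3 * b := fun p b h => by
    simp only [nrm, Fin.sum_univ_three]; linarith [h 0, h 1, h 2]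
  refine ⟨k * (1 + 3 * C), by nlinarith, fun δ S hS hle hδ x => ?_, fun δ S hδ hS x => ?_,
    fun δ σ S a hδ hσ hS hle x => ?_⟩
  · obtain ⟨h1, h2, h3⟩ := (sup3 δ S hS hle hδ).1 x
    exact ⟨h1.trans (kK δ hδ), h2.trans (kK δ hδ), h3.trans (kK δ hδ)⟩
  · obtain ⟨h, hv⟩ := sup3 δ S hS.toReg hS.le hδ
    obtain ⟨h1, h2, h3⟩ := h x
    refine ⟨h1.trans (kK δ hδ), h2.trans (kK δ hδ), h3.trans (kK δ hδ), ?_⟩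
    refine (nrm3 _ _ fun i => (hnewt _ _ _ hv hS.φ_newton hS.φ_smooth).1 i x).trans ?_
    have : 0 ≤ k * δ := by positivity
    linarith
  · obtain ⟨h, hv⟩ := sup3 σ _ ((hS.toReg.translate a).sub hS.toReg) hle hσ
    obtain ⟨h1, h2, h3⟩ := h x
    obtain ⟨-, hv'⟩ := sup3 δ S hS.toReg hS.le hδ
    refine ⟨h1.trans (kK σ hσ), h2.trans (kK σ hσ), h3.trans (kK σ hσ), ?_⟩
    rw [jet_translate]
    refine (nrm3 _ _ fun i => (hnewt _ _ _ hv' hS.φ_newton hS.φ_smooth).2 a _ hv i x).trans ?_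
    have : 0 ≤ k * σ := by positivity
    linarith

/-- `L⁴` bounds of first derivatives. -/
lemma quLe_pd {f : E3 → ℝ} (hf : L2Reg 3 f) {M : ℝ} (hM : ∀ x, |f x| ≤ M) (i : Fin 3) :
    QuLe (pd i f) (9 * M ^ 2 * isq (pd i (pd i f))) := by
  obtain ⟨K, hK, hsob⟩ := exists_sobolev
  refine ⟨continuous_pd hf.smooth i, integral_pd_pow_four_le hf.of_succ hM i
    (N := √(K ^ 2 * (isq (pd i f) + gradSq (pd i f) + hessSq (pd i f)))) fun x => ?_⟩
  exact Real.abs_le_sqrt (hsob _ (hf.pderiv i) x)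

lemma sum_isq_pd_pd_le (f : E3 → ℝ) : ∑ i, isq (pd i (pd i f)) ≤ hessSq f :=
  Finset.sum_le_sum fun i _ => Finset.single_le_sum (f := fun j => isq (pd i (pd j f)))
    (fun _ _ => isq_nonneg _) (Finset.mem_univ i)

lemma quLe_nrm {f : E3 → ℝ} (hf : L2Reg 3 f) {M : ℝ} (hM : ∀ x, |f x| ≤ M) :
    QuLe (fun x => nrm fun i => pd i f x) (243 * M ^ 2 * hessSq f) := by
  refine (QuLe.nrm fun i => quLe_pd hf hM i).le ?_
  rw [← Finset.mul_sum]
  nlinarith [sum_isq_pd_pd_le f, sq_nonneg M]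

lemma sqLe_nrm {f : E3 → ℝ} (hf : ∀ i, MemLp (pd i f) 2) :
    SqLe (fun x => nrm fun i => pd i f x) (3 * gradSq f) :=
  SqLe.nrm fun i => (hf i).sqLe

lemma Reg.sqLe_g (h : Reg S) : SqLe (fun x => (S.jet x).g) (9 * S.Gr) :=
  ((sqLe_nrm fun i => (h.u.pderiv i).memLp).add₃ (sqLe_nrm fun i => (h.v.pderiv i).memLp)
    (sqLe_nrm fun i => (h.θ.pderiv i).memLp)).le (by rw [Gr]; linarith)

lemma Reg.quLe_g (h : Reg S) {M : ℝ}
    (hM : ∀ x, |S.u x| ≤ M ∧ |S.v x| ≤ M ∧ |S.θ x| ≤ M) :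
    QuLe (fun x => (S.jet x).g) (6561 * M ^ 2 * S.He) :=
  ((quLe_nrm h.u fun x => (hM x).1).add₃ (quLe_nrm h.v fun x => (hM x).2.1)
    (quLe_nrm h.θ fun x => (hM x).2.2)).le (by rw [He]; linarith)

lemma Reg.sqLe_L (h : Reg S) : SqLe (fun x => (S.jet x).L) (3 * S.He) := by
  have := h.u.of_succ.memLp_lap.sqLe.abs.add₃ h.v.of_succ.memLp_lap.sqLe.abs
    h.θ.of_succ.memLp_lap.sqLe.abs
  rwa [← h.u.hessSq_eq, ← h.v.hessSq_eq, ← h.θ.hessSq_eq] at this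

lemma lap_sub {f g : E3 → ℝ} (hf : ContDiff ℝ ∞ f) (hg : ContDiff ℝ ∞ g) (x : E3) :
    lap (fun x => f x - g x) x = lap f x - lap g x := by
  simp only [lap, pd_sub hf hg, pd_sub (contDiff_pd hf _) (contDiff_pd hg _),
    Finset.sum_sub_distrib]

lemma Reg.gd_eq {S' : Slice} (h : Reg S) (h' : Reg S') (x : E3) :
    Jet.gd (S.jet x) (S'.jet x) = ((S'.sub S).jet x).g := by
  simp only [Jet.gd, Jet.g, jet, sub_u, sub_v, sub_θ, pd_sub h'.u.smooth h.u.smooth, pd_sub h'.v.smooth h.v.smooth,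
    pd_sub h'.θ.smooth h.θ.smooth]
  rfl

lemma Reg.Ld_eq {S' : Slice} (h : Reg S) (h' : Reg S') (x : E3) :
    Jet.Ld (S.jet x) (S'.jet x) = ((S'.sub S).jet x).L := by
  simp only [Jet.Ld, Jet.L, jet, sub_u, sub_v, sub_θ, lap_sub h'.u.smooth h.u.smooth,
    lap_sub h'.v.smooth h.v.smooth, lap_sub h'.θ.smooth h.θ.smooth]

end Slice

lemma SqLe.translate {f : E3 → ℝ} {b : ℝ} (h : SqLe f b) (a : E3) :
    SqLe (fun x => f (x + a)) b :=
  ⟨h.1.comp_measurePreserving (measurePreserving_add_right volume a), by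
    rw [isq_translate]; exact h.2⟩

lemma QuLe.translate {f : E3 → ℝ} {b : ℝ} (h : QuLe f b) (a : E3) :
    QuLe (fun x => f (x + a)) b := by
  refine ⟨h.1.comp (continuous_add_const a), h.2.1.comp_add_right a, ?_⟩
  rw [integral_add_right_eq_self (fun x => f x ^ 4)]
  exact h.2.2

namespace Slice

variable {δ : ℝ} {S : Slice}

lemma continuous_lap {f : E3 → ℝ} (hf : ContDiff ℝ ∞ f) : Continuous (lap f) :=
  continuous_finsetSum _ fun i _ => continuous_pd (contDiff_pd hf i) i

lemma continuous_dot_pd {f g : E3 → ℝ} (hf : ContDiff ℝ ∞ f) (hg : ContDiff ℝ ∞ g) :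
    Continuous fun x => dot (fun i => pd i f x) (fun i => pd i g x) :=
  continuous_finsetSum _ fun i _ => (continuous_pd hf i).mul (continuous_pd hg i)

/-- Continuity of the nonlinear terms along a slice. -/
lemma Good.continuous_R (h : Good δ S) (hu : ∀ x, 2 + S.u x ≠ 0) (c : ℝ) :
    Continuous (fun x => (S.jet x).Ru) ∧ Continuous (fun x => (S.jet x).Rv) ∧
      Continuous (fun x => (S.jet x).Rθ c) := by
  have cu := h.u.smooth.continuous
  have cv := h.v.smooth.continuous
  have cθ := h.θ.smooth.continuous
  have lu := continuous_lap h.u.smooth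
  have lv := continuous_lap h.v.smooth
  have lθ := continuous_lap h.θ.smooth
  have d1 := continuous_dot_pd h.θ.smooth h.u.smooth
  have d2 := continuous_dot_pd h.v.smooth h.φ_smooth
  have d3 := continuous_dot_pd h.θ.smooth h.v.smooth
  have d4 := continuous_dot_pd h.u.smooth h.φ_smooth
  have d5 := continuous_dot_pd h.θ.smooth h.θ.smooth
  have d6 := continuous_dot_pd h.u.smooth h.θ.smooth
  have d7 := continuous_dot_pd h.θ.smooth h.φ_smooth
  have d8 := continuous_dot_pd h.φ_smooth h.φ_smooth
  have q1 : Continuous fun x => S.u x / (2 * (2 + S.u x)) :=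
    cu.div (by fun_prop) fun x => mul_ne_zero two_ne_zero (hu x)
  have q2 : Continuous fun x => (2 * S.θ x ^ 2 + 4 * S.θ x - S.u x) / (2 * (2 + S.u x)) :=
    Continuous.div (by fun_prop) (by fun_prop) fun x => mul_ne_zero two_ne_zero (hu x)
  have q3 : Continuous fun x => (1 + S.θ x) / (2 + S.u x) :=
    Continuous.div (by fun_prop) (by fun_prop) hu
  have q4 : Continuous fun x => S.v x / (2 + S.u x) :=
    Continuous.div (by fun_prop) (by fun_prop) hu
  refine ⟨?_, ?_, ?_⟩
  · simp only [Jet.Ru, jet]; fun_prop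
  · simp only [Jet.Rv, jet]; fun_prop
  · simp only [Jet.Rθ, jet]; fun_prop

lemma Good.translate_continuous_R (h : Good δ S) (hu : ∀ x, 2 + S.u x ≠ 0) (c : ℝ) (a : E3) :
    Continuous (fun x => ((S.translate a).jet x).Ru) ∧
      Continuous (fun x => ((S.translate a).jet x).Rv) ∧
      Continuous (fun x => ((S.translate a).jet x).Rθ c) := by
  simp only [jet_translate]
  obtain ⟨h1, h2, h3⟩ := h.continuous_R hu c
  have ha : Continuous fun x : E3 => x + a := continuous_add_const a
  exact ⟨h1.comp ha, h2.comp ha, h3.comp ha⟩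

lemma Small.two_add_ne_zero {ε : ℝ} (hε : ε ≤ 1 / 2) (h : ∀ x, (S.jet x).Small ε) (x : E3) :
    2 + S.u x ≠ 0 := by
  have h1 : |S.u x| ≤ ε := (h x).u
  have := neg_le_of_abs_le h1
  linarith

/-- The vanishing jet. -/
def zeroJet : Jet := ⟨0, 0, 0, 0, 0, 0, 0, 0, 0, 0⟩

lemma sqLe_zero : SqLe (fun _ => 0) 0 := ⟨MemLp.zero, by simp [isq]⟩

/-- `L²` bounds of the nonlinear terms. -/
lemma exists_sqLe_R {c : ℝ} (hc : 0 ≤ c) : ∃ C > (0 : ℝ), ∃ δ₀ > (0 : ℝ),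
    ∀ (δ : ℝ) (S : Slice), 0 < δ → δ ≤ δ₀ → Good δ S →
      SqLe (fun x => (S.jet x).Ru) (C * δ ^ 2 * (S.He + S.Gr + isq S.v + gradSq S.φ)) ∧
      SqLe (fun x => (S.jet x).Rv) (C * δ ^ 2 * (S.He + S.Gr + isq S.v + gradSq S.φ)) ∧
      SqLe (fun x => (S.jet x).Rθ c) (C * δ ^ 2 * (S.He + S.Gr + isq S.v + gradSq S.φ)) := by
  obtain ⟨K, hK, hK0, hK1, -⟩ := exists_small
  refine ⟨(40 * (c + 3)) ^ 2 * (27 * 6570 * K ^ 2), by positivity, 1 / (2 * K), by positivity,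
    fun δ S hδ hδ₀ hS => ?_⟩
  set ε := K * δ with hεd
  have hε0 : 0 < ε := by positivity
  have hε : ε ≤ 1 / 2 := by
    rw [le_div_iff₀ (by positivity)] at hδ₀; linarith
  have hsm := hK1 δ S hδ hS
  have z1 : nrm 0 = 0 := by simp [nrm]
  have zg : zeroJet.g = 0 := by simp [zeroJet, Jet.g, z1]
  have hz : zeroJet.Small ε :=
    ⟨by simp [zeroJet, hε0.le], by simp [zeroJet, hε0.le], by simp [zeroJet, hε0.le],
      by simp [zeroJet, z1, hε0.le]⟩
  have hcl : ∀ x, Jet.Close ε ε zeroJet (S.jet x) := fun x =>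
    ⟨by simpa [zeroJet] using (hsm x).u, by simpa [zeroJet] using (hsm x).v,
      by simpa [zeroJet] using (hsm x).θ, by simpa [zeroJet] using (hsm x).φ⟩
  have hR0 : zeroJet.Ru = 0 ∧ zeroJet.Rv = 0 ∧ zeroJet.Rθ c = 0 := by
    simp [zeroJet, Jet.Ru, Jet.Rv, Jet.Rθ, dot]
  have hd := fun x => Jet.diff_le hc hε hz (hsm x) (hcl x)
  simp only [hR0.1, hR0.2.1, hR0.2.2, sub_zero] at hd
  have hq := hS.toReg.quLe_g fun x => ⟨(hsm x).u, (hsm x).v, (hsm x).θ⟩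
  have hbd := Jet.sqLe_bd (ε := ε) (m := ε) (p := ε) (P := fun _ => zeroJet) (P' := S.jet)
    (a₁ := 3 * S.He) (a₂ := 0) (a₃ := 6561 * ε ^ 2 * S.He) (a₄ := 9 * S.Gr) (a₅ := 0)
    (a₆ := 0) (a₇ := 3 * gradSq S.φ) (a₈ := 0) (a₉ := isq S.v) (a₁₀ := 0)
    (by simpa [Jet.Ld, zeroJet, Jet.L] using hS.toReg.sqLe_L)
    (by simpa [Jet.L, zeroJet] using sqLe_zero)
    (by
      refine SqLe.le ?_ (by simp : (1 * (6561 * ε ^ 2 * S.He) + 6561 * ε ^ 2 * S.He / 1) / 2 ≤ _)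
      have := hq.mul hq one_pos
      simp only [zg, add_zero]
      simpa [Jet.gd, zeroJet, Jet.g] using this)
    (by simpa [Jet.gd, zeroJet, Jet.g] using hS.toReg.sqLe_g)
    (by simpa [zg] using sqLe_zero)
    (by simpa [zeroJet, z1] using sqLe_zero)
    (sqLe_nrm hS.φ_memLp)
    (by simpa [zg] using sqLe_zero)
    (by simpa [zeroJet, jet] using hS.v.memLp.sqLe)
    (by simpa [zeroJet] using sqLe_zero)
  have hle := hbd.le (b := 27 * 6570 * ε ^ 2 * (S.He + S.Gr + isq S.v + gradSq S.φ)) (by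
    have h1 : 0 ≤ ε ^ 2 * S.Gr := mul_nonneg (by positivity) S.Gr_nonneg
    have h2 : 0 ≤ ε ^ 2 * isq S.v := mul_nonneg (by positivity) (isq_nonneg _)
    have h3 : 0 ≤ ε ^ 2 * gradSq S.φ := mul_nonneg (by positivity) (gradSq_nonneg _)
    have h4 : 0 ≤ ε ^ 2 * S.He := mul_nonneg (by positivity) S.He_nonneg
    linarith)
  have hbig := hle.const_mul (40 * (c + 3))
  have e : (40 * (c + 3)) ^ 2 * (27 * 6570 * ε ^ 2 * (S.He + S.Gr + isq S.v + gradSq S.φ)) =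
      (40 * (c + 3)) ^ 2 * (27 * 6570 * K ^ 2) * δ ^ 2 *
        (S.He + S.Gr + isq S.v + gradSq S.φ) := by rw [hεd]; ring
  rw [e] at hbig
  have hpos : ∀ x, 0 ≤ Jet.bd ε ε ε zeroJet (S.jet x) := fun x => by
    have := (abs_nonneg _).trans (hd x).1
    linarith
  have h10 : ∀ x, 10 * Jet.bd ε ε ε zeroJet (S.jet x) ≤
      40 * (c + 3) * Jet.bd ε ε ε zeroJet (S.jet x) := fun x => by
    have := hpos x
    gcongr; linarith
  obtain ⟨c1, c2, c3⟩ := hS.continuous_R (Small.two_add_ne_zero hε hsm) c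
  exact ⟨hbig.mono c1 fun x => (hd x).1.trans (h10 x),
    hbig.mono c2 fun x => (hd x).2.1.trans (h10 x), hbig.mono c3 fun x => (hd x).2.2⟩

/-- `L²` bounds of translation differences of the nonlinear terms. -/
lemma exists_sqLe_R_sub {c : ℝ} (hc : 0 ≤ c) : ∃ C > (0 : ℝ), ∃ δ₀ > (0 : ℝ),
    ∀ (δ σ : ℝ) (S : Slice) (a : E3), 0 < δ → δ ≤ δ₀ → 0 < σ → Good δ S →
      ((S.translate a).sub S).Lo + ((S.translate a).sub S).Gr + ((S.translate a).sub S).He ≤ σ ^ 2 →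
      SqLe (fun x => ((S.translate a).jet x).Ru - (S.jet x).Ru) (C * δ ^ 2 * σ ^ 2) ∧
      SqLe (fun x => ((S.translate a).jet x).Rv - (S.jet x).Rv) (C * δ ^ 2 * σ ^ 2) ∧
      SqLe (fun x => ((S.translate a).jet x).Rθ c - (S.jet x).Rθ c) (C * δ ^ 2 * σ ^ 2) := by
  obtain ⟨K, hK, hK0, hK1, hK2⟩ := exists_small
  refine ⟨(40 * (c + 3)) ^ 2 * (27 * 1000000 * K ^ 4), by positivity, 1 / (2 * K),
    by positivity, fun δ σ S a hδ hδ₀ hσ hS hle => ?_⟩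
  have hε : K * δ ≤ 1 / 2 := by
    rw [le_div_iff₀ (by positivity)] at hδ₀; linarith
  have hδ1 : δ ≤ 1 := by nlinarith
  have hsm := hK1 δ S hδ hS
  have hsm' : ∀ x, ((S.translate a).jet x).Small (K * δ) := fun x => by
    rw [jet_translate]; exact hsm _
  have hcl := hK2 δ σ S a hδ hσ hS hle
  have hr' := hS.toReg.translate a
  have hW := hr'.sub hS.toReg
  have hsW := hK0 σ _ hW hle hσ
  set W := (S.translate a).sub S with hWd
  have hd := fun x => Jet.diff_le hc hε (hsm x) (hsm' x) (hcl x)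
  have hq := hS.toReg.quLe_g fun x => ⟨(hsm x).u, (hsm x).v, (hsm x).θ⟩
  have hqW := hW.quLe_g hsW
  have Wn := W.Lo_nonneg
  have Wn1 := W.Gr_nonneg
  have Wn2 := W.He_nonneg
  have hSle := hS.le
  have Sn := S.Lo_nonneg
  have Sn1 := S.Gr_nonneg
  have Sn2 := S.He_nonneg
  have hv : isq S.v ≤ S.Lo := by rw [Lo]; linarith [isq_nonneg S.u, isq_nonneg S.θ]
  have hvW : isq W.v ≤ W.Lo := by rw [Lo]; linarith [isq_nonneg W.u, isq_nonneg W.θ]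
  have hgφ : SqLe (fun x => nrm (S.jet x).gφ) (3 * δ ^ 2) :=
    (sqLe_nrm hS.φ_memLp).le (by linarith [hS.φ_le])
  have hprod := (((hq.translate a).add hq).le
    (b := 54 * 6561 * K ^ 2 * δ ^ 4) (by
      have : (K * δ) ^ 2 * S.He ≤ (K * δ) ^ 2 * δ ^ 2 := by gcongr; linarith
      nlinarith)).mul (hqW.le (b := 6561 * K ^ 2 * σ ^ 4) (by
      have : (K * σ) ^ 2 * W.He ≤ (K * σ) ^ 2 * σ ^ 2 := by gcongr; linarith
      nlinarith)) (by positivity : 0 < σ ^ 2 / δ ^ 2)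
  have hbd := Jet.sqLe_bd (ε := K * δ) (m := K * σ) (p := K * σ) (P := S.jet)
    (P' := (S.translate a).jet)
    (a₁ := 3 * σ ^ 2) (a₂ := 3 * δ ^ 2) (a₃ := 55 * 6561 * K ^ 2 * δ ^ 2 * σ ^ 2)
    (a₄ := 9 * σ ^ 2) (a₅ := 9 * δ ^ 2) (a₆ := 3 * δ ^ 2) (a₇ := 3 * δ ^ 2)
    (a₈ := 6561 * (K * δ) ^ 2 * δ ^ 2) (a₉ := σ ^ 2) (a₁₀ := δ ^ 2)
    (by
      simp only [Reg.Ld_eq hS.toReg hr']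
      exact hW.sqLe_L.le (by linarith))
    (hS.toReg.sqLe_L.le (by linarith))
    (by
      simp only [Reg.gd_eq hS.toReg hr']
      simp only [jet_translate]
      refine hprod.le ?_
      have e : (σ ^ 2 / δ ^ 2 * (54 * 6561 * K ^ 2 * δ ^ 4) +
          6561 * K ^ 2 * σ ^ 4 / (σ ^ 2 / δ ^ 2)) / 2 =
          1 / 2 * (55 * 6561 * K ^ 2 * δ ^ 2 * σ ^ 2) := by field_simp; ring
      rw [e]
      have : 0 ≤ 55 * 6561 * K ^ 2 * δ ^ 2 * σ ^ 2 := by positivity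
      linarith)
    (by
      simp only [Reg.gd_eq hS.toReg hr']
      exact hW.sqLe_g.le (by linarith))
    (hS.toReg.sqLe_g.le (by linarith))
    hgφ
    (by simp only [jet_translate]; exact hgφ.translate a)
    (hq.sq.le (by gcongr; linarith))
    (hW.v.memLp.sqLe.le (by linarith))
    (hS.v.memLp.sqLe.le (by linarith))
  have hle2 := hbd.le (b := 27 * 1000000 * K ^ 4 * δ ^ 2 * σ ^ 2) (by
    have h1 : 0 ≤ δ ^ 2 * σ ^ 2 := by positivity
    have hK2 : 1 ≤ K ^ 2 := one_le_pow₀ hK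
    have h2 : K ^ 2 * (δ ^ 2 * σ ^ 2) ≤ K ^ 4 * (δ ^ 2 * σ ^ 2) := by
      gcongr
      · norm_num
    have h3 : K ^ 4 * (δ ^ 2 * σ ^ 2) * δ ^ 2 ≤ K ^ 4 * (δ ^ 2 * σ ^ 2) := by
      have : δ ^ 2 ≤ 1 := pow_le_one₀ hδ.le hδ1
      exact mul_le_of_le_one_right (by positivity) this
    have h4 : 0 ≤ K ^ 4 * (δ ^ 2 * σ ^ 2) := by positivity
    have e : 27 * ((K * δ) ^ 2 * (3 * σ ^ 2) + (K * σ) ^ 2 * (3 * δ ^ 2) +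
        55 * 6561 * K ^ 2 * δ ^ 2 * σ ^ 2 + (K * δ) ^ 2 * (9 * σ ^ 2) + (K * σ) ^ 2 * (9 * δ ^ 2) +
        (K * σ) ^ 2 * (2 * (3 * δ ^ 2 + 3 * δ ^ 2)) + (K * σ * (K * δ)) ^ 2 * (9 * δ ^ 2) +
        (K * σ) ^ 2 * (6561 * (K * δ) ^ 2 * δ ^ 2) + (K * δ) ^ 2 * σ ^ 2 + (K * σ) ^ 2 * δ ^ 2) =
      27 * (360893 * (K ^ 2 * (δ ^ 2 * σ ^ 2)) + 6570 * (K ^ 4 * (δ ^ 2 * σ ^ 2) * δ ^ 2)) := by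
      ring
    linarith)
  have hbig := hle2.const_mul (40 * (c + 3))
  rw [show (40 * (c + 3)) ^ 2 * (27 * 1000000 * K ^ 4 * δ ^ 2 * σ ^ 2) =
    (40 * (c + 3)) ^ 2 * (27 * 1000000 * K ^ 4) * δ ^ 2 * σ ^ 2 by ring] at hbig
  have hpos : ∀ x, 0 ≤ Jet.bd (K * δ) (K * σ) (K * σ) (S.jet x) ((S.translate a).jet x) :=
    fun x => by
      have := (abs_nonneg _).trans (hd x).1
      linarith
  have h10 : ∀ x, 10 * Jet.bd (K * δ) (K * σ) (K * σ) (S.jet x) ((S.translate a).jet x) ≤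
      40 * (c + 3) * Jet.bd (K * δ) (K * σ) (K * σ) (S.jet x) ((S.translate a).jet x) :=
    fun x => by
      have := hpos x
      gcongr; linarith
  have hne := Small.two_add_ne_zero hε hsm
  obtain ⟨c1, c2, c3⟩ := hS.continuous_R hne c
  obtain ⟨d1, d2, d3⟩ := hS.translate_continuous_R hne c a
  exact ⟨hbig.mono (d1.sub c1) fun x => (hd x).1.trans (h10 x),
    hbig.mono (d2.sub c2) fun x => (hd x).2.1.trans (h10 x),
    hbig.mono (d3.sub c3) fun x => (hd x).2.2⟩

end Slice

/-! ### Lower semicontinuity and difference quotients -/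

lemma isq_le_of_tendsto {F : ℕ → E3 → ℝ} {g : E3 → ℝ} {b : ℝ} (hF : ∀ n, MemLp (F n) 2)
    (hg : MemLp g 2) (h : ∀ x, Tendsto (fun n => F n x) atTop (𝓝 (g x)))
    (hb : ∀ n, isq (F n) ≤ b) : isq g ≤ b := by
  have e : ∀ {f : E3 → ℝ}, MemLp f 2 → ∫⁻ x, ENNReal.ofReal (f x ^ 2) = ENNReal.ofReal (isq f) :=
    fun hf => (ofReal_integral_eq_lintegral_ofReal hf.integrable_sq
      (ae_of_all _ fun x => sq_nonneg _)).symm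
  have hb0 : 0 ≤ b := (isq_nonneg _).trans (hb 0)
  have key : ∫⁻ x, ENNReal.ofReal (g x ^ 2) ≤
      liminf (fun n => ∫⁻ x, ENNReal.ofReal (F n x ^ 2)) atTop := by
    refine le_trans (le_of_eq (lintegral_congr fun x => ?_)) (lintegral_liminf_le' fun n =>
      ((hF n).aestronglyMeasurable.aemeasurable.pow_const 2).ennreal_ofReal)
    exact ((ENNReal.continuous_ofReal.tendsto _).comp ((h x).pow 2)).liminf_eq.symm
  rw [e hg] at key
  have h2 : liminf (fun n => ∫⁻ x, ENNReal.ofReal (F n x ^ 2)) atTop ≤ ENNReal.ofReal b := by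
    refine liminf_le_of_le (by isBoundedDefault) fun B hB => ?_
    obtain ⟨n, hn⟩ := hB.exists
    rw [e (hF n)] at hn
    exact hn.trans (ENNReal.ofReal_le_ofReal (hb n))
  exact (ENNReal.ofReal_le_ofReal_iff hb0).1 (key.trans h2)

lemma eventually_lt_isq {ι : Type*} {l : Filter ι} [l.IsCountablyGenerated] {F : ι → E3 → ℝ}
    {g : E3 → ℝ} (hF : ∀ n, MemLp (F n) 2) (hg : MemLp g 2)
    (h : ∀ x, Tendsto (fun n => F n x) l (𝓝 (g x))) {a : ℝ} (ha : a < isq g) :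
    ∀ᶠ n in l, a < isq (F n) := by
  by_contra hc
  rw [not_eventually] at hc
  obtain ⟨ns, hns, hp⟩ := exists_seq_forall_of_frequently hc
  exact ha.not_ge (isq_le_of_tendsto (fun n => hF (ns n)) hg (fun x => (h x).comp hns)
    fun n => not_lt.1 (hp n))

/-- If `f n → f` pointwise with convergence of the `L²` norms and `g n → g` pointwise with bounded
`L²` norms, then `∫ f n * g n → ∫ f * g`. -/
lemma tendsto_integral_mul {ι : Type*} {l : Filter ι} [l.IsCountablyGenerated]
    {F G : ι → E3 → ℝ} {f g : E3 → ℝ} {M : ℝ} (hF : ∀ n, MemLp (F n) 2) (hG : ∀ n, MemLp (G n) 2)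
    (hf : MemLp f 2) (hg : MemLp g 2) (hFf : ∀ x, Tendsto (fun n => F n x) l (𝓝 (f x)))
    (hGg : ∀ x, Tendsto (fun n => G n x) l (𝓝 (g x)))
    (hn : Tendsto (fun n => isq (F n)) l (𝓝 (isq f))) (hM : ∀ᶠ n in l, isq (G n) ≤ M) :
    Tendsto (fun n => ∫ x, F n x * G n x) l (𝓝 (∫ x, f x * g x)) := by
  have ex : ∀ {p q : E3 → ℝ} (r : ℝ), MemLp p 2 → MemLp q 2 →
      isq (fun x => p x + r * q x) = isq p + 2 * r * (∫ x, p x * q x) + r ^ 2 * isq q := by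
    intro p q r hp hq
    have h1 := hp.integrable_sq
    have h2 := hq.integrable_sq
    have h3 := hp.integrable_mul_two hq
    have h13 : Integrable (fun x => p x ^ 2 + 2 * r * (p x * q x)) := h1.add (h3.const_mul _)
    calc isq (fun x => p x + r * q x)
        = ∫ x, (p x ^ 2 + 2 * r * (p x * q x) + r ^ 2 * q x ^ 2) := by
          refine integral_congr_ae (ae_of_all _ fun x => ?_); simp only []; ring
      _ = _ := by
          rw [integral_add h13 (h2.const_mul _), integral_add h1 (h3.const_mul _),
            integral_const_mul, integral_const_mul]
          rfl
  have main : ∀ r : ℝ, ∀ η > 0, ∀ᶠ n in l,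
      2 * r * (∫ x, f x * g x) - r ^ 2 * M - η < 2 * r * ∫ x, F n x * G n x := by
    intro r η hη
    have h1 := eventually_lt_isq (F := fun n x => F n x + r * G n x)
      (g := fun x => f x + r * g x) (a := isq (fun x => f x + r * g x) - η / 2)
      (fun n => (hF n).add ((hG n).const_mul r)) (hf.add (hg.const_mul r))
      (fun x => (hFf x).add ((hGg x).const_mul r)) (by linarith)
    have h2 := hn.eventually (gt_mem_nhds (by linarith : isq f < isq f + η / 2))
    filter_upwards [h1, h2, hM] with n a1 a2 a3
    rw [ex r hf hg, ex r (hF n) (hG n)] at a1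
    have a4 : r ^ 2 * isq (G n) ≤ r ^ 2 * M := by gcongr
    have a5 : 0 ≤ r ^ 2 * isq g := mul_nonneg (sq_nonneg _) (isq_nonneg _)
    linarith
  rw [Metric.tendsto_nhds]
  intro ε hε
  have hM1 : 0 < |M| + 1 := by positivity
  set r := ε / (|M| + 1) with hr
  have hr0 : 0 < r := by positivity
  have hrM : r * M < ε := by
    calc r * M ≤ r * |M| := by gcongr; exact le_abs_self M
      _ < r * (|M| + 1) := by gcongr; linarith
      _ = ε := by rw [hr]; field_simp
  filter_upwards [main r (r * (ε / 2)) (by positivity), main (-r) (r * (ε / 2)) (by positivity)]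
    with n a1 a2
  have b1 : (∫ x, f x * g x) - r * M / 2 - ε / 4 < ∫ x, F n x * G n x := by
    by_contra hc
    have := mul_le_mul_of_nonneg_left (not_lt.1 hc) (by positivity : 0 ≤ 2 * r)
    nlinarith
  have b2 : ∫ x, F n x * G n x < (∫ x, f x * g x) + r * M / 2 + ε / 4 := by
    by_contra hc
    have := mul_le_mul_of_nonneg_left (not_lt.1 hc) (by positivity : 0 ≤ 2 * r)
    nlinarith
  rw [Real.dist_eq, abs_lt]
  constructor <;> linarith

lemma tendsto_isq_translate_sub {g : E3 → ℝ} (hg : ContDiff ℝ ∞ g) (h2 : MemLp g 2) (i : Fin 3)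
    (hi : MemLp (pd i g) 2) :
    Tendsto (fun h : ℝ => isq (fun x => g (x + h • ei i) - g x) / h ^ 2) (𝓝[≠] 0)
      (𝓝 (isq (pd i g))) := by
  have e : ∀ h : ℝ, isq (fun x => h⁻¹ * (g (x + h • ei i) - g x)) =
      isq (fun x => g (x + h • ei i) - g x) / h ^ 2 := fun h => by
    simp only [isq, mul_pow, integral_const_mul, inv_pow]
    rw [div_eq_inv_mul]
  have m : ∀ h : ℝ, MemLp (fun x => h⁻¹ * (g (x + h • ei i) - g x)) 2 := fun h =>
    ((h2.comp_measurePreserving (measurePreserving_add_right volume (h • ei i))).sub h2).const_mul _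
  refine tendsto_order.2 ⟨fun a ha => ?_, fun a ha => ?_⟩
  · simp only [← e]
    refine eventually_lt_isq m hi (fun x => ?_) ha
    have := (hasDerivAt_add_smul_ei hg i x 1 0)
    have h3 : HasDerivAt (fun h : ℝ => g (x + h • ei i)) (pd i g x) 0 := by
      simpa using this
    have h4 := h3.tendsto_slope_zero
    simpa using h4
  · filter_upwards [self_mem_nhdsWithin] with h hh
    have hh2 : 0 < h ^ 2 := by
      have : h ≠ 0 := hh
      positivity
    refine lt_of_le_of_lt ?_ ha
    rw [div_le_iff₀ hh2, mul_comm]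
    exact isq_translate_sub_le hg i hi h

lemma pd_translate_sub {f : E3 → ℝ} (hf : ContDiff ℝ ∞ f) (a : E3) (j : Fin 3) :
    pd j (fun x => f (x + a) - f x) = fun x => pd j f (x + a) - pd j f x := by
  have hfa : ContDiff ℝ ∞ (fun x => f (x + a)) := hf.comp (contDiff_id.add contDiff_const)
  rw [pd_sub hfa hf, pd_translate]

lemma gradSq_translate_sub_le {f : E3 → ℝ} (hf : L2Reg 2 f) (i : Fin 3) (r : ℝ) :
    gradSq (fun x => f (x + r • ei i) - f x) ≤ r ^ 2 * gradSq (pd i f) := by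
  rw [gradSq, gradSq, Finset.mul_sum]
  refine Finset.sum_le_sum fun j _ => ?_
  rw [pd_translate_sub hf.smooth, pd_comm hf.smooth j i]
  exact isq_translate_sub_le (contDiff_pd hf.smooth j) i ((hf.pderiv j).pderiv i).memLp r

lemma pd_pd_translate_sub {f : E3 → ℝ} (hf : ContDiff ℝ ∞ f) (a : E3) (j k : Fin 3) :
    pd j (pd k (fun x => f (x + a) - f x)) =
      fun x => pd j (pd k f) (x + a) - pd j (pd k f) x := by
  rw [pd_translate_sub hf, pd_translate_sub (contDiff_pd hf k)]

lemma pd_pd_pd_comm {f : E3 → ℝ} (hf : ContDiff ℝ ∞ f) (i j k : Fin 3) :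
    pd j (pd k (pd i f)) = pd i (pd j (pd k f)) := by
  rw [pd_comm hf k i, pd_comm (contDiff_pd hf k) j i]

lemma hessSq_translate_sub_le {f : E3 → ℝ} (hf : L2Reg 3 f) (i : Fin 3) (r : ℝ) :
    hessSq (fun x => f (x + r • ei i) - f x) ≤ r ^ 2 * hessSq (pd i f) := by
  simp only [hessSq, Finset.mul_sum]
  refine Finset.sum_le_sum fun j _ => Finset.sum_le_sum fun k _ => ?_
  rw [pd_pd_translate_sub hf.smooth, pd_pd_pd_comm hf.smooth]
  exact isq_translate_sub_le (contDiff_pd (contDiff_pd hf.smooth k) j) i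
    (((hf.pderiv k).pderiv j).pderiv i).memLp r

lemma tendsto_hessSq_translate_sub {f : E3 → ℝ} (hf : L2Reg 3 f) (i : Fin 3) :
    Tendsto (fun h : ℝ => hessSq (fun x => f (x + h • ei i) - f x) / h ^ 2) (𝓝[≠] 0)
      (𝓝 (hessSq (pd i f))) := by
  simp only [hessSq, Finset.sum_div, pd_pd_translate_sub hf.smooth, pd_pd_pd_comm hf.smooth]
  exact tendsto_finsetSum _ fun j _ => tendsto_finsetSum _ fun k _ =>
    tendsto_isq_translate_sub (contDiff_pd (contDiff_pd hf.smooth k) j)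
      ((hf.pderiv k).pderiv j).memLp i (((hf.pderiv k).pderiv j).pderiv i).memLp

namespace Slice

variable {S : Slice}

/-- The partial derivative of a slice. -/
def pderiv (S : Slice) (i : Fin 3) : Slice := ⟨pd i S.u, pd i S.v, pd i S.θ, pd i S.φ⟩

/-- The difference of a slice and its translate. -/
def diff (S : Slice) (i : Fin 3) (r : ℝ) : Slice := (S.translate (r • ei i)).sub S

lemma Reg.diff (h : Reg S) (i : Fin 3) (r : ℝ) : Reg (S.diff i r) := (h.translate _).sub h

lemma Reg.Lo_diff_le (h : Reg S) (i : Fin 3) (r : ℝ) : (S.diff i r).Lo ≤ r ^ 2 * S.Gr := by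
  have h1 := isq_translate_sub_le h.u.smooth i (h.u.pderiv i).memLp r
  have h2 := isq_translate_sub_le h.v.smooth i (h.v.pderiv i).memLp r
  have h3 := isq_translate_sub_le h.θ.smooth i (h.θ.pderiv i).memLp r
  have h4 : (S.pderiv i).Lo ≤ S.Gr := add_le_add (add_le_add (isq_pd_le_gradSq _ i)
    (isq_pd_le_gradSq _ i)) (isq_pd_le_gradSq _ i)
  refine le_trans ?_ (mul_le_mul_of_nonneg_left h4 (sq_nonneg r))
  have := add_le_add (add_le_add h1 h2) h3
  rwa [← mul_add, ← mul_add] at this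

lemma gradSq_pd_le (f : E3 → ℝ) (i : Fin 3) : gradSq (pd i f) ≤ hessSq f := by
  rw [gradSq, hessSq]
  exact Finset.sum_le_sum fun j _ => Finset.single_le_sum (f := fun k => isq (pd j (pd k f)))
    (fun _ _ => isq_nonneg _) (Finset.mem_univ i)

lemma Reg.Gr_diff_le (h : Reg S) (i : Fin 3) (r : ℝ) : (S.diff i r).Gr ≤ r ^ 2 * S.He := by
  have h1 := gradSq_translate_sub_le h.u.of_succ i r
  have h2 := gradSq_translate_sub_le h.v.of_succ i r
  have h3 := gradSq_translate_sub_le h.θ.of_succ i r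
  have h4 : (S.pderiv i).Gr ≤ S.He := add_le_add (add_le_add (gradSq_pd_le _ i)
    (gradSq_pd_le _ i)) (gradSq_pd_le _ i)
  refine le_trans ?_ (mul_le_mul_of_nonneg_left h4 (sq_nonneg r))
  have := add_le_add (add_le_add h1 h2) h3
  rwa [← mul_add, ← mul_add] at this

lemma Reg.He_diff_le (h : Reg S) (i : Fin 3) (r : ℝ) :
    (S.diff i r).He ≤ r ^ 2 * (S.pderiv i).He := by
  have := add_le_add (add_le_add (hessSq_translate_sub_le h.u i r)
    (hessSq_translate_sub_le h.v i r)) (hessSq_translate_sub_le h.θ i r)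
  rwa [← mul_add, ← mul_add] at this

lemma Reg.tendsto_He_diff (h : Reg S) (i : Fin 3) :
    Tendsto (fun r : ℝ => (S.diff i r).He / r ^ 2) (𝓝[≠] 0) (𝓝 (S.pderiv i).He) := by
  have := ((tendsto_hessSq_translate_sub h.u i).add (tendsto_hessSq_translate_sub h.v i)).add
    (tendsto_hessSq_translate_sub h.θ i)
  simp only [← add_div] at this
  exact this

/-! ### The dissipation inequality at a fixed time -/

/-- Coercivity of the linear part and bounds of the time derivatives. -/
lemma Reg.dissipation (h : Reg S) {c b : ℝ} (hc : 1 < c) {ru rv rθ du dv dθ : E3 → ℝ}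
    (hru : SqLe ru b) (hrv : SqLe rv b) (hrθ : SqLe rθ b)
    (hu : ∀ x, du x = lap S.u x + 2 * lap S.θ x + ru x)
    (hv : ∀ x, dv x = lap S.v x - 2 * S.v x + rv x)
    (hθ : ∀ x, c * dθ x = 3 / 2 * lap S.θ x + 1 / 2 * lap S.u x + rθ x) :
    (SqLe du (15 * (S.He + S.Lo + b)) ∧ SqLe dv (15 * (S.He + S.Lo + b)) ∧
      SqLe dθ (15 * (S.He + S.Lo + b))) ∧
    1 / 10 * S.He + 2 * gradSq S.v - 36 * b ≤
      (∫ x, lap S.u x * du x) + (∫ x, lap S.v x * dv x) + 2 * c * ∫ x, lap S.θ x * dθ x := by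
  have hb := hru.nonneg
  have lu : SqLe (lap S.u) (hessSq S.u) := ⟨h.u.of_succ.memLp_lap, h.u.hessSq_eq.ge⟩
  have lv : SqLe (lap S.v) (hessSq S.v) := ⟨h.v.of_succ.memLp_lap, h.v.hessSq_eq.ge⟩
  have lθ : SqLe (lap S.θ) (hessSq S.θ) := ⟨h.θ.of_succ.memLp_lap, h.θ.hessSq_eq.ge⟩
  have n1 := hessSq_nonneg S.u
  have n2 := hessSq_nonneg S.v
  have n3 := hessSq_nonneg S.θ
  have m1 := isq_nonneg S.u
  have m2 := isq_nonneg S.v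
  have m3 := isq_nonneg S.θ
  have su : SqLe du (15 * (S.He + S.Lo + b)) := by
    have := lu.add₃ (lθ.const_mul 2) hru
    simp only [← hu] at this
    exact this.le (by rw [He, Lo]; linarith)
  have sv : SqLe dv (15 * (S.He + S.Lo + b)) := by
    have := lv.add₃ (h.v.memLp.sqLe.const_mul (-2)) hrv
    have e : ∀ x, lap S.v x + -2 * S.v x + rv x = dv x := fun x => by rw [hv]; ring
    simp only [e] at this
    exact this.le (by rw [He, Lo]; linarith)
  have sθ : SqLe dθ (15 * (S.He + S.Lo + b)) := by
    have := ((lθ.const_mul (3 / 2)).add₃ (lu.const_mul (1 / 2)) hrθ).const_mul c⁻¹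
    have e : ∀ x, c⁻¹ * (3 / 2 * lap S.θ x + 1 / 2 * lap S.u x + rθ x) = dθ x := fun x => by
      rw [← hθ]; field_simp
    simp only [e] at this
    have hc1 : c⁻¹ ^ 2 ≤ 1 := pow_le_one₀ (by positivity) (inv_le_one_of_one_le₀ hc.le)
    refine this.le ((mul_le_of_le_one_left (by positivity) hc1).trans ?_)
    rw [He, Lo]; linarith
  refine ⟨⟨su, sv, sθ⟩, ?_⟩
  have i1 := lu.1.integrable_mul_two su.1
  have i2 := lv.1.integrable_mul_two sv.1
  have i3 := lθ.1.integrable_mul_two sθ.1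
  have i4 := h.v.memLp.integrable_mul_two lv.1
  have q1 := lu.1.integrable_sq
  have q2 := lv.1.integrable_sq
  have q3 := lθ.1.integrable_sq
  have r1 := hru.1.integrable_sq
  have r2 := hrv.1.integrable_sq
  have r3 := hrθ.1.integrable_sq
  have q12 : Integrable fun x => lap S.u x ^ 2 + lap S.v x ^ 2 := q1.add q2
  have q123 : Integrable fun x => lap S.u x ^ 2 + lap S.v x ^ 2 + lap S.θ x ^ 2 := q12.add q3
  have r12 : Integrable fun x => ru x ^ 2 + rv x ^ 2 := r1.add r2
  have r123 : Integrable fun x => ru x ^ 2 + rv x ^ 2 + rθ x ^ 2 := r12.add r3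
  have i12 : Integrable fun x => lap S.u x * du x + lap S.v x * dv x := i1.add i2
  have i123 : Integrable fun x => lap S.u x * du x + lap S.v x * dv x +
      2 * c * (lap S.θ x * dθ x) := i12.add (i3.const_mul _)
  have L1 : Integrable fun x => 1 / 10 * (lap S.u x ^ 2 + lap S.v x ^ 2 + lap S.θ x ^ 2) -
      2 * (S.v x * lap S.v x) := (q123.const_mul _).sub (i4.const_mul _)
  have L2 : Integrable fun x => 1 / 10 * (lap S.u x ^ 2 + lap S.v x ^ 2 + lap S.θ x ^ 2) -
      2 * (S.v x * lap S.v x) - 12 * (ru x ^ 2 + rv x ^ 2 + rθ x ^ 2) := L1.sub (r123.const_mul _)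
  have key := integral_mono L2 i123 fun x => by
    have e : 2 * c * (lap S.θ x * dθ x) = 2 * lap S.θ x * (c * dθ x) := by ring
    simp only [e, hu, hv, hθ]
    nlinarith [sq_nonneg (lap S.u x + 18 * ru x), sq_nonneg (lap S.θ x + 18 * rθ x),
      sq_nonneg (lap S.v x + 18 * rv x), sq_nonneg (6 * lap S.u x + 11 * lap S.θ x),
      sq_nonneg (3 * lap S.u x + 5 * lap S.θ x), sq_nonneg (5 * lap S.u x + 9 * lap S.θ x),
      sq_nonneg (ru x), sq_nonneg (rv x), sq_nonneg (rθ x), sq_nonneg (lap S.v x)]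
  rw [integral_sub L1 (r123.const_mul _), integral_sub (q123.const_mul _) (i4.const_mul _),
    integral_const_mul, integral_const_mul, integral_const_mul, integral_add q12 q3,
    integral_add q1 q2, integral_add r12 r3, integral_add r1 r2,
    integral_add i12 (i3.const_mul _), integral_add i1 i2, integral_const_mul,
    h.v.of_succ.integral_mul_lap] at key
  have f1 := h.u.hessSq_eq
  have f2 := h.v.hessSq_eq
  have f3 := h.θ.hessSq_eq
  have g1 := hru.2
  have g2 := hrv.2
  have g3 := hrθ.2
  simp only [isq] at f1 f2 f3 g1 g2 g3
  rw [He]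
  linarith

end Slice

/-! ### Energy identity and evolution of slices -/

lemma lap_cont {f : ℝ → E3 → ℝ} (hf : JS f) :
    Continuous (fun q : ℝ × E3 => lap (f q.1) q.2) :=
  continuous_finsetSum _ fun j _ => ((hf.pd j).pd j).cont

lemma measurable_hessSq {f : ℝ → E3 → ℝ} (hf : JS f) : Measurable fun s => hessSq (f s) := by
  simp only [hessSq]
  exact Finset.measurable_sum _ fun j _ => Finset.measurable_sum _ fun k _ =>
    (JS.stronglyMeasurable_integral (((hf.pd k).pd j).cont.pow 2)).measurable

lemma intervalIntegrable_of_measurable {g : ℝ → ℝ} (hg : Measurable g) {t₁ t₂ M : ℝ} (h : t₁ ≤ t₂)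
    (hM : ∀ s ∈ Set.Icc t₁ t₂, |g s| ≤ M) : IntervalIntegrable g volume t₁ t₂ := by
  rw [intervalIntegrable_iff_integrableOn_Ioc_of_le h]
  refine Measure.integrableOn_of_bounded (M := M) (by simp) hg.aestronglyMeasurable ?_
  filter_upwards [ae_restrict_mem measurableSet_Ioc] with s hs
  exact hM s ⟨hs.1.le, hs.2⟩

lemma intervalIntegrable_pd_pd_mul_dt {f : ℝ → E3 → ℝ} (hf : JS f) {t₁ t₂ M : ℝ} (h : t₁ ≤ t₂)
    (j : Fin 3) (hr : ∀ s ∈ Set.Icc t₁ t₂, L2Reg 2 (f s))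
    (b2 : ∀ s ∈ Set.Icc t₁ t₂, hessSq (f s) ≤ M) (b3 : ∀ s ∈ Set.Icc t₁ t₂, SqLe (dt f s) M) :
    IntervalIntegrable (fun s => ∫ x, pd j (pd j (f s)) x * dt f s x) volume t₁ t₂ := by
  refine intervalIntegrable_of_measurable (M := M)
    (JS.stronglyMeasurable_integral (((hf.pd j).pd j).cont.mul hf.dt.cont)).measurable h
    fun s hs => ?_
  have h1 := integral_mul_le_half (((hr s hs).pderiv j).pderiv j).memLp (b3 s hs).1
  have h2 := isq_pd_pd_le_hessSq (f s) j j
  linarith [b2 s hs, (b3 s hs).2]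

lemma integral_lap_mul_dt {f : ℝ → E3 → ℝ} {s : ℝ} (hr : L2Reg 2 (f s))
    (hd : MemLp (dt f s) 2) :
    ∫ x, lap (f s) x * dt f s x = ∑ j, ∫ x, pd j (pd j (f s)) x * dt f s x := by
  rw [← integral_finsetSum _ fun j _ => ((hr.pderiv j).pderiv j).memLp.integrable_mul_two hd]
  simp only [lap, Finset.sum_mul]

/-- The energy identity for the gradient. -/
lemma gradSq_sub_eq {f : ℝ → E3 → ℝ} (hf : JS f) {t₁ t₂ M : ℝ} (h : t₁ ≤ t₂)
    (hr : ∀ s ∈ Set.Icc t₁ t₂, L2Reg 2 (f s)) (b1 : ∀ s ∈ Set.Icc t₁ t₂, gradSq (f s) ≤ M)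
    (b2 : ∀ s ∈ Set.Icc t₁ t₂, hessSq (f s) ≤ M) (b3 : ∀ s ∈ Set.Icc t₁ t₂, SqLe (dt f s) M) :
    IntervalIntegrable (fun s => ∫ x, lap (f s) x * dt f s x) volume t₁ t₂ ∧
    gradSq (f t₂) - gradSq (f t₁) = -2 * ∫ s in t₁..t₂, ∫ x, lap (f s) x * dt f s x := by
  have hI := fun j => intervalIntegrable_pd_pd_mul_dt hf h j hr b2 b3
  have e : ∀ s ∈ Set.uIcc t₁ t₂, ∑ j, ∫ x, pd j (pd j (f s)) x * dt f s x =
      ∫ x, lap (f s) x * dt f s x := fun s hs => by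
    rw [Set.uIcc_of_le h] at hs
    exact (integral_lap_mul_dt (hr s hs) (b3 s hs).1).symm
  have hS : IntervalIntegrable (fun s => ∑ j, ∫ x, pd j (pd j (f s)) x * dt f s x)
      volume t₁ t₂ := by
    have := IntervalIntegrable.sum Finset.univ fun j _ => hI j
    rwa [Finset.sum_fn] at this
  refine ⟨hS.congr fun s hs => e s (Set.uIoc_subset_uIcc hs), ?_⟩
  rw [← intervalIntegral.integral_congr e, intervalIntegral.integral_finsetSum fun j _ => hI j,
    gradSq, gradSq, ← Finset.sum_sub_distrib, Finset.mul_sum]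
  refine Finset.sum_congr rfl fun j _ => ?_
  rw [isq_pd_sub_eq hf h j hr (fun s hs => (b3 s hs).1)
    (fun s hs => (isq_pd_le_gradSq _ j).trans (b1 s hs))
    (fun s hs => (isq_pd_pd_le_hessSq _ j j).trans (b2 s hs)) (fun s hs => (b3 s hs).2),
    intervalIntegral.integral_const_mul]

namespace Slice

/-- A family of small slices solving the evolution equations for `s ∈ [a, b]`. -/
structure Evol (c δ a b : ℝ) (S : ℝ → Slice) : Prop where
  u : JS fun s => (S s).u
  v : JS fun s => (S s).v
  θ : JS fun s => (S s).θ
  good : ∀ s, Good δ (S s)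
  eq_u : ∀ s ∈ Set.Icc a b, ∀ x, dt (fun s => (S s).u) s x =
    lap (S s).u x + 2 * lap (S s).θ x + ((S s).jet x).Ru
  eq_v : ∀ s ∈ Set.Icc a b, ∀ x, dt (fun s => (S s).v) s x =
    lap (S s).v x - 2 * (S s).v x + ((S s).jet x).Rv
  eq_θ : ∀ s ∈ Set.Icc a b, ∀ x, c * dt (fun s => (S s).θ) s x =
    3 / 2 * lap (S s).θ x + 1 / 2 * lap (S s).u x + ((S s).jet x).Rθ c

lemma lap_translate (f : E3 → ℝ) (a x : E3) : lap (fun x => f (x + a)) x = lap f (x + a) := by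
  simp only [lap, pd_translate]

lemma lap_translate_sub {f : E3 → ℝ} (hf : ContDiff ℝ ∞ f) (a x : E3) :
    lap (fun x => f (x + a) - f x) x = lap f (x + a) - lap f x := by
  have hfa : ContDiff ℝ ∞ (fun x => f (x + a)) := hf.comp (contDiff_id.add contDiff_const)
  rw [lap_sub hfa hf, lap_translate]

lemma isq_translate_sub_le_four {f : E3 → ℝ} (hf : MemLp f 2) (a : E3) :
    isq (fun x => f (x + a) - f x) ≤ 4 * isq f := by
  have := (hf.sqLe.translate a).add (hf.sqLe.const_mul (-1))
  have e : ∀ x, f (x + a) + -1 * f x = f (x + a) - f x := fun x => by ring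
  simp only [e] at this
  linarith [this.2]

lemma hessSq_translate_sub_le_four {f : E3 → ℝ} (hf : L2Reg 2 f) (a : E3) :
    hessSq (fun x => f (x + a) - f x) ≤ 4 * hessSq f := by
  simp only [hessSq, Finset.mul_sum, pd_pd_translate_sub hf.smooth]
  exact Finset.sum_le_sum fun j _ => Finset.sum_le_sum fun k _ =>
    isq_translate_sub_le_four ((hf.pderiv k).pderiv j).memLp a

lemma Reg.He_diff_le_four {S : Slice} (h : Reg S) (i : Fin 3) (r : ℝ) :
    (S.diff i r).He ≤ 4 * S.He := by
  have := add_le_add (add_le_add (hessSq_translate_sub_le_four h.u.of_succ (r • ei i))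
    (hessSq_translate_sub_le_four h.v.of_succ (r • ei i)))
    (hessSq_translate_sub_le_four h.θ.of_succ (r • ei i))
  rwa [← mul_add, ← mul_add] at this

lemma Good.Gr_add_He_le {δ : ℝ} {S : Slice} (h : Good δ S) : S.Gr + S.He ≤ δ ^ 2 := by
  linarith [h.le, S.Lo_nonneg]

/-- Dissipation for translation differences. -/
lemma exists_diff_dissipation {c : ℝ} (hc : 1 < c) : ∃ δ₀ > (0 : ℝ), ∀ (δ a b : ℝ) (S : ℝ → Slice),
    0 < δ → δ ≤ δ₀ → Evol c δ a b S → ∀ (i : Fin 3) (r : ℝ), r ≠ 0 → ∀ s ∈ Set.Icc a b,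
      (SqLe (dt (fun s => ((S s).diff i r).u) s) (30 * (r ^ 2 + ((S s).diff i r).He)) ∧
        SqLe (dt (fun s => ((S s).diff i r).v) s) (30 * (r ^ 2 + ((S s).diff i r).He)) ∧
        SqLe (dt (fun s => ((S s).diff i r).θ) s) (30 * (r ^ 2 + ((S s).diff i r).He))) ∧
      1 / 20 * ((S s).diff i r).He - r ^ 2 ≤
        (∫ x, lap ((S s).diff i r).u x * dt (fun s => ((S s).diff i r).u) s x) +
        (∫ x, lap ((S s).diff i r).v x * dt (fun s => ((S s).diff i r).v) s x) +
        2 * c * ∫ x, lap ((S s).diff i r).θ x * dt (fun s => ((S s).diff i r).θ) s x := by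
  obtain ⟨C, hC, δ₁, hδ₁, hR⟩ := exists_sqLe_R_sub (by linarith : 0 ≤ c)
  refine ⟨min δ₁ (min 1 (1 / (720 * C))), by positivity,
    fun δ a b S hδ hδ₀ hS i r hr s hs => ?_⟩
  have l1 : δ ≤ δ₁ := hδ₀.trans (min_le_left _ _)
  have l2 : δ ≤ 1 := hδ₀.trans ((min_le_right _ _).trans (min_le_left _ _))
  have l3 : δ ≤ 1 / (720 * C) := hδ₀.trans ((min_le_right _ _).trans (min_le_right _ _))
  have hδ2 : δ ^ 2 ≤ δ := by nlinarith
  have hδ21 : δ ^ 2 ≤ 1 := hδ2.trans l2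
  have hCδ : 720 * (C * δ ^ 2) ≤ 1 := by
    rw [le_div_iff₀ (by positivity)] at l3
    nlinarith
  have hg := hS.good s
  set D := (S s).diff i r with hD
  have hDr : Reg D := hg.toReg.diff i r
  have hHe := D.He_nonneg
  have hr2 : 0 < r ^ 2 := by positivity
  have hLG : D.Lo + D.Gr ≤ r ^ 2 := by
    have h1 := hg.toReg.Lo_diff_le i r
    have h2 := hg.toReg.Gr_diff_le i r
    have h3 := hg.Gr_add_He_le
    have : r ^ 2 * ((S s).Gr + (S s).He) ≤ r ^ 2 * 1 := by gcongr; linarith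
    linarith
  have hσ : √(r ^ 2 + D.He) ^ 2 = r ^ 2 + D.He := Real.sq_sqrt (by positivity)
  obtain ⟨q1, q2, q3⟩ := hR δ (√(r ^ 2 + D.He)) (S s) (r • ei i) hδ l1 (by positivity) hg
    (by rw [hσ]; change D.Lo + D.Gr + D.He ≤ _; linarith)
  rw [hσ] at q1 q2 q3
  have hb : C * δ ^ 2 * (r ^ 2 + D.He) ≤ 1 / 720 * (r ^ 2 + D.He) := by gcongr; linarith
  have eu : ∀ x, dt (fun s => ((S s).diff i r).u) s x =
      lap D.u x + 2 * lap D.θ x + (((S s).translate (r • ei i)).jet x).Ru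
        - ((S s).jet x).Ru := fun x => by
    have e1 : lap D.u x = _ := lap_translate_sub hg.u.smooth (r • ei i) x
    have e2 : lap D.θ x = _ := lap_translate_sub hg.θ.smooth (r • ei i) x
    have e3 : dt (fun s => ((S s).diff i r).u) s x = _ :=
      dt_sub (hS.u.translate (r • ei i)) hS.u s x
    rw [e3, dt_translate (fun s => (S s).u), hS.eq_u s hs, hS.eq_u s hs, e1, e2, jet_translate]
    ring
  have ev : ∀ x, dt (fun s => ((S s).diff i r).v) s x =
      lap D.v x - 2 * D.v x + ((((S s).translate (r • ei i)).jet x).Rv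
        - ((S s).jet x).Rv) := fun x => by
    have e1 : lap D.v x = _ := lap_translate_sub hg.v.smooth (r • ei i) x
    have e2 : D.v x = (S s).v (x + r • ei i) - (S s).v x := rfl
    have e3 : dt (fun s => ((S s).diff i r).v) s x = _ :=
      dt_sub (hS.v.translate (r • ei i)) hS.v s x
    rw [e3, dt_translate (fun s => (S s).v), hS.eq_v s hs, hS.eq_v s hs, e1, e2, jet_translate]
    ring
  have eθ : ∀ x, c * dt (fun s => ((S s).diff i r).θ) s x =
      3 / 2 * lap D.θ x + 1 / 2 * lap D.u x + ((((S s).translate (r • ei i)).jet x).Rθ c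
        - ((S s).jet x).Rθ c) := fun x => by
    have e1 : lap D.u x = _ := lap_translate_sub hg.u.smooth (r • ei i) x
    have e2 : lap D.θ x = _ := lap_translate_sub hg.θ.smooth (r • ei i) x
    have e3 : dt (fun s => ((S s).diff i r).θ) s x = _ :=
      dt_sub (hS.θ.translate (r • ei i)) hS.θ s x
    rw [e3, dt_translate (fun s => (S s).θ), mul_sub, hS.eq_θ s hs, hS.eq_θ s hs, e1, e2,
      jet_translate]
    ring
  obtain ⟨⟨s1, s2, s3⟩, hdis⟩ := hDr.dissipation hc (q1.le hb) (q2.le hb) (q3.le hb)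
    (fun x => (eu x).trans (by ring)) ev eθ
  have hle : 15 * (D.He + D.Lo + 1 / 720 * (r ^ 2 + D.He)) ≤ 30 * (r ^ 2 + D.He) := by
    linarith [D.Gr_nonneg]
  exact ⟨⟨s1.le hle, s2.le hle, s3.le hle⟩, by linarith [gradSq_nonneg D.v]⟩

end Slice

/-! ### Third derivatives and continuity in time -/

namespace Slice

variable {c δ a b : ℝ} {S : ℝ → Slice}

lemma hessSq_u_le_He (S : Slice) : hessSq S.u ≤ S.He := by
  unfold He; linarith [hessSq_nonneg S.v, hessSq_nonneg S.θ]

lemma hessSq_v_le_He (S : Slice) : hessSq S.v ≤ S.He := by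
  unfold He; linarith [hessSq_nonneg S.u, hessSq_nonneg S.θ]

lemma hessSq_θ_le_He (S : Slice) : hessSq S.θ ≤ S.He := by
  unfold He; linarith [hessSq_nonneg S.u, hessSq_nonneg S.v]

lemma gradSq_u_le_Gr (S : Slice) : gradSq S.u ≤ S.Gr := by
  unfold Gr; linarith [gradSq_nonneg S.v, gradSq_nonneg S.θ]

lemma gradSq_v_le_Gr (S : Slice) : gradSq S.v ≤ S.Gr := by
  unfold Gr; linarith [gradSq_nonneg S.u, gradSq_nonneg S.θ]

lemma gradSq_θ_le_Gr (S : Slice) : gradSq S.θ ≤ S.Gr := by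
  unfold Gr; linarith [gradSq_nonneg S.u, gradSq_nonneg S.v]

lemma measurable_He (hu : JS fun s => (S s).u) (hv : JS fun s => (S s).v)
    (hθ : JS fun s => (S s).θ) : Measurable fun s => (S s).He :=
  ((measurable_hessSq hu).add (measurable_hessSq hv)).add (measurable_hessSq hθ)

/-- Uniform bounds for translation differences, and the integrated dissipation. -/
lemma exists_integral_He_diff_le (hc : 1 < c) : ∃ δ₀ > (0 : ℝ), δ₀ ≤ 1 ∧
    ∀ (δ a b : ℝ) (S : ℝ → Slice), 0 < δ → δ ≤ δ₀ → a ≤ b → Evol c δ a b S →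
    ∀ (i : Fin 3) (r : ℝ), r ≠ 0 →
      (∀ s ∈ Set.Icc a b,
        SqLe (dt (fun s => ((S s).diff i r).u) s) (30 * (r ^ 2 + ((S s).diff i r).He)) ∧
        SqLe (dt (fun s => ((S s).diff i r).v) s) (30 * (r ^ 2 + ((S s).diff i r).He)) ∧
        SqLe (dt (fun s => ((S s).diff i r).θ) s) (30 * (r ^ 2 + ((S s).diff i r).He))) ∧
      IntervalIntegrable (fun s => ((S s).diff i r).He) volume a b ∧
      ∫ s in a..b, ((S s).diff i r).He ≤ r ^ 2 * (20 * (c + (b - a))) := by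
  obtain ⟨δ₀, hδ₀, H⟩ := exists_diff_dissipation hc
  refine ⟨min δ₀ 1, by positivity, min_le_right _ _, fun δ a b S hδ hle hab hS i r hr => ?_⟩
  have l1 : δ ≤ 1 := hle.trans (min_le_right _ _)
  have hδ2 : δ ^ 2 ≤ 1 := by nlinarith
  have hd := H δ a b S hδ (hle.trans (min_le_left _ _)) hS i r hr
  have hr2 : 0 ≤ r ^ 2 := sq_nonneg r
  set D : ℝ → Slice := fun s => (S s).diff i r with hD
  have Du : JS fun s => (D s).u := (hS.u.translate (r • ei i)).sub hS.u
  have Dv : JS fun s => (D s).v := (hS.v.translate (r • ei i)).sub hS.v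
  have Dθ : JS fun s => (D s).θ := (hS.θ.translate (r • ei i)).sub hS.θ
  have hreg : ∀ s, Reg (D s) := fun s => (hS.good s).toReg.diff i r
  have hHe : ∀ s, (D s).He ≤ 4 := fun s => by
    have := (hS.good s).toReg.He_diff_le_four i r
    linarith [(hS.good s).Gr_add_He_le, (S s).Gr_nonneg]
  have hGr : ∀ s, (D s).Gr ≤ r ^ 2 := fun s => by
    have h1 := (hS.good s).toReg.Gr_diff_le i r
    have : r ^ 2 * (S s).He ≤ r ^ 2 * 1 :=
      mul_le_mul_of_nonneg_left (by linarith [(hS.good s).Gr_add_He_le, (S s).Gr_nonneg]) hr2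
    exact h1.trans (by linarith)
  have hM : ∀ s, 30 * (r ^ 2 + (D s).He) ≤ 30 * (r ^ 2 + 4) := fun s => by linarith [hHe s]
  obtain ⟨iu, eu⟩ := gradSq_sub_eq (M := 30 * (r ^ 2 + 4)) Du hab
    (fun s _ => (hreg s).u.of_succ) (fun s _ => by linarith [gradSq_u_le_Gr (D s), hGr s])
    (fun s _ => by linarith [hessSq_u_le_He (D s), hHe s])
    (fun s hs => (hd s hs).1.1.le (hM s))
  obtain ⟨iv, ev⟩ := gradSq_sub_eq (M := 30 * (r ^ 2 + 4)) Dv hab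
    (fun s _ => (hreg s).v.of_succ) (fun s _ => by linarith [gradSq_v_le_Gr (D s), hGr s])
    (fun s _ => by linarith [hessSq_v_le_He (D s), hHe s])
    (fun s hs => (hd s hs).1.2.1.le (hM s))
  obtain ⟨iθ, eθ⟩ := gradSq_sub_eq (M := 30 * (r ^ 2 + 4)) Dθ hab
    (fun s _ => (hreg s).θ.of_succ) (fun s _ => by linarith [gradSq_θ_le_Gr (D s), hGr s])
    (fun s _ => by linarith [hessSq_θ_le_He (D s), hHe s])
    (fun s hs => (hd s hs).1.2.2.le (hM s))
  have iH : IntervalIntegrable (fun s => (D s).He) volume a b :=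
    intervalIntegrable_of_measurable (M := 4) (measurable_He Du Dv Dθ) hab fun s _ => by
      rw [abs_of_nonneg (He_nonneg _)]; exact hHe s
  refine ⟨fun s hs => (hd s hs).1, iH, ?_⟩
  have key := intervalIntegral.integral_mono_on hab
    ((iH.const_mul (1 / 20)).sub (intervalIntegrable_const (c := r ^ 2)))
    ((iu.add iv).add (iθ.const_mul (2 * c))) fun s hs => (hd s hs).2
  rw [intervalIntegral.integral_sub (iH.const_mul _) intervalIntegrable_const,
    intervalIntegral.integral_add (iu.add iv) (iθ.const_mul _), intervalIntegral.integral_add iu iv,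
    intervalIntegral.integral_const_mul, intervalIntegral.integral_const_mul,
    intervalIntegral.integral_const, smul_eq_mul] at key
  have hG := hGr a
  unfold Gr at hG
  have n1 := gradSq_nonneg (D b).u
  have n2 := gradSq_nonneg (D b).v
  have n3 := mul_nonneg (by linarith : 0 ≤ c) (gradSq_nonneg (D b).θ)
  have n4 := mul_nonneg (by linarith : 0 ≤ c - 1) (gradSq_nonneg (D a).u)
  have n5 := mul_nonneg (by linarith : 0 ≤ c - 1) (gradSq_nonneg (D a).v)
  have n6 := mul_le_mul_of_nonneg_left hG (by linarith : 0 ≤ c)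
  have n7 := gradSq_nonneg (D a).u
  have n8 := gradSq_nonneg (D a).v
  have n9 : c * _ = c * _ := congrArg (c * ·) eθ
  nlinarith

/-- Integrability in time of the third derivatives. -/
lemma exists_intervalIntegrable_He_pderiv (hc : 1 < c) : ∃ δ₀ > (0 : ℝ), δ₀ ≤ 1 ∧
    ∀ (δ a b : ℝ) (S : ℝ → Slice), 0 < δ → δ ≤ δ₀ → a ≤ b → Evol c δ a b S → ∀ i : Fin 3,
      IntervalIntegrable (fun s => ((S s).pderiv i).He) volume a b ∧
      ∀ r : ℝ, r ≠ 0 → ∀ s ∈ Set.Icc a b,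
        SqLe (dt (fun s => ((S s).diff i r).u) s) (30 * (r ^ 2 + ((S s).diff i r).He)) ∧
        SqLe (dt (fun s => ((S s).diff i r).v) s) (30 * (r ^ 2 + ((S s).diff i r).He)) ∧
        SqLe (dt (fun s => ((S s).diff i r).θ) s) (30 * (r ^ 2 + ((S s).diff i r).He)) := by
  obtain ⟨δ₀, hδ₀, hδ₁, H⟩ := exists_integral_He_diff_le hc
  refine ⟨δ₀, hδ₀, hδ₁, fun δ a b S hδ hle hab hS i =>
    ⟨?_, fun r hr => (H δ a b S hδ hle hab hS i r hr).1⟩⟩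
  replace H := fun r hr => (H δ a b S hδ hle hab hS i r hr).2
  have hm : Measurable fun s => ((S s).pderiv i).He :=
    measurable_He (S := fun s => (S s).pderiv i) (hS.u.pd i) (hS.v.pd i) (hS.θ.pd i)
  have hmD : ∀ r, Measurable fun s => ((S s).diff i r).He := fun r =>
    measurable_He (S := fun s => (S s).diff i r) ((hS.u.translate (r • ei i)).sub hS.u)
      ((hS.v.translate (r • ei i)).sub hS.v) ((hS.θ.translate (r • ei i)).sub hS.θ)
  let ρ : ℕ → ℝ := fun n => 1 / ((n : ℝ) + 1)
  have hρ : ∀ n, ρ n ≠ 0 := fun n => by positivity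
  have hρt : Tendsto ρ atTop (𝓝[≠] 0) :=
    tendsto_nhdsWithin_iff.2 ⟨tendsto_one_div_add_atTop_nhds_zero_nat, .of_forall hρ⟩
  rw [intervalIntegrable_iff_integrableOn_Ioc_of_le hab]
  refine ⟨hm.aestronglyMeasurable, ?_⟩
  rw [hasFiniteIntegral_iff_ofReal (.of_forall fun s => He_nonneg _)]
  have hlim : ∀ s, ENNReal.ofReal ((S s).pderiv i).He =
      liminf (fun n => ENNReal.ofReal (((S s).diff i (ρ n)).He / ρ n ^ 2)) atTop := fun s =>
    (Tendsto.liminf_eq (ENNReal.tendsto_ofReal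
      (((hS.good s).toReg.tendsto_He_diff i).comp hρt))).symm
  simp only [hlim]
  refine (lintegral_liminf_le fun n => ((hmD (ρ n)).div_const _).ennreal_ofReal).trans_lt ?_
  refine lt_of_le_of_lt (b := ENNReal.ofReal (20 * (c + (b - a)))) ?_ ENNReal.ofReal_lt_top
  refine liminf_le_of_frequently_le' (Frequently.of_forall fun n => ?_)
  obtain ⟨h1, h2⟩ := H (ρ n) (hρ n)
  have h3 := ((intervalIntegrable_iff_integrableOn_Ioc_of_le hab).1 h1).div_const (ρ n ^ 2)
  rw [← ofReal_integral_eq_lintegral_ofReal h3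
    (.of_forall fun s => div_nonneg (He_nonneg _) (sq_nonneg _))]
  refine ENNReal.ofReal_le_ofReal ?_
  rw [integral_div, ← intervalIntegral.integral_of_le hab,
    div_le_iff₀ (pow_pos (abs_pos.2 (hρ n)) 2 |>.trans_eq (sq_abs _))]
  linarith

end Slice

/-- If `‖∂ⱼ²(τ f - f)‖² + ‖∂ₛ(τ f - f)‖² ≤ r² g` for every translation by `r` in direction `j`,
then `g` controls the variation of `‖∂ⱼ²f‖²`. -/
lemma abs_isq_pd_pd_sub_le {f : ℝ → E3 → ℝ} (hf : JS f) {t₁ t₂ : ℝ} (h : t₁ ≤ t₂) (j : Fin 3)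
    (hr : ∀ s ∈ Set.Icc t₁ t₂, L2Reg 3 (f s)) {g : ℝ → ℝ} (hg : IntervalIntegrable g volume t₁ t₂)
    (hd : ∀ r : ℝ, r ≠ 0 → ∀ s ∈ Set.Icc t₁ t₂,
      SqLe (dt (fun s x => f s (x + r • ei j) - f s x) s) (g s * r ^ 2 -
        isq (pd j (pd j fun x => f s (x + r • ei j) - f s x))))
    (hM : ∀ r : ℝ, r ≠ 0 → ∃ M, ∀ s ∈ Set.Icc t₁ t₂,
      isq (pd j fun x => f s (x + r • ei j) - f s x) ≤ M ∧
      isq (pd j (pd j fun x => f s (x + r • ei j) - f s x)) ≤ M ∧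
      isq (dt (fun s x => f s (x + r • ei j) - f s x) s) ≤ M) :
    |isq (pd j (pd j (f t₂))) - isq (pd j (pd j (f t₁)))| ≤ ∫ s in t₁..t₂, g s := by
  have hlim : ∀ s ∈ Set.Icc t₁ t₂, Tendsto (fun r : ℝ =>
      isq (pd j fun x => f s (x + r • ei j) - f s x) / r ^ 2) (𝓝[≠] 0)
      (𝓝 (isq (pd j (pd j (f s))))) := fun s hs => by
    have h1 := (hr s hs).pderiv j
    have := tendsto_isq_translate_sub h1.smooth h1.memLp j (h1.pderiv j).memLp
    refine this.congr fun r => ?_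
    rw [show (pd j fun x => f s (x + r • ei j) - f s x) = fun x =>
      pd j (f s) (x + r • ei j) - pd j (f s) x from pd_translate_sub (hr s hs).smooth _ j]
  refine le_of_tendsto ((hlim t₂ ⟨h, le_rfl⟩).sub (hlim t₁ ⟨le_rfl, h⟩)).abs ?_
  filter_upwards [self_mem_nhdsWithin] with r hr0
  obtain ⟨M, hM⟩ := hM r hr0
  have hDr : ∀ s ∈ Set.Icc t₁ t₂, L2Reg 3 (fun x => f s (x + r • ei j) - f s x) := fun s hs =>
    ((hr s hs).translate _).sub (hr s hs)
  have e := isq_pd_sub_eq ((hf.translate (r • ei j)).sub hf) h j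
    (fun s hs => (hDr s hs).of_succ) (fun s hs => (hd r hr0 s hs).1)
    (fun s hs => (hM s hs).1) (fun s hs => (hM s hs).2.1) (fun s hs => (hM s hs).2.2)
  have hr2 : 0 < r ^ 2 := pow_pos (abs_pos.2 hr0) 2 |>.trans_eq (sq_abs _)
  rw [← sub_div, e, abs_div, abs_of_pos hr2, div_le_iff₀ hr2, ← intervalIntegral.integral_mul_const,
    ← Real.norm_eq_abs]
  refine intervalIntegral.norm_integral_le_of_norm_le h (.of_forall fun s hs => ?_)
    (hg.mul_const _)
  have hs' : s ∈ Set.Icc t₁ t₂ := ⟨hs.1.le, hs.2⟩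
  have h1 := integral_mul_le_half ((((hDr s hs').pderiv j).pderiv j).memLp) (hd r hr0 s hs').1
  rw [Real.norm_eq_abs, abs_mul, abs_neg, abs_two]
  linarith [(hd r hr0 s hs').2]

/-- A function whose variation is controlled by the integral of an integrable function is
continuous. -/
lemma continuousOn_of_abs_sub_le {A g : ℝ → ℝ} {a b : ℝ} (hab : a ≤ b)
    (hg : IntervalIntegrable g volume a b)
    (h : ∀ t₁ t₂, a ≤ t₁ → t₁ ≤ t₂ → t₂ ≤ b → |A t₂ - A t₁| ≤ ∫ s in t₁..t₂, g s) :
    ContinuousOn A (Set.Icc a b) := by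
  have hG : ContinuousOn (fun t => ∫ s in a..t, g s) (Set.Icc a b) := by
    have := intervalIntegral.continuousOn_primitive_interval (μ := volume) (f := g) (a := a)
      (b := b) (by
        rw [Set.uIcc_of_le hab, integrableOn_Icc_iff_integrableOn_Ioc]
        exact (intervalIntegrable_iff_integrableOn_Ioc_of_le hab).1 hg)
    rwa [Set.uIcc_of_le hab] at this
  have hi : ∀ t ∈ Set.Icc a b, IntervalIntegrable g volume a t := fun t ht =>
    hg.mono_set (by
      rw [Set.uIcc_of_le hab, Set.uIcc_of_le ht.1]; exact Set.Icc_subset_Icc_right ht.2)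
  have hle : ∀ t ∈ Set.Icc a b, ∀ s ∈ Set.Icc a b,
      |A t - A s| ≤ |(∫ r in a..t, g r) - ∫ r in a..s, g r| := fun t ht s hs => by
    rw [intervalIntegral.integral_interval_sub_left (hi t ht) (hi s hs)]
    rcases le_total s t with hst | hst
    · exact (h s t hs.1 hst ht.2).trans (le_abs_self _)
    · rw [abs_sub_comm, intervalIntegral.integral_symm, abs_neg]
      exact (h t s ht.1 hst hs.2).trans (le_abs_self _)
  intro s hs
  have h0 : Tendsto (fun t => |(∫ r in a..t, g r) - ∫ r in a..s, g r|) (𝓝[Set.Icc a b] s) (𝓝 0) := by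
    have := ((hG s hs).sub_const (∫ r in a..s, g r)).abs
    simpa using this
  refine tendsto_iff_dist_tendsto_zero.2 (squeeze_zero' (.of_forall fun _ => dist_nonneg) ?_ h0)
  filter_upwards [self_mem_nhdsWithin] with t ht
  exact hle t ht s hs

/-- Continuity in time of `∫ Δf ∂ₛf`. -/
lemma continuousOn_integral_lap_mul_dt {f : ℝ → E3 → ℝ} (hf : JS f) {a b M : ℝ}
    (hr : ∀ s ∈ Set.Icc a b, L2Reg 2 (f s))
    (hA : ∀ j, ContinuousOn (fun s => isq (pd j (pd j (f s)))) (Set.Icc a b))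
    (hd : ∀ s ∈ Set.Icc a b, SqLe (dt f s) M) :
    ContinuousOn (fun s => ∫ x, lap (f s) x * dt f s x) (Set.Icc a b) := by
  have : ContinuousOn (fun s => ∑ j, ∫ x, pd j (pd j (f s)) x * dt f s x) (Set.Icc a b) := by
    refine continuousOn_finsetSum _ fun j _ => ?_
    rw [continuousOn_iff_continuous_domRestrict, continuous_iff_continuousAt]
    intro t
    refine tendsto_integral_mul (M := M) (F := fun s : Set.Icc a b => pd j (pd j (f s)))
      (G := fun s : Set.Icc a b => dt f s)
      (fun s => (((hr s s.2).pderiv j).pderiv j).memLp) (fun s => (hd s s.2).1)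
      (((hr t t.2).pderiv j).pderiv j).memLp (hd t t.2).1 (fun x => ?_) (fun x => ?_)
      ((continuousOn_iff_continuous_domRestrict.1 (hA j)).tendsto t)
      (.of_forall fun s => (hd s s.2).2)
    · exact (((hf.pd j).pd j).cont.comp
        (continuous_subtype_val.prodMk continuous_const)).tendsto t
    · exact (hf.dt.cont.comp (continuous_subtype_val.prodMk continuous_const)).tendsto t
  exact this.congr fun s hs => integral_lap_mul_dt (hr s hs) (hd s hs).1

/-- The differentiated energy identity. -/
lemma hasDerivAt_gradSq {f : ℝ → E3 → ℝ} (hf : JS f) {a b M t : ℝ} (ht : t ∈ Set.Ioo a b)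
    (hr : ∀ s ∈ Set.Icc a b, L2Reg 2 (f s))
    (hA : ∀ j, ContinuousOn (fun s => isq (pd j (pd j (f s)))) (Set.Icc a b))
    (b1 : ∀ s ∈ Set.Icc a b, gradSq (f s) ≤ M)
    (b2 : ∀ s ∈ Set.Icc a b, hessSq (f s) ≤ M) (b3 : ∀ s ∈ Set.Icc a b, SqLe (dt f s) M) :
    HasDerivAt (fun s => gradSq (f s)) (-2 * ∫ x, lap (f t) x * dt f t x) t := by
  have hc := continuousOn_integral_lap_mul_dt hf hr hA b3
  have hI : ∀ s ∈ Set.Icc a b, _ := fun s (hs : s ∈ Set.Icc a b) =>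
    gradSq_sub_eq (t₁ := a) (t₂ := s) (M := M) hf hs.1 (fun r hr' => hr r ⟨hr'.1, hr'.2.trans hs.2⟩)
      (fun r hr' => b1 r ⟨hr'.1, hr'.2.trans hs.2⟩) (fun r hr' => b2 r ⟨hr'.1, hr'.2.trans hs.2⟩)
      (fun r hr' => b3 r ⟨hr'.1, hr'.2.trans hs.2⟩)
  have hsm : StronglyMeasurable fun s => ∫ x, lap (f s) x * dt f s x :=
    JS.stronglyMeasurable_integral (F := fun s x => lap (f s) x * dt f s x)
      ((lap_cont hf).mul hf.dt.cont)
  have h1 := intervalIntegral.integral_hasDerivAt_right (hI t ⟨ht.1.le, ht.2.le⟩).1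
    (hsm.stronglyMeasurableAtFilter) (hc.continuousAt (Icc_mem_nhds ht.1 ht.2))
  refine ((h1.const_mul (-2)).add_const (gradSq (f a))).congr_of_eventuallyEq ?_
  filter_upwards [Icc_mem_nhds ht.1 ht.2] with s hs
  linarith [(hI s hs).2]

/-! ### The estimate for families of slices -/

namespace Slice

variable {c δ a b : ℝ} {S : ℝ → Slice}

lemma Good.mono {δ' : ℝ} {S : Slice} (h : Good δ S) (hδ : 0 ≤ δ) (hle : δ ≤ δ') : Good δ' S :=
  ⟨h.toReg, h.φ_smooth, h.φ_newton, h.φ_memLp, h.le.trans (by gcongr), h.φ_le.trans (by gcongr)⟩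

lemma Evol.continuousOn_isq_pd_pd (hδ : 0 < δ) (hδ1 : δ ≤ 1) (hab : a ≤ b) (hS : Evol c δ a b S)
    (j : Fin 3) (hi : IntervalIntegrable (fun s => ((S s).pderiv j).He) volume a b)
    {f : ℝ → E3 → ℝ} (hf : JS f) (hr : ∀ s, L2Reg 3 (f s))
    (hgr : ∀ r : ℝ, ∀ s, gradSq (fun x => f s (x + r • ei j) - f s x) ≤ ((S s).diff j r).Gr)
    (hhe : ∀ r : ℝ, ∀ s, hessSq (fun x => f s (x + r • ei j) - f s x) ≤ ((S s).diff j r).He)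
    (hd : ∀ r : ℝ, r ≠ 0 → ∀ s ∈ Set.Icc a b,
      SqLe (dt (fun s x => f s (x + r • ei j) - f s x) s) (30 * (r ^ 2 + ((S s).diff j r).He))) :
    ContinuousOn (fun s => isq (pd j (pd j (f s)))) (Set.Icc a b) := by
  have hδ2 : δ ^ 2 ≤ 1 := by nlinarith
  have hg := (intervalIntegrable_const (c := (1 : ℝ)) (μ := volume) (a := a) (b := b)).add hi
    |>.const_mul 31
  refine continuousOn_of_abs_sub_le hab hg fun t₁ t₂ h1 h12 h2 => ?_
  have hsub : ∀ s ∈ Set.Icc t₁ t₂, s ∈ Set.Icc a b := fun s hs => ⟨h1.trans hs.1, hs.2.trans h2⟩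
  refine abs_isq_pd_pd_sub_le hf h12 j (fun s _ => hr s) (hg.mono_set ?_)
    (fun r hr0 s hs => (hd r hr0 s (hsub s hs)).le ?_)
    fun r hr0 => ⟨30 * (r ^ 2 + 4), fun s hs => ?_⟩
  · rw [Set.uIcc_of_le hab, Set.uIcc_of_le h12]
    exact hsub
  · have e1 := (hS.good s).toReg.He_diff_le j r
    have e2 := (isq_pd_pd_le_hessSq _ j j).trans (hhe r s)
    have := sq_nonneg r
    have e3 : 31 * (1 + ((S s).pderiv j).He) * r ^ 2 = 31 * r ^ 2 + 31 * (r ^ 2 * ((S s).pderiv j).He) := by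
      ring
    rw [e3]
    linarith
  · have e1 := (isq_pd_pd_le_hessSq _ j j).trans (hhe r s)
    have e2 := (isq_pd_le_gradSq _ j).trans (hgr r s)
    have e3 := (hd r hr0 s (hsub s hs)).2
    have e4 := (hS.good s).toReg.He_diff_le_four j r
    have e5 := (hS.good s).toReg.Gr_diff_le j r
    have e6 := (hS.good s).Gr_add_He_le
    have e7 := (S s).Gr_nonneg
    have e8 : r ^ 2 * (S s).He ≤ r ^ 2 * 1 :=
      mul_le_mul_of_nonneg_left (by linarith) (sq_nonneg r)
    have := sq_nonneg r
    exact ⟨by linarith, by linarith, by linarith⟩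

/-- The first order estimate for a smooth family of slices. -/
theorem exists_estimate (hc : 1 < c) : ∃ δ₀ > (0 : ℝ), ∃ C > (0 : ℝ),
    ∀ (δ a b t : ℝ) (S : ℝ → Slice), 0 < δ → δ ≤ δ₀ → t ∈ Set.Ioo a b → Evol c δ a b S →
      ∃ E' : ℝ, HasDerivAt (fun s => gradSq (S s).u + gradSq (S s).v + 2 * c * gradSq (S s).θ) E' t ∧
        1 / 2 * E' + 1 / 20 * (S t).He + 2 * gradSq (S t).v ≤
          C * δ * ((S t).Gr + isq (S t).v + gradSq (S t).φ) := by
  obtain ⟨δ₁, hδ₁, hδ₁', H⟩ := exists_intervalIntegrable_He_pderiv hc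
  obtain ⟨C, hC, δ₂, hδ₂, hR⟩ := exists_sqLe_R (by linarith : 0 ≤ c)
  refine ⟨min δ₁ (min δ₂ (1 / (720 * C))), by positivity, 36 * C, by positivity,
    fun δ a b t S hδ hle ht hS => ?_⟩
  have l1 : δ ≤ δ₁ := hle.trans (min_le_left _ _)
  have l2 : δ ≤ δ₂ := hle.trans ((min_le_right _ _).trans (min_le_left _ _))
  have l3 : δ ≤ 1 / (720 * C) := hle.trans ((min_le_right _ _).trans (min_le_right _ _))
  have hδ1 : δ ≤ 1 := l1.trans hδ₁'
  have hδ2 : δ ^ 2 ≤ δ := by nlinarith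
  have hab : a ≤ b := (ht.1.trans ht.2).le
  have hCδ : 720 * (C * δ ^ 2) ≤ 1 := by
    rw [le_div_iff₀ (by positivity)] at l3
    nlinarith
  have hD := H δ a b S hδ l1 hab hS
  have hdis : ∀ s ∈ Set.Icc a b, _ := fun s (hs : s ∈ Set.Icc a b) => by
    obtain ⟨q1, q2, q3⟩ := hR δ (S s) hδ l2 (hS.good s)
    exact (hS.good s).toReg.dissipation hc q1 q2 q3
      (hS.eq_u s hs) (hS.eq_v s hs) (hS.eq_θ s hs)
  have hbound : ∀ s, 15 * ((S s).He + (S s).Lo +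
      C * δ ^ 2 * ((S s).He + (S s).Gr + isq (S s).v + gradSq (S s).φ)) ≤ 60 := fun s => by
    have g1 := (hS.good s).le
    have g2 := (hS.good s).φ_le
    have g3 := (S s).Lo_nonneg
    have g4 := (S s).Gr_nonneg
    have g5 := (S s).He_nonneg
    have g6 : isq (S s).v ≤ (S s).Lo := by
      unfold Lo; linarith [isq_nonneg (S s).u, isq_nonneg (S s).θ]
    have g7 : C * δ ^ 2 * ((S s).He + (S s).Gr + isq (S s).v + gradSq (S s).φ) ≤ 1 * 2 :=
      mul_le_mul (by linarith) (by linarith) (add_nonneg (add_nonneg (add_nonneg g5 g4)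
        (isq_nonneg _)) (gradSq_nonneg _)) one_pos.le
    linarith
  have hGH : ∀ s, (S s).Gr ≤ 60 ∧ (S s).He ≤ 60 := fun s => by
    have := (hS.good s).Gr_add_He_le
    exact ⟨by linarith [(S s).He_nonneg], by linarith [(S s).Gr_nonneg]⟩
  have du := hasDerivAt_gradSq (M := 60) hS.u ht (fun s _ => (hS.good s).u.of_succ)
    (fun j => hS.continuousOn_isq_pd_pd hδ hδ1 hab j (hD j).1 hS.u (fun s => (hS.good s).u)
      (fun r s => gradSq_u_le_Gr ((S s).diff j r)) (fun r s => hessSq_u_le_He ((S s).diff j r))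
      fun r hr s hs => ((hD j).2 r hr s hs).1)
    (fun s _ => (gradSq_u_le_Gr _).trans (hGH s).1) (fun s _ => (hessSq_u_le_He _).trans (hGH s).2)
    (fun s hs => (hdis s hs).1.1.le (hbound s))
  have dv := hasDerivAt_gradSq (M := 60) hS.v ht (fun s _ => (hS.good s).v.of_succ)
    (fun j => hS.continuousOn_isq_pd_pd hδ hδ1 hab j (hD j).1 hS.v (fun s => (hS.good s).v)
      (fun r s => gradSq_v_le_Gr ((S s).diff j r)) (fun r s => hessSq_v_le_He ((S s).diff j r))
      fun r hr s hs => ((hD j).2 r hr s hs).2.1)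
    (fun s _ => (gradSq_v_le_Gr _).trans (hGH s).1) (fun s _ => (hessSq_v_le_He _).trans (hGH s).2)
    (fun s hs => (hdis s hs).1.2.1.le (hbound s))
  have dθ := hasDerivAt_gradSq (M := 60) hS.θ ht (fun s _ => (hS.good s).θ.of_succ)
    (fun j => hS.continuousOn_isq_pd_pd hδ hδ1 hab j (hD j).1 hS.θ (fun s => (hS.good s).θ)
      (fun r s => gradSq_θ_le_Gr ((S s).diff j r)) (fun r s => hessSq_θ_le_He ((S s).diff j r))
      fun r hr s hs => ((hD j).2 r hr s hs).2.2)
    (fun s _ => (gradSq_θ_le_Gr _).trans (hGH s).1) (fun s _ => (hessSq_θ_le_He _).trans (hGH s).2)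
    (fun s hs => (hdis s hs).1.2.2.le (hbound s))
  refine ⟨_, (du.add dv).add (dθ.const_mul (2 * c)), ?_⟩
  have key := (hdis t ⟨ht.1.le, ht.2.le⟩).2
  have h1 : 36 * (C * δ ^ 2 * (S t).He) ≤ 1 / 20 * (S t).He := by
    have := mul_le_mul_of_nonneg_right hCδ (S t).He_nonneg
    linarith
  have h2 : C * δ ^ 2 * ((S t).Gr + isq (S t).v + gradSq (S t).φ) ≤
      C * δ * ((S t).Gr + isq (S t).v + gradSq (S t).φ) := by
    have := (S t).Gr_nonneg
    have := isq_nonneg (S t).v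
    have := gradSq_nonneg (S t).φ
    gcongr
  linarith

end Slice

/-! ### Norms of total derivatives -/

lemma norm_le_sum_norm_apply_ei {F : Type*} [NormedAddCommGroup F] [NormedSpace ℝ F]
    (L : E3 →L[ℝ] F) : ‖L‖ ≤ ∑ i, ‖L (ei i)‖ := by
  refine L.opNorm_le_bound (Finset.sum_nonneg fun _ _ => norm_nonneg _) fun x => ?_
  have e : x = ∑ i, x i • ei i := by
    ext j
    simp [ei, Pi.single_apply]
  conv_lhs => rw [e, map_sum]
  rw [Finset.sum_mul]
  refine (norm_sum_le _ _).trans (Finset.sum_le_sum fun i _ => ?_)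
  rw [map_smul, norm_smul, mul_comm]
  gcongr
  exact PiLp.norm_apply_le x i

lemma norm_iteratedFDeriv_pd_le {f : E3 → ℝ} (hf : ContDiff ℝ ∞ f) (i : Fin 3) (k : ℕ) (x : E3) :
    ‖iteratedFDeriv ℝ k (pd i f) x‖ ≤ ‖iteratedFDeriv ℝ (k + 1) f x‖ := by
  have hf' : ContDiff ℝ k (fderiv ℝ f) := hf.fderiv_right (by exact_mod_cast le_top)
  have h := (ContinuousLinearMap.apply ℝ ℝ (ei i)).norm_iteratedFDeriv_comp_left
    (f := fderiv ℝ f) (x := x) (hf'.contDiffAt) le_rfl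
  rw [norm_iteratedFDeriv_fderiv] at h
  refine h.trans (mul_le_of_le_one_left (norm_nonneg _) ?_)
  refine ContinuousLinearMap.opNorm_le_bound _ zero_le_one fun L => ?_
  have := L.le_opNorm (ei i)
  simpa [ei] using this

lemma memLp_two_of_integrable_iteratedFDeriv {f g : E3 → ℝ} {k : ℕ} (hg : Continuous g)
    (h : Integrable fun x => ‖iteratedFDeriv ℝ k f x‖ ^ 2)
    (hle : ∀ x, |g x| ≤ ‖iteratedFDeriv ℝ k f x‖) : MemLp g 2 := by
  rw [memLp_two_iff_integrable_sq hg.aestronglyMeasurable]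
  refine h.mono' (hg.pow 2).aestronglyMeasurable (.of_forall fun x => ?_)
  rw [Real.norm_eq_abs, abs_pow]
  gcongr
  exact hle x

lemma l2Reg_of_integrable {n : ℕ} : ∀ {f : E3 → ℝ}, ContDiff ℝ ∞ f →
    (∀ k ≤ n, Integrable fun x => ‖iteratedFDeriv ℝ k f x‖ ^ 2) → L2Reg n f := by
  have h0 : ∀ {f : E3 → ℝ}, ContDiff ℝ ∞ f → (Integrable fun x => ‖iteratedFDeriv ℝ 0 f x‖ ^ 2) →
      MemLp f 2 := fun hf h =>
    memLp_two_of_integrable_iteratedFDeriv hf.continuous h fun x => by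
      rw [norm_iteratedFDeriv_zero, Real.norm_eq_abs]
  induction n with
  | zero => exact fun hf h => ⟨hf, h0 hf (h 0 le_rfl)⟩
  | succ n ih =>
    refine fun {f} hf h => ⟨hf, h0 hf (h 0 (Nat.zero_le _)), fun i => ih (contDiff_pd hf i)
      fun k hk => ?_⟩
    have hc : Continuous (iteratedFDeriv ℝ k (pd i f)) :=
      (contDiff_pd hf i).continuous_iteratedFDeriv (by exact_mod_cast le_top)
    refine (h (k + 1) (by omega)).mono' (hc.norm.pow 2).aestronglyMeasurable
      (.of_forall fun x => ?_)
    rw [Real.norm_of_nonneg (sq_nonneg _)]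
    gcongr
    exact norm_iteratedFDeriv_pd_le hf i k x

lemma Dsq_zero_eq (f : E3 → ℝ) : Dsq 0 f = isq f := by
  simp only [Dsq, isq, norm_iteratedFDeriv_zero, Real.norm_eq_abs, sq_abs]

lemma Dsq_one_eq {f : E3 → ℝ} (h : ∀ i, MemLp (pd i f) 2) : Dsq 1 f = gradSq f := by
  simp only [gradSq, isq]
  rw [← integral_finsetSum _ fun i _ => (h i).integrable_sq, Dsq]
  refine integral_congr_ae (.of_forall fun x => ?_)
  simp only
  rw [norm_iteratedFDeriv_one,
    ← (InnerProductSpace.toDual ℝ E3).symm.norm_map (fderiv ℝ f x), EuclideanSpace.norm_sq_eq]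
  refine Finset.sum_congr rfl fun i _ => ?_
  have e : pd i f x = ((InnerProductSpace.toDual ℝ E3).symm (fderiv ℝ f x)) i := by
    rw [pd, ← InnerProductSpace.toDual_symm_apply, EuclideanSpace.inner_single_right, one_mul,
      conj_trivial]
  rw [e, Real.norm_eq_abs, sq_abs]

lemma hessSq_le_Dsq_two {f : E3 → ℝ} (hf : ContDiff ℝ ∞ f)
    (h : Integrable fun x => ‖iteratedFDeriv ℝ 2 f x‖ ^ 2) : hessSq f ≤ 9 * Dsq 2 f := by
  have key : ∀ i j, isq (pd i (pd j f)) ≤ Dsq 2 f := fun i j => by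
    refine integral_mono_of_nonneg (.of_forall fun _ => sq_nonneg _) h (.of_forall fun x => ?_)
    have := norm_iteratedFDeriv_pd_le (contDiff_pd hf j) i 0 x
    rw [norm_iteratedFDeriv_zero] at this
    have := this.trans (norm_iteratedFDeriv_pd_le hf j 1 x)
    rw [Real.norm_eq_abs] at this
    simp only [← sq_abs (pd i (pd j f) x)]
    gcongr
  refine (Finset.sum_le_sum fun i _ => Finset.sum_le_sum fun j _ => key i j).trans ?_
  simp only [Finset.sum_const, Finset.card_univ, Fintype.card_fin, nsmul_eq_mul]
  exact le_of_eq (by push_cast; ring)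

lemma Dsq_two_le_hessSq {f : E3 → ℝ} (hf : L2Reg 2 f) : Dsq 2 f ≤ 9 * hessSq f := by
  have hI : ∀ i j, Integrable fun x => pd i (pd j f) x ^ 2 := fun i j =>
    ((hf.pderiv j).pderiv i).memLp.integrable_sq
  have e : hessSq f = ∫ x, ∑ i, ∑ j, pd i (pd j f) x ^ 2 := by
    rw [integral_finsetSum _ fun i _ => integrable_finsetSum _ fun j _ => hI i j]
    refine Finset.sum_congr rfl fun i _ => ?_
    rw [integral_finsetSum _ fun j _ => hI i j]
    rfl
  rw [e, ← integral_const_mul]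
  refine integral_mono_of_nonneg (.of_forall fun _ => sq_nonneg _)
    ((integrable_finsetSum _ fun i _ => integrable_finsetSum _ fun j _ => hI i j).const_mul 9)
    (.of_forall fun x => ?_)
  have hd : DifferentiableAt ℝ (fderiv ℝ f) x :=
    (hf.smooth.fderiv_right (m := ∞) (by simp)).differentiable (by simp) x
  have hp : ∀ i j, fderiv ℝ (fderiv ℝ f) x (ei i) (ei j) = pd i (pd j f) x := fun i j => by
    change _ = fderiv ℝ (fun x => fderiv ℝ f x (ei j)) x (ei i)
    rw [fderiv_clm_apply hd (by fun_prop)]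
    simp
  have h1 : ‖iteratedFDeriv ℝ 2 f x‖ ≤ ∑ i, ∑ j, |pd i (pd j f) x| := by
    rw [← norm_iteratedFDeriv_fderiv (n := 1), norm_iteratedFDeriv_one]
    refine (norm_le_sum_norm_apply_ei _).trans (Finset.sum_le_sum fun i _ => ?_)
    refine (norm_le_sum_norm_apply_ei _).trans (Finset.sum_le_sum fun j _ => ?_)
    rw [hp, Real.norm_eq_abs]
  have h2 : (∑ i, ∑ j, |pd i (pd j f) x|) ^ 2 ≤ 9 * ∑ i, ∑ j, pd i (pd j f) x ^ 2 := by
    simp only [← Finset.sum_product', Finset.univ_product_univ]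
    refine (sq_sum_le_card_mul_sum_sq).trans (le_of_eq ?_)
    simp [Finset.card_univ]
  exact (pow_le_pow_left₀ (norm_nonneg _) h1 2).trans h2

/-! ### Localization in time -/

/-- A smooth map from `ℝ` to `(0, T)` which is the identity near `t`. -/
lemma exists_time_cutoff {t T : ℝ} (ht : t ∈ Set.Ioo 0 T) : ∃ ψ : ℝ → ℝ, ContDiff ℝ ∞ ψ ∧
    (∀ s, ψ s ∈ Set.Icc 0 T) ∧ ∃ r > 0, ∀ s ∈ Set.Ioo (t - r) (t + r), ψ s = s := by
  set ρ := min t (T - t) with hρ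
  have hρ0 : 0 < ρ := lt_min ht.1 (by linarith [ht.2])
  let χ : ContDiffBump t := ⟨ρ / 2, ρ, by positivity, by linarith⟩
  refine ⟨fun s => t + (s - t) * χ s, contDiff_const.add
    ((contDiff_id.sub contDiff_const).mul χ.contDiff), fun s => ?_, ρ / 2, by positivity,
    fun s hs => ?_⟩
  · have h : |(s - t) * χ s| ≤ ρ := by
      rw [abs_mul, abs_of_nonneg χ.nonneg]
      rcases le_total ρ |s - t| with h | h
      · rw [χ.zero_of_le_dist (by rwa [Real.dist_eq]), mul_zero]
        exact hρ0.le
      · exact (mul_le_of_le_one_right (abs_nonneg _) χ.le_one).trans h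
    rw [abs_le] at h
    exact ⟨by linarith [min_le_left t (T - t), h.1], by linarith [min_le_right t (T - t), h.2]⟩
  · have : χ s = 1 := χ.one_of_mem_closedBall (by
      rw [Metric.mem_closedBall, Real.dist_eq, abs_le, show χ.rIn = ρ / 2 from rfl]
      exact ⟨by linarith [hs.1], by linarith [hs.2]⟩)
    simp only [this]
    ring

lemma js_comp_time {f : ℝ → E3 → ℝ} {T : ℝ} {ψ : ℝ → ℝ}
    (hf : ContDiffOn ℝ (⊤ : ℕ∞) (fun q : ℝ × E3 => f q.1 q.2) (Set.Icc 0 T ×ˢ Set.univ))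
    (hψ : ContDiff ℝ ∞ ψ) (hψT : ∀ s, ψ s ∈ Set.Icc 0 T) : JS fun s => f (ψ s) := by
  have h : ContDiff ℝ ∞ fun q : ℝ × E3 => (ψ q.1, q.2) := (hψ.comp contDiff_fst).prodMk contDiff_snd
  exact contDiffOn_univ.1 (hf.comp h.contDiffOn fun q _ => ⟨hψT q.1, Set.mem_univ _⟩)

lemma dt_comp_time {f : ℝ → E3 → ℝ} {ψ : ℝ → ℝ} {s : ℝ} (h : ∀ᶠ r in 𝓝 s, ψ r = r) (x : E3) :
    dt (fun s => f (ψ s)) s x = deriv (fun s => f s x) s :=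
  EventuallyEq.deriv_eq (h.mono fun r hr => by simp only [hr])

/-- A time slice of a small solution is a good slice. -/
lemma IsRefSol.good {c T δ : ℝ} {u v θ φ : ℝ → E3 → ℝ} (h : IsRefSol c T u v θ φ) {s : ℝ}
    (hs : s ∈ Set.Icc 0 T)
    (hle : √(H2sq (u s) + H2sq (v s) + H2sq (θ s)) + √(Dsq 1 (φ s)) ≤ δ) :
    Slice.Good (3 * δ) ⟨u s, v s, θ s, φ s⟩ := by
  obtain ⟨hu, hv, hθ, hφ, -, hN, hI, -⟩ := h
  have sm : ∀ {f : ℝ → E3 → ℝ}, ContDiffOn ℝ (⊤ : ℕ∞) (fun q : ℝ × E3 => f q.1 q.2)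
      (Set.Icc 0 T ×ˢ Set.univ) → ContDiff ℝ ∞ (f s) := fun hf =>
    (js_comp_time (ψ := fun _ => s) hf contDiff_const fun _ => hs).space 0
  have ru := l2Reg_of_integrable (sm hu) fun k hk => (hI s hs k hk).1
  have rv := l2Reg_of_integrable (sm hv) fun k hk => (hI s hs k hk).2.1
  have rθ := l2Reg_of_integrable (sm hθ) fun k hk => (hI s hs k hk).2.2.1
  have rφ : ∀ i, MemLp (pd i (φ s)) 2 := fun i =>
    memLp_two_of_integrable_iteratedFDeriv (contDiff_pd (sm hφ) i).continuous
      (hI s hs 0 (by norm_num)).2.2.2 fun x => by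
        have := norm_iteratedFDeriv_pd_le (sm hφ) i 0 x
        rwa [norm_iteratedFDeriv_zero, Real.norm_eq_abs] at this
  have hδ : 0 ≤ δ := (add_nonneg (Real.sqrt_nonneg _) (Real.sqrt_nonneg _)).trans hle
  have h1 : H2sq (u s) + H2sq (v s) + H2sq (θ s) ≤ δ ^ 2 :=
    (Real.sqrt_le_left hδ).1 (by linarith [Real.sqrt_nonneg (Dsq 1 (φ s))])
  have h2 : Dsq 1 (φ s) ≤ δ ^ 2 := (Real.sqrt_le_left hδ).1
    (by linarith [Real.sqrt_nonneg (H2sq (u s) + H2sq (v s) + H2sq (θ s))])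
  have hH : ∀ {f : E3 → ℝ}, L2Reg 3 f → (Integrable fun x => ‖iteratedFDeriv ℝ 2 f x‖ ^ 2) →
      isq f + gradSq f + hessSq f ≤ 9 * H2sq f := fun {f} hf hi => by
    have := hessSq_le_Dsq_two hf.smooth hi
    rw [H2sq, Dsq_zero_eq, Dsq_one_eq fun i => (hf.pderiv i).memLp]
    linarith [isq_nonneg f, gradSq_nonneg f]
  have k1 := hH ru (hI s hs 2 (by norm_num)).1
  have k2 := hH rv (hI s hs 2 (by norm_num)).2.1
  have k3 := hH rθ (hI s hs 2 (by norm_num)).2.2.1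
  refine ⟨⟨ru, rv, rθ⟩, sm hφ, fun x => hN s hs x, rφ, ?_, ?_⟩
  · simp only [Slice.Lo, Slice.Gr, Slice.He]
    linarith
  · simp only
    rw [← Dsq_one_eq rφ]
    nlinarith

/-- Near any interior time, a small solution is an evolution of good slices. -/
lemma IsRefSol.exists_evol {c T δ t : ℝ} {u v θ φ : ℝ → E3 → ℝ} (h : IsRefSol c T u v θ φ)
    (hle : ∀ s ∈ Set.Icc 0 T,
      √(H2sq (u s) + H2sq (v s) + H2sq (θ s)) + √(Dsq 1 (φ s)) ≤ δ) (ht : t ∈ Set.Ioo 0 T) :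
    ∃ a b, t ∈ Set.Ioo a b ∧ ∃ S : ℝ → Slice, Slice.Evol c (3 * δ) a b S ∧
      ∀ᶠ s in 𝓝 t, S s = ⟨u s, v s, θ s, φ s⟩ := by
  obtain ⟨ψ, hψ, hψT, r, hr, hid⟩ := exists_time_cutoff ht
  have hgood := fun s => h.good (hψT s) (hle _ (hψT s))
  obtain ⟨hu, hv, hθ, -, -, -, -, -, eu, ev, eθ⟩ := h
  have hev : ∀ s ∈ Set.Icc (t - r / 2) (t + r / 2), ∀ᶠ s' in 𝓝 s, ψ s' = s' := fun s hs => by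
    filter_upwards [Ioo_mem_nhds (by linarith [hs.1] : t - r < s) (by linarith [hs.2] : s < t + r)]
      using hid
  refine ⟨t - r / 2, t + r / 2, ⟨by linarith, by linarith⟩,
    fun s => ⟨u (ψ s), v (ψ s), θ (ψ s), φ (ψ s)⟩,
    ⟨js_comp_time hu hψ hψT, js_comp_time hv hψ hψT, js_comp_time hθ hψ hψT, hgood, ?_, ?_, ?_⟩,
    (hev t ⟨by linarith, by linarith⟩).mono fun s hs => by simp only [hs]⟩
  all_goals
    intro s hs x
    have hsT : s ∈ Set.Icc 0 T := by
      have := hψT s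
      rwa [(hev s hs).self_of_nhds] at this
    simp only [dt_comp_time (hev s hs), (hev s hs).self_of_nhds, Slice.jet]
  · rw [eu s hsT x]
    simp only [Jet.Ru, dot, gdot]
    ring
  · rw [ev s hsT x]
    simp only [Jet.Rv, dot, gdot]
    ring
  · rw [eθ s hsT x]
    simp only [Jet.Rθ, dot, gdot]
    ring

/-- **Lemma (first-order derivative estimate).** There exist positive constants
`δ*, C₁, C₂` such that: if `(ũ, v, θ̃, φ)` is a solution of the reformulated
PNPF system on `[0, T]` with `‖(ũ, v, θ̃)(t)‖_{H²} + ‖∇φ(t)‖_{L²} ≤ δ ≤ δ*` for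
all `t ∈ [0, T]`, then for all `t ∈ (0, T)`:
`½ d/dt (‖∇(ũ,v)‖²_{L²} + 2c‖∇θ̃‖²_{L²}) + C₁‖∇²(ũ,v,θ̃)‖²_{L²} + C₁‖∇v‖²_{L²}
  ≤ C₂ δ (‖∇(ũ,v,θ̃)‖²_{L²} + ‖v‖²_{L²} + ‖∇φ‖²_{L²})`. -/
theorem lem_first_order_estimate (c : ℝ) (hc : 1 < c) :
    ∃ δstar > (0 : ℝ), ∃ C₁ > (0 : ℝ), ∃ C₂ > (0 : ℝ),
      ∀ (T δ : ℝ) (u v θ φ : ℝ → E3 → ℝ),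
        IsRefSol c T u v θ φ →
        δ ≤ δstar →
        (∀ t ∈ Set.Icc (0 : ℝ) T,
          Real.sqrt (H2sq (u t) + H2sq (v t) + H2sq (θ t))
            + Real.sqrt (Dsq 1 (φ t)) ≤ δ) →
        ∀ t ∈ Set.Ioo (0 : ℝ) T,
          (1 / 2) * deriv (fun s =>
              Dsq 1 (u s) + Dsq 1 (v s) + 2 * c * Dsq 1 (θ s)) t
            + C₁ * (Dsq 2 (u t) + Dsq 2 (v t) + Dsq 2 (θ t))
            + C₁ * Dsq 1 (v t)
            ≤ C₂ * δ * ((Dsq 1 (u t) + Dsq 1 (v t) + Dsq 1 (θ t))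
                + Dsq 0 (v t) + Dsq 1 (φ t)) := by

  obtain ⟨δ₀, hδ₀, C, hC, H⟩ := Slice.exists_estimate hc
  refine ⟨δ₀ / 3, by positivity, 1 / 180, by norm_num, 3 * C, by positivity,
    fun T δ u v θ φ hsol hδ hle t ht => ?_⟩
  have hδ0 : 0 ≤ δ := (add_nonneg (Real.sqrt_nonneg _) (Real.sqrt_nonneg _)).trans
    (hle t ⟨ht.1.le, ht.2.le⟩)
  obtain ⟨a, b, htab, S, hS, hev⟩ := hsol.exists_evol hle ht
  have hD1 : ∀ {f : E3 → ℝ}, L2Reg 3 f → Dsq 1 f = gradSq f := fun hf =>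
    Dsq_one_eq fun i => (hf.pderiv i).memLp
  have hg := hS.good t
  have hev_deriv : deriv (fun s => Dsq 1 (u s) + Dsq 1 (v s) + 2 * c * Dsq 1 (θ s)) t =
      deriv (fun s => gradSq (S s).u + gradSq (S s).v + 2 * c * gradSq (S s).θ) t := by
    refine EventuallyEq.deriv_eq (hev.mono fun s hs => ?_)
    have hgs := hS.good s
    simp only [hs] at hgs ⊢
    rw [hD1 hgs.u, hD1 hgs.v, hD1 hgs.θ]
  rw [hev_deriv]
  have k1 := Dsq_two_le_hessSq hg.u.of_succ
  have k2 := Dsq_two_le_hessSq hg.v.of_succ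
  have k3 := Dsq_two_le_hessSq hg.θ.of_succ
  set X := (S t).Gr + isq (S t).v + gradSq (S t).φ with hX
  have key : 1 / 2 * deriv (fun s => gradSq (S s).u + gradSq (S s).v + 2 * c * gradSq (S s).θ) t +
      1 / 20 * (S t).He + 2 * gradSq (S t).v ≤ 3 * C * δ * X := by
    rcases hδ0.eq_or_lt with h0 | h0
    · obtain ⟨E', hE, hb⟩ := H δ₀ a b t S hδ₀ le_rfl htab ⟨hS.u, hS.v, hS.θ,
        fun s => (hS.good s).mono (by linarith) (by linarith), hS.eq_u, hS.eq_v, hS.eq_θ⟩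
      have hX0 : X ≤ 0 := by
        have h1 := hg.le
        have h2 := hg.φ_le
        rw [← h0] at h1 h2
        have : isq (S t).v ≤ (S t).Lo := by
          unfold Slice.Lo; linarith [isq_nonneg (S t).u, isq_nonneg (S t).θ]
        linarith [(S t).He_nonneg]
      have : C * δ₀ * X ≤ 0 := mul_nonpos_of_nonneg_of_nonpos (by positivity) hX0
      rw [hE.deriv, ← h0]
      linarith
    · obtain ⟨E', hE, hb⟩ := H (3 * δ) a b t S (by linarith) (by linarith) htab hS
      rw [hE.deriv]
      linarith
  have e1 := hD1 hg.u
  have e2 := hD1 hg.v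
  have e3 := hD1 hg.θ
  have e4 := Dsq_one_eq hg.φ_memLp
  have e5 := Dsq_zero_eq (S t).v
  have n := gradSq_nonneg (S t).v
  simp only [hX, Slice.Gr, Slice.He, ← e1, ← e2, ← e3, ← e4, ← e5] at key n k1 k2 k3
  simp only [hev.self_of_nhds] at key n k1 k2 k3 ⊢
  linarith
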